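/- Let q ≥ 3 be a prime power and n ≥ 2 an integer such that (n,q) ≠ (2,3) and such that it is not the case that q = 3 and 5 ≤ n ≤ 14. Then ε(PSL_n(q)) > 1. -/

import Mathlib

open scoped Classical

/-- The set of irreducible complex characters of a group `G`. -/
noncomputable def IrrChar (G : Type) [Monoid G] : Set (G → ℂ) :=
  {f | ∃ V : FDRep ℂ G, CategoryTheory.Simple V ∧ f = FDRep.character V}

/-- The largest degree of a complex irreducible representation of `G`. -/
noncomputable def maxIrrDeg (G : Type) [Monoid G] : ℕ :=
  sSup {d : ℕ | ∃ V : FDRep ℂ G, CategoryTheory.Simple V ∧ Module.finrank ℂ V = d}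

/-- `ε(G)`: ratio of the sum of squares of the degrees of the irreducible characters of
degree less than the largest degree, to the square of the largest degree. -/
noncomputable def epsG (G : Type) [Monoid G] : ℝ :=
  (∑ᶠ f ∈ {f ∈ IrrChar G | (f 1).re < (maxIrrDeg G : ℝ)}, (f 1).re ^ 2) /
    ((maxIrrDeg G : ℝ)) ^ 2

section
namespace PSLeps

/-- Wedderburn data of the complex group algebra. -/
structure WD (G : Type) [Group G] [Fintype G] where
  k : ℕ
  d : Fin k → ℕ
  hd : ∀ i, 0 < d i
  Φ : MonoidAlgebra ℂ G ≃ₐ[ℂ] (∀ i, Matrix (Fin (d i)) (Fin (d i)) ℂ)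

theorem exists_WD (G : Type) [Group G] [Fintype G] : Nonempty (WD G) := by
  have : NeZero (Nat.card G : ℂ) := ⟨by simp⟩
  obtain ⟨n, d, hd, ⟨e⟩⟩ :=
    IsSemisimpleRing.exists_algEquiv_pi_matrix_of_isAlgClosed ℂ (MonoidAlgebra ℂ G)
  exact ⟨⟨n, d, fun i => Nat.pos_of_ne_zero (hd i).out, e⟩⟩

section
variable {G : Type} [Group G] [Fintype G] (W : WD G)

noncomputable def WD.tr (i : Fin W.k) (x : MonoidAlgebra ℂ G) : ℂ := (W.Φ x i).trace

/-- two sided multiplication -/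
noncomputable def sand {A : Type} [Ring A] [Algebra ℂ A] (a b : A) : A →ₗ[ℂ] A :=
  (LinearMap.mulLeft ℂ a).comp (LinearMap.mulRight ℂ b)

theorem sand_apply {A : Type} [Ring A] [Algebra ℂ A] (a b x : A) : sand a b x = a * (x * b) := rfl

theorem trace_sand_pi {k : ℕ} (d : Fin k → ℕ)
    (a b : ∀ i, Matrix (Fin (d i)) (Fin (d i)) ℂ) :
    LinearMap.trace ℂ _ (sand a b) = ∑ i, (a i).trace * (b i).trace := by
  let B := Pi.basis (fun i => Matrix.stdBasis ℂ (Fin (d i)) (Fin (d i)))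
  rw [LinearMap.trace_eq_matrix_trace ℂ B, Matrix.trace]
  rw [Fintype.sum_sigma]
  refine Finset.sum_congr rfl fun i _ => ?_
  rw [Fintype.sum_prod_type]
  simp only [Matrix.trace, Matrix.diag_apply, Finset.sum_mul_sum]
  refine Finset.sum_congr rfl fun p _ => ?_
  refine Finset.sum_congr rfl fun r _ => ?_
  rw [LinearMap.toMatrix_apply, sand_apply]
  simp only [B, Pi.basis_repr, Pi.basis_apply, Pi.mul_apply, Pi.single_eq_same,
    Matrix.stdBasis_eq_single]
  rw [← Matrix.mul_assoc]
  have : ∀ M : Matrix (Fin (d i)) (Fin (d i)) ℂ,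
      (Matrix.stdBasis ℂ (Fin (d i)) (Fin (d i))).repr M (p, r) = M p r := by
    intro M
    simp [Matrix.stdBasis]
  rw [this]
  simp [Matrix.mul_apply, Matrix.single_apply, Finset.sum_ite_eq, ite_and]


theorem trace_sand (a b : MonoidAlgebra ℂ G) :
    LinearMap.trace ℂ _ (sand a b) = ∑ i, W.tr i a * W.tr i b := by
  have h := trace_sand_pi W.d (W.Φ a) (W.Φ b)
  unfold WD.tr
  rw [← h, ← LinearMap.trace_conj' (sand a b) W.Φ.toLinearEquiv]
  congr 1
  refine LinearMap.ext fun x => ?_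
  rw [LinearEquiv.conj_apply]
  simp only [LinearMap.comp_apply, sand_apply]
  change W.Φ (a * (W.Φ.symm x * b)) = _
  simp

theorem WD.tr_one (i : Fin W.k) : W.tr i 1 = W.d i := by
  simp [WD.tr, Matrix.trace_one]

theorem WD.tr_add (i : Fin W.k) (x y : MonoidAlgebra ℂ G) :
    W.tr i (x + y) = W.tr i x + W.tr i y := by simp [WD.tr]

theorem WD.tr_smul (i : Fin W.k) (c : ℂ) (y : MonoidAlgebra ℂ G) :
    W.tr i (c • y) = c * W.tr i y := by simp [WD.tr]

theorem WD.tr_sum {ι : Type} (s : Finset ι) (i : Fin W.k) (f : ι → MonoidAlgebra ℂ G) :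
    W.tr i (∑ a ∈ s, f a) = ∑ a ∈ s, W.tr i (f a) := by
  simp [WD.tr, map_sum, Matrix.trace_sum, Finset.sum_apply]

theorem WD.tr_mul_comm (i : Fin W.k) (x y : MonoidAlgebra ℂ G) :
    W.tr i (x * y) = W.tr i (y * x) := by
  simp only [WD.tr, map_mul, Pi.mul_apply]
  exact Matrix.trace_mul_comm _ _

theorem WD.sum_tr (x : MonoidAlgebra ℂ G) :
    ∑ i, (W.d i : ℂ) * W.tr i x = Fintype.card G * x.coeff 1 := by
  have h := trace_sand W x 1
  simp only [WD.tr_one] at h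
  rw [LinearMap.trace_eq_matrix_trace ℂ (MonoidAlgebra.basis G ℂ), Matrix.trace] at h
  simp only [Matrix.diag_apply, LinearMap.toMatrix_apply, sand_apply, mul_one] at h
  have h2 : ∀ g : G, ((MonoidAlgebra.basis G ℂ).repr (x * (MonoidAlgebra.basis G ℂ) g)) g
      = x.coeff 1 := by
    intro g
    rw [MonoidAlgebra.basis_apply]
    change (x * MonoidAlgebra.single g 1).coeff g = _
    rw [MonoidAlgebra.coeff_mul_single_apply]
    simp
  simp only [h2] at h
  simp only [Finset.sum_const, Finset.card_univ, nsmul_eq_mul] at h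
  rw [h]
  exact Finset.sum_congr rfl fun i _ => mul_comm _ _

theorem WD.sum_sq : ∑ i, (W.d i) ^ 2 = Fintype.card G := by
  have h := W.sum_tr 1
  simp only [WD.tr_one, MonoidAlgebra.coeff_one_one, mul_one, ← pow_two] at h
  exact_mod_cast h

theorem idem_rank {m : ℕ} (E : Matrix (Fin m) (Fin m) ℂ) (hE : E * E = E) :
    E.trace = (Module.finrank ℂ (LinearMap.range (Matrix.toLin' E)) : ℂ) := by
  have h1 : IsIdempotentElem (Matrix.toLin' E) := by
    unfold IsIdempotentElem
    rw [Module.End.mul_eq_comp, ← Matrix.toLin'_mul, hE]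
  have h2 := (LinearMap.isProj_range_iff_isIdempotentElem _).2 h1
  rw [← h2.trace, Matrix.trace_toLin'_eq]

noncomputable def WD.rk (i : Fin W.k) (x : MonoidAlgebra ℂ G) : ℕ :=
  Module.finrank ℂ (LinearMap.range (Matrix.toLin' (W.Φ x i)))

theorem WD.tr_eq_rk (i : Fin W.k) (e : MonoidAlgebra ℂ G) (he : e * e = e) :
    W.tr i e = W.rk i e := by
  unfold WD.tr WD.rk
  rw [idem_rank]
  rw [← Pi.mul_apply, ← map_mul, he]

theorem WD.rk_eq_zero (i : Fin W.k) (e : MonoidAlgebra ℂ G) : W.rk i e = 0 ↔ W.Φ e i = 0 := by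
  unfold WD.rk
  rw [Submodule.finrank_eq_zero, LinearMap.range_eq_bot]
  exact (Matrix.toLin' (R := ℂ)).map_eq_zero_iff

theorem WD.sum_rk_sq (e : MonoidAlgebra ℂ G) (he : e * e = e) :
    ∑ i, (W.rk i e) ^ 2 = Module.finrank ℂ (LinearMap.range (sand e e)) := by
  have h1 : IsIdempotentElem (sand e e) := by
    unfold IsIdempotentElem
    refine LinearMap.ext fun x => ?_
    simp only [Module.End.mul_apply, sand_apply]
    simp only [← mul_assoc, he]
    simp only [mul_assoc, he]
  have h2 := (LinearMap.isProj_range_iff_isIdempotentElem _).2 h1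
  have h3 := h2.trace
  rw [trace_sand W] at h3
  simp only [W.tr_eq_rk _ _ he, ← pow_two] at h3
  exact_mod_cast h3

theorem WD.sum_d_rk (e : MonoidAlgebra ℂ G) (he : e * e = e) :
    ∑ i, (W.d i : ℂ) * W.rk i e = Fintype.card G * e.coeff 1 := by
  rw [← W.sum_tr]
  simp [W.tr_eq_rk _ _ he]

theorem comm_trace {m : ℕ} (E : Matrix (Fin m) (Fin m) ℂ) (hE : E * E = E)
    (h : ∀ X Y : Matrix (Fin m) (Fin m) ℂ, (E * X * E) * (E * Y * E) = (E * Y * E) * (E * X * E)) :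
    E.trace ^ 3 = E.trace := by
  have key : ∀ a b c : Fin m, E a a * E b b * E c c = E a b * E c a * E b c := by
    intro a b c
    have h1 := h (Matrix.single a b 1) (Matrix.single b c 1)
    have e1 : ∀ X Y : Matrix (Fin m) (Fin m) ℂ, (E * X * E) * (E * Y * E) = E * X * E * Y * E := by
      intro X Y
      simp only [← mul_assoc]
      rw [mul_assoc (E * X) E E, hE]
    rw [e1, e1] at h1
    have h2 := congrFun (congrFun h1 a) c
    have e2 : ∀ a b c d p r : Fin m, (E * Matrix.single a b (1:ℂ) * E * Matrix.single c d (1:ℂ) * E : Matrix (Fin m) (Fin m) ℂ) p r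
        = E p a * E b c * E d r := by
      intro a b c d p r
      simp [Matrix.mul_apply, Matrix.single_apply, ite_and, Finset.sum_mul]
    rw [e2, e2] at h2
    exact h2
  have l : E.trace ^ 3 = ∑ a, ∑ b, ∑ c, E a a * E b b * E c c := by
    rw [pow_three', Matrix.trace, Finset.sum_mul_sum, Finset.sum_mul]
    refine Finset.sum_congr rfl fun a _ => ?_
    rw [Finset.sum_mul]
    refine Finset.sum_congr rfl fun b _ => ?_
    rw [Finset.mul_sum]
    rfl
  have r : E.trace = ∑ a, ∑ b, ∑ c, E a b * E c a * E b c := by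
    have h0 : E.trace = (E * (E * E)).trace := by rw [hE, hE]
    rw [h0]
    simp only [Matrix.trace, Matrix.diag_apply, Matrix.mul_apply, Finset.mul_sum]
    refine Finset.sum_congr rfl fun a _ => ?_
    refine Finset.sum_congr rfl fun b _ => ?_
    refine Finset.sum_congr rfl fun c _ => ?_
    ring
  rw [l]
  refine Eq.trans ?_ r.symm
  exact Finset.sum_congr rfl fun a _ => Finset.sum_congr rfl fun b _ =>
    Finset.sum_congr rfl fun c _ => key a b c


theorem WD.rk_le_one (e : MonoidAlgebra ℂ G) (he : e * e = e)
    (h : ∀ x y, (e * x * e) * (e * y * e) = (e * y * e) * (e * x * e)) (i : Fin W.k) :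
    W.rk i e ≤ 1 := by
  have h1 := comm_trace (W.Φ e i) (by rw [← Pi.mul_apply, ← map_mul, he]) (by
    intro X Y
    have := h (W.Φ.symm (Pi.single i X)) (W.Φ.symm (Pi.single i Y))
    have := congrArg (fun z => W.Φ z i) this
    simpa using this)
  have h2 := W.tr_eq_rk i e he
  unfold WD.tr at h2
  rw [h2] at h1
  have h3 : (W.rk i e) ^ 3 = W.rk i e := by exact_mod_cast h1
  by_contra hc
  have h4 : 2 ≤ W.rk i e := by omega
  nlinarith [h4, h3, mul_le_mul h4 h4 (by norm_num) (by omega)]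

end
end PSLeps
end

section
namespace PSLeps
section
variable {G : Type} [Group G] [Fintype G] (W : WD G)

/-- the character of a block -/
noncomputable def WD.ch (j : Fin W.k) (g : G) : ℂ := W.tr j (MonoidAlgebra.of ℂ G g)

theorem eq_sum_of (x : MonoidAlgebra ℂ G) : x = ∑ g, x.coeff g • MonoidAlgebra.of ℂ G g := by
  have := (MonoidAlgebra.basis G ℂ).sum_repr x
  simp only [MonoidAlgebra.basis_apply] at this
  exact this.symm

theorem WD.tr_eq_sum (j : Fin W.k) (x : MonoidAlgebra ℂ G) :
    W.tr j x = ∑ g, x.coeff g * W.ch j g := by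
  conv_lhs => rw [eq_sum_of x]
  simp only [WD.tr_sum, WD.tr_smul, WD.ch]

/-- central idempotent -/
noncomputable def WD.z (j : Fin W.k) : MonoidAlgebra ℂ G := W.Φ.symm (Pi.single j 1)

theorem WD.Φz (j : Fin W.k) : W.Φ (W.z j) = Pi.single j 1 := by simp [WD.z]

theorem WD.tr_z_mul (j i : Fin W.k) (x : MonoidAlgebra ℂ G) :
    W.tr i (W.z j * x) = if i = j then W.tr i x else 0 := by
  unfold WD.tr
  rw [map_mul, WD.Φz, Pi.mul_apply]
  split_ifs with h
  · subst h; simp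
  · simp [h]

theorem WD.tr_z (j i : Fin W.k) : W.tr i (W.z j) = if i = j then (W.d i : ℂ) else 0 := by
  have := W.tr_z_mul j i 1
  rwa [mul_one, WD.tr_one] at this

theorem WD.z_coeff (j : Fin W.k) (g : G) :
    (Fintype.card G : ℂ) * (W.z j).coeff g = W.d j * W.ch j g⁻¹ := by
  have h := W.sum_tr (W.z j * MonoidAlgebra.of ℂ G g⁻¹)
  simp only [WD.tr_z_mul, mul_ite, mul_zero, Finset.sum_ite_eq', Finset.mem_univ, if_true] at h
  rw [WD.ch, h, MonoidAlgebra.of_apply, MonoidAlgebra.coeff_mul_single_apply]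
  simp

theorem WD.ch_norm (j : Fin W.k) : ∑ g, W.ch j g * W.ch j g⁻¹ = Fintype.card G := by
  have h := W.tr_eq_sum j (W.z j)
  rw [WD.tr_z, if_pos rfl] at h
  have hd : (W.d j : ℂ) ≠ 0 := by exact_mod_cast (W.hd j).ne'
  have h2 : (W.d j : ℂ) * ∑ g, W.ch j g * W.ch j g⁻¹ = W.d j * Fintype.card G := by
    conv_rhs => rw [h, Finset.sum_mul]
    rw [Finset.mul_sum]
    refine Finset.sum_congr rfl fun g _ => ?_
    have := W.z_coeff j g
    linear_combination -W.ch j g * this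
  exact mul_left_cancel₀ hd h2

theorem WD.ch_one (j : Fin W.k) : W.ch j 1 = W.d j := by
  rw [WD.ch, map_one, WD.tr_one]

theorem WD.ch_inj : Function.Injective W.ch := by
  intro i j h
  by_contra hne
  have h1 := W.tr_eq_sum i (W.z i)
  have h2 := W.tr_eq_sum j (W.z i)
  rw [← h, ← h1, WD.tr_z, WD.tr_z, if_pos rfl, if_neg (Ne.symm hne)] at h2
  exact (W.hd i).ne' (by exact_mod_cast h2.symm)

noncomputable def WD.rep (j : Fin W.k) : Representation ℂ G (Fin (W.d j) → ℂ) where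
  toFun g := Matrix.toLin' (W.Φ (MonoidAlgebra.of ℂ G g) j)
  map_one' := by
    rw [map_one, map_one, Pi.one_apply, Matrix.toLin'_one]; rfl
  map_mul' a b := by
    rw [map_mul, map_mul, Pi.mul_apply, Matrix.toLin'_mul]; rfl

theorem WD.rep_char (j : Fin W.k) : (FDRep.of (W.rep j)).character = W.ch j := by
  funext g
  have : (FDRep.of (W.rep j)).character g = LinearMap.trace ℂ (Fin (W.d j) → ℂ) (W.rep j g) := rfl
  rw [this]
  simp [WD.rep, WD.ch, WD.tr]

theorem WD.rep_simple (j : Fin W.k) : CategoryTheory.Simple (FDRep.of (W.rep j)) := by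
  have : NeZero (Nat.card G : ℂ) := ⟨by simp⟩
  rw [FDRep.simple_iff_char_is_norm_one, WD.rep_char, WD.ch_norm, Nat.card_eq_fintype_card]

theorem WD.simple_char (V : FDRep ℂ G) (hV : CategoryTheory.Simple V) :
    ∃ j, V.character = W.ch j := by
  have hn : NeZero (Nat.card G : ℂ) := ⟨by simp⟩
  by_contra hc
  push Not at hc
  have := invertibleOfNonzero (NeZero.ne (Nat.card G : ℂ))
  have key : ∀ j, ∑ g, V.character g * W.ch j g⁻¹ = 0 := by
    intro j
    have hj := W.rep_simple j
    have h1 := FDRep.char_orthonormal V (FDRep.of (W.rep j))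
    rw [if_neg] at h1
    · rw [WD.rep_char] at h1
      simpa using h1
    · rintro ⟨i⟩
      exact hc j (by rw [← WD.rep_char]; exact FDRep.char_iso i)
  have h2 : ∑ j, (W.d j : ℂ) * ∑ g, V.character g * W.ch j g⁻¹ = 0 := by simp [key]
  simp only [Finset.mul_sum] at h2
  rw [Finset.sum_comm] at h2
  have h3 : ∀ g : G, ∑ j, (W.d j : ℂ) * (V.character g * W.ch j g⁻¹)
      = V.character g * if g = 1 then (Fintype.card G : ℂ) else 0 := by
    intro g
    have := W.sum_tr (MonoidAlgebra.of ℂ G g⁻¹)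
    have e : (MonoidAlgebra.of ℂ G g⁻¹).coeff 1 = if g = 1 then 1 else 0 := by
      rw [MonoidAlgebra.of_apply, MonoidAlgebra.coeff_single, Finsupp.single_apply]
      simp
    rw [e] at this
    have e2 : ∑ j, (W.d j : ℂ) * (V.character g * W.ch j g⁻¹)
      = V.character g * ∑ j, (W.d j : ℂ) * W.ch j g⁻¹ := by
      rw [Finset.mul_sum]
      exact Finset.sum_congr rfl fun j _ => by ring
    rw [e2]
    unfold WD.ch
    rw [this]
    simp
  simp only [h3, mul_ite, mul_zero, Finset.sum_ite_eq', Finset.mem_univ, if_true] at h2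
  have h4 : V.character 1 = 0 := by
    rcases mul_eq_zero.1 h2 with h | h
    · exact h
    · simp at h
  rw [FDRep.char_one] at h4
  have h5 : Module.finrank ℂ V = 0 := by exact_mod_cast h4
  have h6 := (FDRep.simple_iff_char_is_norm_one V).1 hV
  have h7 : ∀ g, V.character g = 0 := by
    intro g
    have hs : Subsingleton V := Module.finrank_zero_iff.1 h5
    have : V.ρ g = 0 := by
      ext x
      exact Subsingleton.elim _ _
    unfold FDRep.character
    rw [this, map_zero]
  simp only [h7] at h6
  simp at h6
  exact Fintype.card_ne_zero (by exact_mod_cast h6.symm)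

theorem WD.irr : IrrChar G = Set.range W.ch := by
  ext f
  constructor
  · rintro ⟨V, hV, rfl⟩
    obtain ⟨j, hj⟩ := W.simple_char V hV
    exact ⟨j, hj.symm⟩
  · rintro ⟨j, rfl⟩
    exact ⟨_, W.rep_simple j, (W.rep_char j).symm⟩

theorem WD.degs : {d : ℕ | ∃ V : FDRep ℂ G, CategoryTheory.Simple V ∧ Module.finrank ℂ V = d}
    = Set.range W.d := by
  ext m
  constructor
  · rintro ⟨V, hV, rfl⟩
    obtain ⟨j, hj⟩ := W.simple_char V hV
    refine ⟨j, ?_⟩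
    have := FDRep.char_one V
    rw [hj, WD.ch_one] at this
    exact_mod_cast this
  · rintro ⟨j, rfl⟩
    refine ⟨_, W.rep_simple j, ?_⟩
    have := FDRep.char_one (FDRep.of (W.rep j))
    rw [WD.rep_char, WD.ch_one] at this
    exact_mod_cast this.symm

theorem WD.k_pos : 0 < W.k := by
  by_contra h
  have h0 := W.sum_sq
  have : IsEmpty (Fin W.k) := by
    rw [Nat.eq_zero_of_not_pos h]; infer_instance
  simp at h0
  exact Fintype.card_ne_zero h0.symm

theorem WD.d_le (j : Fin W.k) : W.d j ≤ maxIrrDeg G := by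
  unfold maxIrrDeg
  rw [W.degs]
  exact le_csSup (Set.finite_range _).bddAbove ⟨j, rfl⟩

theorem WD.exists_max : ∃ j, W.d j = maxIrrDeg G := by
  unfold maxIrrDeg
  rw [W.degs]
  have : Nonempty (Fin W.k) := ⟨⟨0, W.k_pos⟩⟩
  exact Nat.sSup_mem (Set.range_nonempty _) (Set.finite_range _).bddAbove

theorem WD.epsG_eq : epsG G =
    ((∑ j ∈ Finset.univ.filter (fun j => W.d j < maxIrrDeg G), (W.d j) ^ 2 : ℕ) : ℝ)
      / (maxIrrDeg G : ℝ) ^ 2 := by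
  unfold epsG
  congr 1
  have h : {f ∈ IrrChar G | (f 1).re < (maxIrrDeg G : ℝ)}
      = Set.image W.ch {j | W.d j < maxIrrDeg G} := by
    rw [W.irr]
    ext f
    constructor
    · rintro ⟨⟨j, rfl⟩, h⟩
      refine ⟨j, ?_, rfl⟩
      rw [WD.ch_one] at h
      simpa using h
    · rintro ⟨j, h, rfl⟩
      refine ⟨⟨j, rfl⟩, ?_⟩
      rw [WD.ch_one]
      simpa using h
  rw [h, finsum_mem_image W.ch_inj.injOn]
  have h2 : {j | W.d j < maxIrrDeg G} =
    ((Finset.univ.filter (fun j => W.d j < maxIrrDeg G) : Finset (Fin W.k)) : Set (Fin W.k)) := by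
    ext j; simp
  rw [h2, finsum_mem_coe_finset]
  push_cast
  refine Finset.sum_congr rfl fun j _ => ?_
  rw [WD.ch_one]
  simp

theorem WD.sum_split :
    (∑ j ∈ Finset.univ.filter (fun j => W.d j < maxIrrDeg G), (W.d j) ^ 2)
      + (Finset.univ.filter (fun j => W.d j = maxIrrDeg G)).card * (maxIrrDeg G) ^ 2
      = Fintype.card G := by
  rw [← W.sum_sq, ← Finset.sum_filter_add_sum_filter_not Finset.univ
    (fun j => W.d j < maxIrrDeg G)]
  congr 1
  have : Finset.univ.filter (fun j => W.d j = maxIrrDeg G)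
    = Finset.univ.filter (fun j => ¬ W.d j < maxIrrDeg G) := by
    ext j
    have := W.d_le j
    simp only [Finset.mem_filter, Finset.mem_univ, true_and]
    omega
  rw [← this, ← smul_eq_mul, ← Finset.sum_const]
  refine Finset.sum_congr rfl fun j hj => ?_
  rw [(Finset.mem_filter.1 hj).2]

end
end PSLeps
end

section
namespace PSLeps
section restrict
variable {H G : Type} [Group H] [Fintype H] [Group G] [Fintype G] (V : WD H) (W : WD G)
  (f : H →* G)

noncomputable def pushA : MonoidAlgebra ℂ H →ₐ[ℂ] MonoidAlgebra ℂ G :=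
  MonoidAlgebra.mapDomainAlgHom ℂ ℂ f

noncomputable def WD.E (j : Fin V.k) (a b : Fin (V.d j)) : MonoidAlgebra ℂ H :=
  V.Φ.symm (Pi.single j (Matrix.single a b 1))

theorem WD.E_mul (j : Fin V.k) (a b c : Fin (V.d j)) : V.E j a b * V.E j b c = V.E j a c := by
  unfold WD.E
  rw [← map_mul, ← Pi.single_mul]
  simp

theorem WD.sum_E : ∑ j, ∑ a, V.E j a a = 1 := by
  unfold WD.E
  simp only [← map_sum]
  rw [show (1 : MonoidAlgebra ℂ H) = V.Φ.symm 1 by simp]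
  congr 1
  funext i
  simp only [Finset.sum_apply]
  rw [Finset.sum_eq_single i]
  · simp only [Pi.single_eq_same, Pi.one_apply]
    ext p r
    rw [Matrix.sum_apply]
    simp [Matrix.single_apply, Matrix.one_apply, ite_and]
  · intro b _ hb
    refine Finset.sum_eq_zero fun a _ => ?_
    rw [Pi.single_eq_of_ne (Ne.symm hb)]
  · simp

noncomputable def WD.eps (j : Fin V.k) : MonoidAlgebra ℂ H :=
  V.E j ⟨0, V.hd j⟩ ⟨0, V.hd j⟩

theorem WD.tr_eps (i j : Fin V.k) : V.tr i (V.eps j) = if i = j then 1 else 0 := by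
  unfold WD.tr WD.eps WD.E
  simp only [AlgEquiv.apply_symm_apply]
  split_ifs with h
  · subst h; simp
  · rw [Pi.single_eq_of_ne h]; simp

/-- restriction multiplicities -/
noncomputable def mult (i : Fin W.k) (j : Fin V.k) : ℕ := W.rk i (pushA f (V.eps j))

theorem mult_eq (i : Fin W.k) (j : Fin V.k) : (mult V W f i j : ℂ) = W.tr i (pushA f (V.eps j)) := by
  rw [mult, ← W.tr_eq_rk]
  rw [← map_mul, WD.eps, WD.E_mul]

theorem mult_sum (i : Fin W.k) : ∑ j, mult V W f i j * V.d j = W.d i := by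
  have h : W.tr i (pushA f (∑ j, ∑ a, V.E j a a)) = W.d i := by
    rw [V.sum_E, map_one, W.tr_one]
  simp only [map_sum, WD.tr_sum] at h
  have h2 : ∀ j a, W.tr i (pushA f (V.E j a a)) = mult V W f i j := by
    intro j a
    rw [mult_eq, WD.eps, ← V.E_mul j ⟨0, V.hd j⟩ a, ← V.E_mul j a ⟨0, V.hd j⟩ a, map_mul, map_mul,
      W.tr_mul_comm]
  simp only [h2] at h
  simp only [Finset.sum_const, Finset.card_univ, Fintype.card_fin, nsmul_eq_mul] at h
  have : ∑ j, V.d j * mult V W f i j = W.d i := by exact_mod_cast h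
  rw [← this]
  exact Finset.sum_congr rfl fun j _ => mul_comm _ _

theorem mult_sum' (hf : Function.Injective f) (j : Fin V.k) :
    Fintype.card H * ∑ i, mult V W f i j * W.d i = Fintype.card G * V.d j := by
  have h := W.sum_tr (pushA f (V.eps j))
  have h2 := V.sum_tr (V.eps j)
  simp only [← mult_eq] at h
  simp only [WD.tr_eps, mul_ite, mul_one, mul_zero, Finset.sum_ite_eq', Finset.sum_ite_eq,
    Finset.mem_univ, if_true] at h2
  have h3 : (pushA f (V.eps j)).coeff 1 = (V.eps j).coeff 1 := by
    have : (pushA f (V.eps j)).coeff = Finsupp.mapDomain f (V.eps j).coeff := rfl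
    rw [this, show (1 : G) = f 1 by simp, Finsupp.mapDomain_apply hf]
  rw [h3] at h
  have h4 : (Fintype.card H : ℂ) * ∑ i, (W.d i : ℂ) * mult V W f i j = Fintype.card G * V.d j := by
    rw [h, h2]; ring
  have h5 : Fintype.card H * ∑ i, W.d i * mult V W f i j = Fintype.card G * V.d j := by
    exact_mod_cast h4
  rw [← h5]
  congr 1
  exact Finset.sum_congr rfl fun j _ => mul_comm _ _

theorem mass (hf : Function.Injective f) : ∃ I1 : Finset (Fin W.k), I1.Nonempty ∧
    (∀ i ∈ I1, maxIrrDeg H ≤ W.d i) ∧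
    Fintype.card H * ∑ i ∈ Finset.univ \ I1, (W.d i) ^ 2 ≤
      Fintype.card G * ∑ j ∈ Finset.univ.filter (fun j => V.d j < maxIrrDeg H), (V.d j) ^ 2 ∧
    Fintype.card H * ∑ i ∈ I1, W.d i ≤
      Fintype.card G * ((Finset.univ.filter (fun j => V.d j = maxIrrDeg H)).card * maxIrrDeg H) := by
  set b := maxIrrDeg H with hb
  set I1 : Finset (Fin W.k) :=
    Finset.univ.filter (fun i => ∃ j, V.d j = b ∧ 0 < mult V W f i j) with hI1
  have hbpos : 0 < b := by
    obtain ⟨j, hj⟩ := V.exists_max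
    rw [hb, ← hj]; exact V.hd j
  have hle : ∀ i ∈ I1, b ≤ W.d i := by
    intro i hi
    obtain ⟨j, hj, hm⟩ := (Finset.mem_filter.1 hi).2
    rw [← mult_sum V W f i, ← hj]
    calc V.d j ≤ mult V W f i j * V.d j := Nat.le_mul_of_pos_left _ hm
      _ ≤ _ := Finset.single_le_sum (f := fun j => mult V W f i j * V.d j)
        (fun _ _ => Nat.zero_le _) (Finset.mem_univ j)
  refine ⟨I1, ?_, hle, ?_, ?_⟩
  · obtain ⟨j, hj⟩ := V.exists_max
    have h := mult_sum' V W f hf j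
    by_contra hne
    rw [Finset.not_nonempty_iff_eq_empty] at hne
    have h0 : ∀ i, mult V W f i j = 0 := by
      intro i
      by_contra hc
      have : i ∈ I1 := Finset.mem_filter.2 ⟨Finset.mem_univ _, j, hj, Nat.pos_of_ne_zero hc⟩
      rw [hne] at this
      simp at this
    simp only [h0] at h
    simp only [zero_mul, Finset.sum_const_zero, mul_zero] at h
    have h9 : 0 < Fintype.card G * V.d j := Nat.mul_pos Fintype.card_pos (V.hd j)
    omega
  · have h1 : ∀ i ∈ Finset.univ \ I1, (W.d i) ^ 2 ≤
        ∑ j ∈ Finset.univ.filter (fun j => V.d j < b), mult V W f i j * V.d j * W.d i := by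
      intro i hi
      have hi' : i ∉ I1 := (Finset.mem_sdiff.1 hi).2
      have : W.d i = ∑ j ∈ Finset.univ.filter (fun j => V.d j < b), mult V W f i j * V.d j := by
        rw [← mult_sum V W f i]
        symm
        apply Finset.sum_subset (Finset.subset_univ _)
        intro j _ hj
        have hj1 : V.d j = b := by
          have := V.d_le j
          simp at hj
          omega
        have : mult V W f i j = 0 := by
          by_contra hc
          exact hi' (Finset.mem_filter.2 ⟨Finset.mem_univ _, j, hj1, Nat.pos_of_ne_zero hc⟩)
        simp [this]
      rw [pow_two, ← Finset.sum_mul, ← this]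
    calc Fintype.card H * ∑ i ∈ Finset.univ \ I1, (W.d i) ^ 2
        ≤ Fintype.card H * ∑ i ∈ Finset.univ \ I1,
          ∑ j ∈ Finset.univ.filter (fun j => V.d j < b), mult V W f i j * V.d j * W.d i :=
          Nat.mul_le_mul_left _ (Finset.sum_le_sum h1)
      _ ≤ Fintype.card H * ∑ i,
          ∑ j ∈ Finset.univ.filter (fun j => V.d j < b), mult V W f i j * V.d j * W.d i :=
          Nat.mul_le_mul_left _ (Finset.sum_le_sum_of_subset (Finset.subset_univ _))
      _ = ∑ j ∈ Finset.univ.filter (fun j => V.d j < b),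
          V.d j * (Fintype.card H * ∑ i, mult V W f i j * W.d i) := by
          rw [Finset.sum_comm, Finset.mul_sum]
          refine Finset.sum_congr rfl fun j _ => ?_
          simp only [Finset.mul_sum]
          refine Finset.sum_congr rfl fun i _ => ?_
          ring
      _ = _ := by
          simp only [mult_sum' V W f hf]
          rw [Finset.mul_sum]
          refine Finset.sum_congr rfl fun i _ => ?_
          ring
  · have h1 : ∀ i ∈ I1, b * W.d i ≤
        ∑ j ∈ Finset.univ.filter (fun j => V.d j = b), mult V W f i j * V.d j * W.d i := by
      intro i hi
      have h2 := hle i hi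
      obtain ⟨j, hj, hm⟩ := (Finset.mem_filter.1 hi).2
      calc b * W.d i ≤ mult V W f i j * V.d j * W.d i := by
            rw [hj]
            exact Nat.mul_le_mul (Nat.le_mul_of_pos_left _ hm) le_rfl
        _ ≤ _ := Finset.single_le_sum (f := fun j => mult V W f i j * V.d j * W.d i)
          (fun _ _ => Nat.zero_le _) (Finset.mem_filter.2 ⟨Finset.mem_univ j, hj⟩)
    have h3 : Fintype.card H * ∑ i ∈ I1, b * W.d i ≤
        ∑ j ∈ Finset.univ.filter (fun j => V.d j = b), Fintype.card G * b ^ 2 :=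
      calc Fintype.card H * ∑ i ∈ I1, b * W.d i
        ≤ Fintype.card H * ∑ i ∈ I1,
          ∑ j ∈ Finset.univ.filter (fun j => V.d j = b), mult V W f i j * V.d j * W.d i :=
          Nat.mul_le_mul_left _ (Finset.sum_le_sum h1)
      _ ≤ Fintype.card H * ∑ i,
          ∑ j ∈ Finset.univ.filter (fun j => V.d j = b), mult V W f i j * V.d j * W.d i :=
          Nat.mul_le_mul_left _ (Finset.sum_le_sum_of_subset (Finset.subset_univ _))
      _ = ∑ j ∈ Finset.univ.filter (fun j => V.d j = b),
          V.d j * (Fintype.card H * ∑ i, mult V W f i j * W.d i) := by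
          rw [Finset.sum_comm, Finset.mul_sum]
          refine Finset.sum_congr rfl fun j _ => ?_
          simp only [Finset.mul_sum]
          refine Finset.sum_congr rfl fun i _ => ?_
          ring
      _ = _ := by
          simp only [mult_sum' V W f hf]
          refine Finset.sum_congr rfl fun i hi => ?_
          rw [(Finset.mem_filter.1 hi).2]
          ring
    rw [← Finset.mul_sum] at h3
    simp only [Finset.sum_const, smul_eq_mul] at h3
    have : (Fintype.card H * ∑ i ∈ I1, W.d i) * b ≤
      (Fintype.card G * ((Finset.univ.filter (fun j => V.d j = b)).card * b)) * b := by
      calc _ = Fintype.card H * (b * ∑ i ∈ I1, W.d i) := by ring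
        _ ≤ _ := h3
        _ = _ := by ring
    exact Nat.le_of_mul_le_mul_right this hbpos

end restrict

section big
variable {G : Type} [Group G] [Fintype G] (W : WD G)

theorem WD.exists_big {M : Type} [AddCommGroup M] [Module ℂ M] (ρ : Representation ℂ G M) (N : ℕ)
    (v : M) (hv : v ≠ 0) (Y : Submodule ℂ M) (hvY : v ∈ Y) (hY : ∀ g, ∀ x ∈ Y, ρ g x ∈ Y)
    (h : ∀ X : Submodule ℂ M, X ≤ Y → X ≠ ⊥ → (∀ g, ∀ x ∈ X, ρ g x ∈ X) → N ≤ Module.finrank ℂ X) :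
    ∃ j, N ≤ W.d j := by
  set R := ρ.asAlgebraHom with hR
  have h1 : R (∑ j, ∑ a, W.E j a a) v = v := by rw [W.sum_E]; simp
  have h2 : ∃ j a, R (W.E j a a) v ≠ 0 := by
    by_contra hc
    push Not at hc
    apply hv
    rw [← h1]
    simp only [map_sum, LinearMap.sum_apply]
    simp [hc]
  obtain ⟨j, a, hja⟩ := h2
  refine ⟨j, ?_⟩
  let Lm : (Fin (W.d j) → ℂ) →ₗ[ℂ] M :=
    Fintype.linearCombination ℂ (fun b => R (W.E j b a) v)
  have hmem : ∀ x, R x (R (W.E j a a) v) ∈ LinearMap.range Lm := by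
    intro x
    refine ⟨fun b => W.Φ x j b a, ?_⟩
    rw [← Module.End.mul_apply, ← map_mul]
    have : x * W.E j a a = ∑ b, (W.Φ x j b a) • W.E j b a := by
      apply W.Φ.injective
      simp only [map_mul, map_sum, map_smul, WD.E, AlgEquiv.apply_symm_apply]
      funext i
      rw [Pi.mul_apply, Finset.sum_apply]
      by_cases hi : i = j
      · subst hi
        simp only [Pi.single_eq_same, Pi.smul_apply]
        ext p r
        simp [Matrix.mul_apply, Matrix.sum_apply, Matrix.single_apply, ite_and]
      · simp [Pi.single_eq_of_ne hi]
    rw [this]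
    simp [Lm, Fintype.linearCombination_apply]
  let X : Submodule ℂ M := LinearMap.range ((LinearMap.applyₗ (R (W.E j a a) v)).comp R.toLinearMap)
  have hX1 : X ≠ ⊥ := by
    intro hc
    have : R 1 (R (W.E j a a) v) ∈ X := ⟨1, rfl⟩
    rw [hc, map_one] at this
    exact hja (by simpa using this)
  have hX2 : X ≤ LinearMap.range Lm := by
    rintro _ ⟨x, rfl⟩
    exact hmem x
  have hRY : ∀ x, ∀ y ∈ Y, R x y ∈ Y := by
    intro x y hy
    induction x using MonoidAlgebra.induction_on with
    | of g => 
      have h3 : R (MonoidAlgebra.of ℂ G g) = ρ g := by simp [hR]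
      rw [h3]; exact hY g y hy
    | add a b ha hb => rw [map_add]; exact Y.add_mem ha hb
    | smul c a ha => rw [map_smul]; exact Y.smul_mem c ha
  have hXY : X ≤ Y := by
    rintro _ ⟨x, rfl⟩
    exact hRY _ _ (hRY _ _ hvY)
  have := h X hXY hX1 (by
    rintro g _ ⟨x, rfl⟩
    refine ⟨MonoidAlgebra.of ℂ G g * x, ?_⟩
    simp [hR, Representation.asAlgebraHom_single])
  calc N ≤ _ := this
    _ ≤ Module.finrank ℂ (LinearMap.range Lm) := Submodule.finrank_mono hX2
    _ ≤ Module.finrank ℂ (Fin (W.d j) → ℂ) := LinearMap.finrank_range_le _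
    _ = W.d j := by simp

end big

end PSLeps
end

section
namespace PSLeps
section gelfand
variable {G U : Type} [Group G] [Fintype G] [Group U] [Fintype U] (ι : U →* G) (ψ : U →* ℂ)

noncomputable def idem : MonoidAlgebra ℂ G :=
  (Fintype.card U : ℂ)⁻¹ • ∑ u, ψ u⁻¹ • MonoidAlgebra.of ℂ G (ι u)

theorem psi_inv_mul (u : U) : ψ u * ψ u⁻¹ = 1 := by rw [← map_mul]; simp

theorem psi_ne (u : U) : ψ u ≠ 0 := left_ne_zero_of_mul_eq_one (psi_inv_mul ψ u)

theorem of_mul_idem (v : U) : MonoidAlgebra.of ℂ G (ι v) * idem ι ψ = ψ v • idem ι ψ := by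
  unfold idem
  rw [mul_smul_comm, smul_comm (ψ v), Finset.mul_sum]
  congr 1
  rw [Finset.smul_sum]
  refine Fintype.sum_equiv (Equiv.mulLeft v) _ _ fun u => ?_
  rw [mul_smul_comm, ← map_mul, ← map_mul, smul_smul]
  congr 1
  simp only [Equiv.coe_mulLeft, mul_inv_rev, map_mul]
  rw [mul_comm, mul_assoc, mul_comm (ψ v⁻¹), psi_inv_mul, mul_one]

theorem idem_mul_of (v : U) : idem ι ψ * MonoidAlgebra.of ℂ G (ι v) = ψ v • idem ι ψ := by
  unfold idem
  rw [smul_mul_assoc, smul_comm (ψ v), Finset.sum_mul]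
  congr 1
  rw [Finset.smul_sum]
  refine Fintype.sum_equiv (Equiv.mulRight v) _ _ fun u => ?_
  rw [smul_mul_assoc, ← map_mul, ← map_mul, smul_smul]
  congr 1
  simp only [Equiv.coe_mulRight, mul_inv_rev, map_mul]
  rw [← mul_assoc, psi_inv_mul, one_mul]

theorem idem_idem : idem ι ψ * idem ι ψ = idem ι ψ := by
  conv_lhs => enter [1]; rw [idem]
  rw [smul_mul_assoc, Finset.sum_mul]
  have : ∀ u : U, (ψ u⁻¹ • MonoidAlgebra.of ℂ G (ι u)) * idem ι ψ = idem ι ψ := by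
    intro u
    rw [smul_mul_assoc, of_mul_idem, smul_smul, mul_comm, psi_inv_mul, one_smul]
  simp only [this, Finset.sum_const, Finset.card_univ]
  rw [← Nat.cast_smul_eq_nsmul ℂ, smul_smul, inv_mul_cancel₀, one_smul]
  exact_mod_cast Fintype.card_ne_zero

theorem idem_coeff_one (hι : Function.Injective ι) :
    (idem ι ψ).coeff 1 = (Fintype.card U : ℂ)⁻¹ := by
  unfold idem
  rw [MonoidAlgebra.coeff_smul_apply, MonoidAlgebra.coeff_sum, Finsupp.finsetSum_apply]
  rw [Finset.sum_eq_single 1]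
  · simp [MonoidAlgebra.of_apply]
  · intro u _ hu
    rw [MonoidAlgebra.coeff_smul_apply, MonoidAlgebra.of_apply, MonoidAlgebra.coeff_single,
      Finsupp.single_apply, if_neg, smul_zero]
    intro h
    exact hu (hι (by simpa using h))
  · simp

theorem idem_sandwich (g : G) : idem ι ψ * MonoidAlgebra.of ℂ G g * idem ι ψ =
    ((Fintype.card U : ℂ)⁻¹ * (Fintype.card U : ℂ)⁻¹) •
      ∑ u, ∑ u', (ψ u⁻¹ * ψ u'⁻¹) • MonoidAlgebra.of ℂ G (ι u * g * ι u') := by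
  unfold idem
  rw [smul_mul_assoc, smul_mul_assoc, mul_smul_comm, smul_smul]
  congr 1
  rw [Finset.sum_mul, Finset.sum_mul]
  refine Finset.sum_congr rfl fun u _ => ?_
  rw [Finset.mul_sum]
  refine Finset.sum_congr rfl fun u' _ => ?_
  simp only [smul_mul_assoc, mul_smul_comm, smul_smul, map_mul]
  congr 1
  ring

theorem idem_move (u u' : U) (g : G) :
    idem ι ψ * MonoidAlgebra.of ℂ G (ι u * g * ι u') * idem ι ψ =
      (ψ u * ψ u') • (idem ι ψ * MonoidAlgebra.of ℂ G g * idem ι ψ) := by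
  simp only [map_mul]
  have : idem ι ψ * (MonoidAlgebra.of ℂ G (ι u) * MonoidAlgebra.of ℂ G g * MonoidAlgebra.of ℂ G (ι u'))
      * idem ι ψ = (idem ι ψ * MonoidAlgebra.of ℂ G (ι u)) * MonoidAlgebra.of ℂ G g *
        (MonoidAlgebra.of ℂ G (ι u') * idem ι ψ) := by simp only [mul_assoc]
  rw [this, idem_mul_of, of_mul_idem, smul_mul_assoc, smul_mul_assoc, mul_smul_comm, smul_smul]

variable {X : Type} [Fintype X] (w : X → G)
  (ha : ∀ g : G, idem ι ψ * MonoidAlgebra.of ℂ G g * idem ι ψ = 0 ∨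
    ∃ x u u', g = ι u * w x * ι u')
  (hb : ∀ x y u u', ι u * w x * ι u' = w y → x = y)
  (hc : ∀ x u u', ι u * w x * ι u' = w x → ψ u * ψ u' = 1)

include ha hb hc

theorem gelfand_dim : Module.finrank ℂ (LinearMap.range (sand (idem ι ψ) (idem ι ψ))) =
    Fintype.card X := by
  set e := idem ι ψ with he
  let b : X → MonoidAlgebra ℂ G := fun x => e * MonoidAlgebra.of ℂ G (w x) * e
  have hcoef : ∀ x y, (b x).coeff (w y) = ((Fintype.card U : ℂ)⁻¹ * (Fintype.card U : ℂ)⁻¹) *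
      ∑ u, ∑ u', (if ι u * w x * ι u' = w y then (1:ℂ) else 0) := by
    intro x y
    simp only [b, he]
    rw [idem_sandwich, MonoidAlgebra.coeff_smul_apply, MonoidAlgebra.coeff_sum,
      Finsupp.finsetSum_apply, smul_eq_mul]
    congr 1
    refine Finset.sum_congr rfl fun u _ => ?_
    rw [MonoidAlgebra.coeff_sum, Finsupp.finsetSum_apply]
    refine Finset.sum_congr rfl fun u' _ => ?_
    rw [MonoidAlgebra.coeff_smul_apply, MonoidAlgebra.of_apply, MonoidAlgebra.coeff_single,
      Finsupp.single_apply]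
    split_ifs with h
    · have hxy := hb _ _ _ _ h
      subst hxy
      have h1 := hc _ _ _ h
      have h2 := psi_inv_mul ψ u
      have h3 := psi_inv_mul ψ u'
      have h4 : ψ u⁻¹ * ψ u'⁻¹ = 1 := by
        calc ψ u⁻¹ * ψ u'⁻¹ = (ψ u * ψ u') * (ψ u⁻¹ * ψ u'⁻¹) := by rw [h1, one_mul]
          _ = (ψ u * ψ u⁻¹) * (ψ u' * ψ u'⁻¹) := by ring
          _ = 1 := by rw [h2, h3, one_mul]
      rw [h4, one_smul]
    · simp
  have hU : (Fintype.card U : ℂ) ≠ 0 := by exact_mod_cast Fintype.card_ne_zero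
  have hdiag : ∀ x, (b x).coeff (w x) ≠ 0 := by
    intro x
    rw [hcoef]
    apply mul_ne_zero (mul_ne_zero (inv_ne_zero hU) (inv_ne_zero hU))
    have : ∑ u, ∑ u', (if ι u * w x * ι u' = w x then (1:ℂ) else 0) =
      ((∑ u : U, ∑ u' : U, (if ι u * w x * ι u' = w x then 1 else 0) : ℕ) : ℂ) := by
      push_cast; rfl
    rw [this]
    have : 0 < (∑ u : U, ∑ u' : U, (if ι u * w x * ι u' = w x then 1 else 0) : ℕ) := by
      refine Finset.sum_pos' (fun _ _ => Nat.zero_le _) ⟨1, Finset.mem_univ _, ?_⟩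
      refine Finset.sum_pos' (fun _ _ => Nat.zero_le _) ⟨1, Finset.mem_univ _, ?_⟩
      simp
    exact_mod_cast this.ne'
  have hoff : ∀ x y, x ≠ y → (b x).coeff (w y) = 0 := by
    intro x y hxy
    rw [hcoef]
    refine mul_eq_zero_of_right _ (Finset.sum_eq_zero fun u _ => Finset.sum_eq_zero fun u' _ => ?_)
    rw [if_neg]
    intro h
    exact hxy (hb _ _ _ _ h)
  have hli : LinearIndependent ℂ b := by
    rw [Fintype.linearIndependent_iff]
    intro c hc0 y
    have := congrArg (fun z : MonoidAlgebra ℂ G => z.coeff (w y)) hc0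
    simp only [MonoidAlgebra.coeff_sum, Finsupp.finsetSum_apply, MonoidAlgebra.coeff_smul_apply,
      MonoidAlgebra.coeff_zero, Finsupp.zero_apply] at this
    rw [Finset.sum_eq_single y] at this
    · rcases mul_eq_zero.1 this with h | h
      · exact h
      · exact absurd h (hdiag y)
    · intro x _ hxy
      rw [hoff x y hxy, smul_zero]
    · simp
  have hspan : LinearMap.range (sand e e) = Submodule.span ℂ (Set.range b) := by
    apply le_antisymm
    · rintro _ ⟨z, rfl⟩
      rw [eq_sum_of z, map_sum]
      refine Submodule.sum_mem _ fun g _ => ?_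
      rw [map_smul]
      refine Submodule.smul_mem _ _ ?_
      rw [sand_apply, ← mul_assoc]
      rcases ha g with h | ⟨x, u, u', rfl⟩
      · rw [h]; exact Submodule.zero_mem _
      · rw [he, idem_move]
        exact Submodule.smul_mem _ _ (Submodule.subset_span ⟨x, rfl⟩)
    · rw [Submodule.span_le]
      rintro _ ⟨x, rfl⟩
      exact ⟨MonoidAlgebra.of ℂ G (w x), by rw [sand_apply, ← mul_assoc]⟩
  rw [hspan, finrank_span_eq_card hli]

omit hb hc in
theorem gelfand_comm (τ : G → G) (hτ1 : τ 1 = 1) (hτ : ∀ g h, τ (g * h) = τ h * τ g)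
    (τU : U → U) (hτU : Function.Bijective τU)
    (h1 : ∀ u, τ (ι u) = ι (τU u)) (h2 : ∀ u, ψ (τU u)⁻¹ = ψ u⁻¹) (h3 : ∀ x, τ (w x) = w x) :
    ∀ x y, (idem ι ψ * x * idem ι ψ) * (idem ι ψ * y * idem ι ψ) =
      (idem ι ψ * y * idem ι ψ) * (idem ι ψ * x * idem ι ψ) := by
  set e := idem ι ψ with he
  let t0 : G →* (MonoidAlgebra ℂ G)ᵐᵒᵖ :=
    { toFun := fun g => MulOpposite.op (MonoidAlgebra.of ℂ G (τ g))
      map_one' := by rw [hτ1, map_one]; rfl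
      map_mul' := fun a b => by rw [hτ, map_mul, MulOpposite.op_mul] }
  let t : MonoidAlgebra ℂ G →ₐ[ℂ] (MonoidAlgebra ℂ G)ᵐᵒᵖ := MonoidAlgebra.lift ℂ (MonoidAlgebra ℂ G)ᵐᵒᵖ G t0
  have ht : ∀ g, t (MonoidAlgebra.of ℂ G g) = MulOpposite.op (MonoidAlgebra.of ℂ G (τ g)) := by
    intro g
    simp only [t]
    rw [MonoidAlgebra.lift_of]
    rfl
  have hte : t e = MulOpposite.op e := by
    rw [he, idem, map_smul, map_sum]
    simp only [map_smul, ht, h1]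
    rw [MulOpposite.op_smul, Finset.op_sum]
    congr 1
    refine Fintype.sum_equiv (Equiv.ofBijective τU hτU) _ _ fun u => ?_
    rw [MulOpposite.op_smul, Equiv.ofBijective_apply, h2]
  have hfix : ∀ z, t (e * z * e) = MulOpposite.op (e * z * e) := by
    intro z
    rw [eq_sum_of z]
    simp only [Finset.mul_sum, Finset.sum_mul, mul_smul_comm, smul_mul_assoc]
    rw [map_sum, Finset.op_sum]
    refine Finset.sum_congr rfl fun g _ => ?_
    rw [map_smul, MulOpposite.op_smul]
    congr 1
    rcases ha g with h | ⟨x, u, u', rfl⟩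
    · rw [h, map_zero]; rfl
    · rw [he, idem_move, map_smul, MulOpposite.op_smul, ← he]
      congr 1
      rw [map_mul, map_mul, hte, ht, h3, ← MulOpposite.op_mul, ← MulOpposite.op_mul, mul_assoc]
  intro x y
  have h4 : e * x * e * (e * y * e) = e * (x * (e * (e * y))) * e := by simp only [mul_assoc]
  have h5 := hfix (x * (e * (e * y)))
  rw [← h4, map_mul, hfix, hfix, ← MulOpposite.op_mul] at h5
  exact (MulOpposite.op_injective h5).symm

end gelfand
end PSLeps
end

section
namespace PSLeps
open Matrix

section mats
variable {n : ℕ} {F : Type} [Field F]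

/-- upper unitriangular -/
def IsUT (M : Matrix (Fin n) (Fin n) F) : Prop := (∀ i, M i i = 1) ∧ ∀ i j, j < i → M i j = 0

theorem IsUT.one : IsUT (1 : Matrix (Fin n) (Fin n) F) :=
  ⟨fun i => by simp, fun i j h => Matrix.one_apply_ne (ne_of_gt h)⟩

theorem upper_mul_diag {M N : Matrix (Fin n) (Fin n) F} (hM : ∀ i j, j < i → M i j = 0)
    (hN : ∀ i j, j < i → N i j = 0) (i : Fin n) : (M * N) i i = M i i * N i i := by
  rw [Matrix.mul_apply, Finset.sum_eq_single i]
  · intro k _ hk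
    rcases lt_or_gt_of_ne hk with h | h
    · rw [hM i k h, zero_mul]
    · rw [hN k i h, mul_zero]
  · simp

theorem upper_mul {M N : Matrix (Fin n) (Fin n) F} (hM : ∀ i j, j < i → M i j = 0)
    (hN : ∀ i j, j < i → N i j = 0) (i j : Fin n) (h : j < i) : (M * N) i j = 0 := by
  rw [Matrix.mul_apply]
  refine Finset.sum_eq_zero fun k _ => ?_
  rcases lt_or_ge k i with h' | h'
  · rw [hM i k h', zero_mul]
  · rw [hN k j (lt_of_lt_of_le h h'), mul_zero]

theorem IsUT.mul {M N : Matrix (Fin n) (Fin n) F} (hM : IsUT M) (hN : IsUT N) : IsUT (M * N) :=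
  ⟨fun i => by rw [upper_mul_diag hM.2 hN.2, hM.1, hN.1, one_mul], upper_mul hM.2 hN.2⟩

theorem IsUT.det {M : Matrix (Fin n) (Fin n) F} (hM : IsUT M) : M.det = 1 := by
  rw [Matrix.det_of_upperTriangular]
  · simp [hM.1]
  · intro i j h
    exact hM.2 i j h

theorem inv_mem_of_finite {G : Type} [Group G] [Finite G] (S : Submonoid G) (g : G) (hg : g ∈ S) :
    g⁻¹ ∈ S := by
  have : g⁻¹ = g ^ (orderOf g - 1) := by
    rw [inv_eq_iff_mul_eq_one, ← pow_succ', Nat.sub_add_cancel (orderOf_pos g), pow_orderOf_eq_one]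
  rw [this]
  exact S.pow_mem hg _

variable [Fintype F]

def UTm (n : ℕ) (F : Type) [Field F] : Submonoid (GL (Fin n) F) where
  carrier := {g | IsUT (g : Matrix (Fin n) (Fin n) F)}
  one_mem' := IsUT.one
  mul_mem' := fun ha hb => IsUT.mul ha hb

def UT (n : ℕ) (F : Type) [Field F] [Fintype F] : Subgroup (GL (Fin n) F) where
  __ := UTm n F
  inv_mem' := fun {x} h => inv_mem_of_finite (UTm n F) x h

theorem mem_UT {g : GL (Fin n) F} : g ∈ UT n F ↔ IsUT (g : Matrix (Fin n) (Fin n) F) := Iff.rfl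

/-- upper triangular -/
def Bm (n : ℕ) (F : Type) [Field F] : Submonoid (GL (Fin n) F) where
  carrier := {g | ∀ i j, j < i → (g : Matrix (Fin n) (Fin n) F) i j = 0}
  one_mem' := IsUT.one.2
  mul_mem' := fun ha hb => upper_mul ha hb

def BT (n : ℕ) (F : Type) [Field F] [Fintype F] : Subgroup (GL (Fin n) F) where
  __ := Bm n F
  inv_mem' := fun {x} h => inv_mem_of_finite (Bm n F) x h

theorem mem_BT {g : GL (Fin n) F} :
    g ∈ BT n F ↔ ∀ i j, j < i → (g : Matrix (Fin n) (Fin n) F) i j = 0 := Iff.rfl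

theorem UT_le_BT : UT n F ≤ BT n F := fun _ h => h.2

omit [Fintype F] in
noncomputable def IsUT.toGL {M : Matrix (Fin n) (Fin n) F} (hM : IsUT M) : GL (Fin n) F :=
  GeneralLinearGroup.mkOfDetNeZero M (by rw [hM.det]; exact one_ne_zero)

theorem IsUT.toGL_val {M : Matrix (Fin n) (Fin n) F} (hM : IsUT M) :
  (hM.toGL : Matrix (Fin n) (Fin n) F) = M := rfl

omit [Fintype F] in
def utM (a : {p : Fin n × Fin n // p.1 < p.2} → F) : Matrix (Fin n) (Fin n) F :=
  Matrix.of fun i j => if h : i < j then a ⟨(i, j), h⟩ else if i = j then 1 else 0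

omit [Fintype F] in
theorem utM_isUT (a : {p : Fin n × Fin n // p.1 < p.2} → F) : IsUT (utM a) :=
  ⟨fun i => by simp [utM], fun i j h => by simp [utM, not_lt_of_gt h, ne_of_gt h]⟩

noncomputable def UTequiv : UT n F ≃ ({p : Fin n × Fin n // p.1 < p.2} → F) where
  toFun u := fun p => (u : GL (Fin n) F).val p.1.1 p.1.2
  invFun a := ⟨(utM_isUT a).toGL, by
      rw [mem_UT, IsUT.toGL_val]
      exact utM_isUT a⟩
  left_inv u := by
    apply Subtype.ext
    apply Units.ext
    rw [IsUT.toGL_val]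
    ext i j
    have h := u.2
    rw [mem_UT] at h
    by_cases h1 : i < j
    · simp [utM, h1]
    · by_cases h2 : i = j
      · subst h2; simp [utM, h.1]
      · have : j < i := lt_of_le_of_ne (not_lt.1 h1) (Ne.symm h2)
        simp [utM, h1, h2, h.2 i j this]
  right_inv a := by
    funext p
    simp only [IsUT.toGL_val]
    simp [utM, p.2]

theorem card_UT : Fintype.card (UT n F) = Fintype.card F ^ (n * (n - 1) / 2) := by
  rw [Fintype.card_congr UTequiv, Fintype.card_fun]
  congr 1
  rw [Fintype.card_subtype]
  have : (Finset.univ.filter fun p : Fin n × Fin n => p.1 < p.2).card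
      = ∑ j : Fin n, (Finset.univ.filter fun i : Fin n => i < j).card := by
    rw [Finset.card_filter, Fintype.sum_prod_type, Finset.sum_comm]
    refine Finset.sum_congr rfl fun j _ => ?_
    rw [Finset.card_filter]
  rw [this]
  have h2 : ∀ j : Fin n, (Finset.univ.filter fun i : Fin n => i < j).card = (j : ℕ) := by
    intro j
    rw [← Fin.card_Iio]
    congr 1
    ext i; simp
  simp only [h2]
  rw [Fin.sum_univ_eq_sum_range (fun i => i), Finset.sum_range_id]

/-- monomial matrices -/
def monoM (π : Equiv.Perm (Fin n)) (t : Fin n → Fˣ) : Matrix (Fin n) (Fin n) F :=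
  Matrix.of fun i j => if i = π j then (t j : F) else 0

omit [Fintype F] in
theorem monoM_apply (π : Equiv.Perm (Fin n)) (t : Fin n → Fˣ) (i j : Fin n) :
  monoM π t i j = if i = π j then (t j : F) else 0 := rfl

omit [Fintype F] in
theorem monoM_mul (π σ : Equiv.Perm (Fin n)) (t s : Fin n → Fˣ) :
    monoM (F := F) π t * monoM σ s = monoM (π * σ) (fun j => s j * t (σ j)) := by
  ext i j
  rw [Matrix.mul_apply, Finset.sum_eq_single (σ j)]
  · rw [monoM_apply, monoM_apply, monoM_apply, Equiv.Perm.mul_apply, if_pos rfl]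
    by_cases h : i = π (σ j)
    · rw [if_pos h, if_pos h, Units.val_mul, mul_comm]
    · rw [if_neg h, if_neg h, zero_mul]
  · intro k _ hk
    rw [monoM_apply, monoM_apply, if_neg hk, mul_zero]
  · simp

omit [Fintype F] in
theorem monoM_one : monoM (F := F) (n := n) 1 1 = 1 := by
  ext i j
  rw [monoM_apply, Matrix.one_apply, Equiv.Perm.one_apply]
  by_cases h : i = j
  · rw [if_pos h, if_pos h]; rfl
  · rw [if_neg h, if_neg h]

def mono (π : Equiv.Perm (Fin n)) (t : Fin n → Fˣ) : GL (Fin n) F where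
  val := monoM π t
  inv := monoM π⁻¹ (fun j => (t (π⁻¹ j))⁻¹)
  val_inv := by
    rw [monoM_mul, ← monoM_one]
    congr 1
    · simp
    · funext j; simp
  inv_val := by
    rw [monoM_mul, ← monoM_one]
    congr 1
    · simp
    · funext j; simp

omit [Fintype F] in
theorem mono_val (π : Equiv.Perm (Fin n)) (t : Fin n → Fˣ) (i j : Fin n) :
    (mono π t : GL (Fin n) F).val i j = if i = π j then (t j : F) else 0 := rfl

omit [Fintype F] in
theorem mono_mul (π σ : Equiv.Perm (Fin n)) (t s : Fin n → Fˣ) :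
    mono (F := F) π t * mono σ s = mono (π * σ) (fun j => s j * t (σ j)) :=
  by apply Units.ext; exact monoM_mul π σ t s

omit [Fintype F] in
theorem mono_inj {π σ : Equiv.Perm (Fin n)} {t s : Fin n → Fˣ}
    (h : (mono π t : GL (Fin n) F) = mono σ s) : π = σ ∧ t = s := by
  have h1 : ∀ j, π j = σ j ∧ t j = s j := by
    intro j
    have : (mono π t : GL (Fin n) F).val (π j) j = (mono σ s : GL (Fin n) F).val (π j) j := by rw [h]
    rw [mono_val, mono_val, if_pos rfl] at this
    split_ifs at this with h2
    · exact ⟨h2, Units.ext this⟩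
    · exact absurd this (t j).ne_zero
  exact ⟨Equiv.ext fun j => (h1 j).1, funext fun j => (h1 j).2⟩

omit [Fintype F] in
/-- elementary step of the Bruhat decomposition -/
theorem bruhat_step (g : Matrix (Fin n) (Fin n) F) (hg : g.det ≠ 0) (k : ℕ) (hk : k ≤ n) :
    ∃ u u' : Matrix (Fin n) (Fin n) F, IsUT u ∧ IsUT u' ∧ ∃ π : Fin n → Fin n,
      (∀ j : Fin n, (j : ℕ) < k → ∀ i, (u * g * u') i j ≠ 0 → i = π j) ∧
      (∀ j : Fin n, (j : ℕ) < k → ∀ l, (u * g * u') (π j) l ≠ 0 → l = j) := by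
  induction k with
  | zero => exact ⟨1, 1, IsUT.one, IsUT.one, id, by simp, by simp⟩
  | succ k ih =>
    obtain ⟨u, u', hu, hu', π, h1, h2⟩ := ih (by omega)
    set h := u * g * u' with hh
    have hdet : h.det ≠ 0 := by rw [hh, det_mul, det_mul, hu.det, hu'.det]; simpa using hg
    let kk : Fin n := ⟨k, hk⟩
    -- lowest nonzero entry in column kk
    have hne : (Finset.univ.filter fun i => h i kk ≠ 0).Nonempty := by
      by_contra hc
      rw [Finset.not_nonempty_iff_eq_empty, Finset.filter_eq_empty_iff] at hc
      apply hdet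
      refine Matrix.det_eq_zero_of_column_eq_zero kk fun i => ?_
      simpa using hc (Finset.mem_univ i)
    set p := (Finset.univ.filter fun i => h i kk ≠ 0).max' hne with hp
    have hp1 : h p kk ≠ 0 := (Finset.mem_filter.1 (Finset.max'_mem _ hne)).2
    have hp2 : ∀ i, p < i → h i kk = 0 := by
      intro i hi
      by_contra hc
      exact absurd (Finset.le_max' _ i (Finset.mem_filter.2 ⟨Finset.mem_univ _, hc⟩)) (not_le.2 hi)
    have hpz : ∀ j : Fin n, (j : ℕ) < k → h p j = 0 := by
      intro j hj
      by_contra hc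
      have h3 := h1 j hj p hc
      have h4 := h2 j hj kk (h3 ▸ hp1)
      have : (kk : ℕ) = j := by rw [h4]
      simp only [kk] at this
      omega
    let v : Matrix (Fin n) (Fin n) F := fun i j =>
      if i = j then 1 else if j = p ∧ i < p then - h i kk / h p kk else 0
    let v' : Matrix (Fin n) (Fin n) F := fun i j =>
      if i = j then 1 else if i = kk ∧ kk < j then - h p j / h p kk else 0
    have hv : IsUT v := ⟨fun i => by simp [v], fun i j hij => by
      simp only [v]
      rw [if_neg (ne_of_gt hij), if_neg]
      rintro ⟨rfl, h⟩
      exact absurd h (not_lt_of_gt hij)⟩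
    have hv' : IsUT v' := ⟨fun i => by simp [v'], fun i j hij => by
      simp only [v']
      rw [if_neg (ne_of_gt hij), if_neg]
      rintro ⟨rfl, h⟩
      exact absurd h (not_lt_of_gt hij)⟩
    have e1 : ∀ i j, (v * h) i j = if i < p then h i j - h i kk / h p kk * h p j else h i j := by
      intro i j
      rw [Matrix.mul_apply]
      split_ifs with hi
      · rw [Finset.sum_eq_add i p (ne_of_lt hi)]
        · simp [v, ne_of_lt hi, hi]; ring
        · intro c _ hc
          simp [v, Ne.symm hc.1, hc.2]
        · simp
        · simp
      · rw [Finset.sum_eq_single i]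
        · simp [v]
        · intro c _ hc
          simp [v, Ne.symm hc, hi]
        · simp
    have e2 : ∀ (M : Matrix (Fin n) (Fin n) F) i j, (M * v') i j =
        if kk < j then M i j - M i kk * (h p j / h p kk) else M i j := by
      intro M i j
      rw [Matrix.mul_apply]
      split_ifs with hj
      · rw [Finset.sum_eq_add j kk (ne_of_gt hj)]
        · simp [v', ne_of_lt hj, hj]; ring
        · intro c _ hc
          simp [v', hc.1, hc.2]
        · simp
        · simp
      · rw [Finset.sum_eq_single j]
        · simp [v']
        · intro c _ hc
          simp [v', hc, hj]
        · simp
    refine ⟨v * u, u' * v', hv.mul hu, hu'.mul hv', Function.update π kk p, ?_⟩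
    have e3 : v * u * g * (u' * v') = v * h * v' := by
      rw [hh]; simp only [Matrix.mul_assoc]
    rw [e3]
    have c1 : ∀ i, i ≠ p → (v * h) i kk = 0 := by
      intro i hi
      rw [e1]
      split_ifs with h3
      · field_simp; ring
      · exact hp2 i (lt_of_le_of_ne (not_lt.1 h3) (Ne.symm hi))
    have c2 : ∀ j, (v * h) p j = h p j := by
      intro j; rw [e1, if_neg (lt_irrefl _)]
    have c3 : ∀ (j : Fin n), (j : ℕ) < k → ∀ i, (v * h) i j = h i j := by
      intro j hj i
      rw [e1]
      split_ifs with h3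
      · rw [hpz j hj]; ring
      · rfl
    have hkne : ∀ j : Fin n, (j : ℕ) < k → j ≠ kk := by
      intro j hj hc
      have : (j : ℕ) = k := by rw [hc]
      omega
    have f1 : ∀ i j, (v * h * v') i j = if i = p ∧ kk < j then 0 else (v * h) i j := by
      intro i j
      rw [e2]
      by_cases hi : i = p
      · subst hi
        by_cases hj : kk < j
        · simp only [hj, if_true, and_self, c2]; field_simp; ring
        · simp [hj]
      · simp [hi, c1 i hi]
    constructor
    · intro j hj i hne0
      by_cases hjk : j = kk
      · subst hjk
        rw [Function.update_self]
        by_contra hc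
        rw [f1, if_neg (by simp [hc]), c1 i hc] at hne0
        exact hne0 rfl
      · have hj' : (j : ℕ) < k := by
          have : (j : ℕ) ≠ k := fun hc => hjk (Fin.ext hc)
          omega
        rw [Function.update_of_ne hjk]
        rw [f1, if_neg, c3 j hj'] at hne0
        · exact h1 j hj' i hne0
        · rintro ⟨_, h5⟩
          have : k < (j : ℕ) := h5
          omega
    · intro j hj l hne0
      by_cases hjk : j = kk
      · subst hjk
        rw [Function.update_self, f1] at hne0
        split_ifs at hne0 with h5
        · exact absurd rfl hne0
        · rw [c2] at hne0
          have h6 : ¬ kk < l := fun hc => h5 ⟨rfl, hc⟩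
          by_contra hc
          have : (l : ℕ) < k := by
            have h7 : l < kk := lt_of_le_of_ne (not_lt.1 h6) hc
            exact h7
          exact hne0 (hpz l this)
      · have hj' : (j : ℕ) < k := by
          have : (j : ℕ) ≠ k := fun hc => hjk (Fin.ext hc)
          omega
        rw [Function.update_of_ne hjk] at hne0
        have hpk : h (π j) kk = 0 := by
          by_contra hc
          exact hkne j hj' (h2 j hj' kk hc).symm
        rw [f1] at hne0
        split_ifs at hne0 with h5
        · exact absurd rfl hne0
        · have : (v * h) (π j) l = h (π j) l := by
            rw [e1]
            split_ifs
            · rw [hpk]; ring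
            · rfl
          rw [this] at hne0
          exact h2 j hj' l hne0

theorem bruhat (g : GL (Fin n) F) : ∃ u ∈ UT n F, ∃ u' ∈ UT n F, ∃ π t,
    g = u * mono π t * u' := by
  have hdet : (g : Matrix (Fin n) (Fin n) F).det ≠ 0 := by
    have := GeneralLinearGroup.det_ne_zero g
    exact this
  obtain ⟨u, u', hu, hu', π, h1, h2⟩ := bruhat_step (g : Matrix (Fin n) (Fin n) F) hdet n le_rfl
  set h := u * (g : Matrix (Fin n) (Fin n) F) * u' with hh
  have hdet' : h.det ≠ 0 := by rw [hh, det_mul, det_mul, hu.det, hu'.det]; simpa using hdet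
  have hnz : ∀ j, h (π j) j ≠ 0 := by
    intro j hc
    apply hdet'
    refine Matrix.det_eq_zero_of_column_eq_zero j fun i => ?_
    by_contra hi
    rw [h1 j j.2 i hi] at hi
    exact hi hc
  have hinj : Function.Injective π := by
    intro a b hab
    exact h2 b b.2 a (hab ▸ hnz a)
  let σ : Equiv.Perm (Fin n) := Equiv.ofBijective π (Finite.injective_iff_bijective.1 hinj)
  let t : Fin n → Fˣ := fun j => Units.mk0 _ (hnz j)
  have key : hu.toGL * g * hu'.toGL = mono σ t := by
    apply Units.ext
    ext i j
    rw [mono_val]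
    change h i j = _
    split_ifs with hi
    · rw [hi]; rfl
    · by_contra hc
      exact hi (h1 j j.2 i hc)
  refine ⟨hu.toGL⁻¹, inv_mem (mem_UT.2 hu), hu'.toGL⁻¹, inv_mem (mem_UT.2 hu'), σ, t, ?_⟩
  rw [← key]
  group

theorem mono_disjoint {u u' : GL (Fin n) F} (hu : u ∈ UT n F) (hu' : u' ∈ UT n F)
    {π σ : Equiv.Perm (Fin n)} {t s : Fin n → Fˣ} (h : u * mono π t * u' = mono σ s) :
    π = σ ∧ t = s := by
  rw [mem_UT] at hu hu'
  have h0 : u * mono π t = mono σ s * u'⁻¹ := by rw [← h]; group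
  have hv : IsUT (u'⁻¹ : GL (Fin n) F).val := mem_UT.1 (inv_mem (mem_UT.2 hu'))
  have hL : ∀ i j, (u * mono π t).val i j = u.val i (π j) * t j := by
    intro i j
    rw [Units.val_mul, Matrix.mul_apply, Finset.sum_eq_single (π j)]
    · rw [mono_val, if_pos rfl]
    · intro k _ hk; rw [mono_val, if_neg hk, mul_zero]
    · simp
  have hR : ∀ i j, (mono σ s * u'⁻¹).val (σ i) j = s i * (u'⁻¹).val i j := by
    intro i j
    rw [Units.val_mul, Matrix.mul_apply, Finset.sum_eq_single i]
    · rw [mono_val, if_pos rfl]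
    · intro k _ hk
      rw [mono_val, if_neg (fun hc => hk (σ.injective hc.symm)), zero_mul]
    · simp
  have hent : ∀ i j, u.val (σ i) (π j) * t j = s i * (u'⁻¹).val i j := by
    intro i j; rw [← hL, ← hR, h0]
  have hle : ∀ j, σ j ≤ π j := by
    intro j
    by_contra hc
    have := hent j j
    rw [hu.2 _ _ (not_le.1 hc), hv.1, zero_mul, mul_one] at this
    exact (s j).ne_zero this.symm
  have hsum : ∑ j, ((σ j : Fin n) : ℕ) = ∑ j, ((π j : Fin n) : ℕ) := by
    rw [Equiv.sum_comp σ (fun j => (j : ℕ)), Equiv.sum_comp π (fun j => (j : ℕ))]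
  have heq : ∀ j, π j = σ j := by
    have := (Finset.sum_eq_sum_iff_of_le (s := Finset.univ)
      (f := fun j => ((σ j : Fin n) : ℕ)) (g := fun j => ((π j : Fin n) : ℕ))
      (fun j _ => hle j)).1 hsum
    intro j
    exact Fin.ext (this j (Finset.mem_univ j)).symm
  refine ⟨Equiv.ext heq, funext fun j => Units.ext ?_⟩
  have := hent j j
  rw [heq j, hu.1, hv.1, one_mul, mul_one] at this
  exact this

end mats
end PSLeps
end

section
namespace PSLeps
open Matrix

section goodperm
variable {n : ℕ} {K : Type}

def Good (π : Equiv.Perm (Fin n)) (t : Fin n → K) : Prop :=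
  ∀ i j, i < j → π i < π j → (π j : ℕ) + i = π i + j ∧ t i = t j

/-- local goodness implies goodness -/
theorem good_of_local (π : Equiv.Perm (Fin n)) (t : Fin n → K)
    (h : ∀ i j : Fin n, (j : ℕ) = i + 1 → π i < π j → (π j : ℕ) = π i + 1 ∧ t i = t j) :
    Good π t := by
  have key : ∀ d : ℕ, ∀ i j : Fin n, (j : ℕ) = i + d → π i < π j →
      ∀ k, i ≤ k → k ≤ j → (π k : ℕ) + i = π i + k ∧ t i = t k := by
    intro d
    induction d with
    | zero =>
      intro i j hij hlt
      have : i = j := Fin.ext (by omega)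
      subst this
      exact absurd hlt (lt_irrefl _)
    | succ d ih =>
      intro i j hij hlt k hik hkj
      let i' : Fin n := ⟨i + 1, by omega⟩
      have hi' : (i' : ℕ) = i + 1 := rfl
      by_cases hk : k = i
      · subst hk; exact ⟨rfl, rfl⟩
      have hk' : i' ≤ k := by
        have h1 : (i : ℕ) ≤ k := hik
        have h2 : (k : ℕ) ≠ i := fun hc => hk (Fin.ext hc)
        show (i' : ℕ) ≤ k
        omega
      rcases lt_trichotomy (π i) (π i') with h1 | h1 | h1
      · obtain ⟨h2, h3⟩ := h i i' hi' h1
        by_cases hj : i' = j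
        · have : k = i' := le_antisymm (hj ▸ hkj) hk'
          rw [this]
          exact ⟨by omega, h3⟩
        · have h4 : π i' < π j := by
            have h5 : (π i' : ℕ) ≠ π j := fun hc => hj (π.injective (Fin.ext hc))
            have h6 : (π i : ℕ) < π j := hlt
            show (π i' : ℕ) < π j
            omega
          obtain ⟨h5, h6⟩ := ih i' j (by omega) h4 k hk' hkj
          exact ⟨by omega, h3.trans h6⟩
      · have := congrArg Fin.val (π.injective h1)
        omega
      · exfalso
        have h4 : π i' < π j := lt_trans h1 hlt
        have hk2 := ih i' j (by omega) h4
        have h5 := (hk2 j (by show (i' : ℕ) ≤ j; omega) le_rfl).1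
        have h6 : (π i : ℕ) < π j := hlt
        have h7 : (π i' : ℕ) < π i := h1
        let k0 : Fin n := ⟨i' + (π i - π i'), by omega⟩
        have hk0 : (k0 : ℕ) = i' + (π i - π i') := rfl
        have h8 := (hk2 k0 (by show (i' : ℕ) ≤ k0; omega) (by show (k0 : ℕ) ≤ j; omega)).1
        have h9 : (π k0 : ℕ) = π i := by omega
        have := congrArg Fin.val (π.injective (Fin.ext h9))
        omega
  intro i j hij hlt
  have hij' : (i : ℕ) < j := hij
  exact key (j - i) i j (by omega) hlt j (le_of_lt hij) le_rfl

theorem Good.rel {π : Equiv.Perm (Fin n)} {t : Fin n → K} (h : Good π t) {i j : Fin n}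
    (hij : i < j) : π i < π j ↔ (π j : ℕ) + i = π i + j := by
  constructor
  · exact fun hl => (h i j hij hl).1
  · intro he
    have hij' : (i : ℕ) < j := hij
    show (π i : ℕ) < π j
    omega

theorem perm_val (π : Equiv.Perm (Fin n)) (j : Fin n) :
    (π j : ℕ) = (Finset.univ.filter fun k => π k < π j).card := by
  have : (Finset.univ.filter fun k => π k < π j) = (Finset.Iio (π j)).map π.symm.toEmbedding := by
    ext k
    simp only [Finset.mem_filter, Finset.mem_univ, true_and, Finset.mem_map, Finset.mem_Iio]
    constructor
    · intro h; exact ⟨π k, h, by simp⟩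
    · rintro ⟨a, ha, rfl⟩; simpa using ha
  rw [this, Finset.card_map, Fin.card_Iio]

theorem Good.conv {π : Equiv.Perm (Fin n)} {t : Fin n → K} (h : Good π t) {a b : Fin n}
    (hab : (π a : ℕ) + b = π b + a) (k : Fin n) (hak : a ≤ k) (hkb : k ≤ b) :
    (π k : ℕ) + a = π a + k := by
  rcases eq_or_lt_of_le hak with h1 | h1
  · rw [← h1]
  rcases eq_or_lt_of_le hkb with h2 | h2
  · rw [h2]; omega
  have h1' : (a : ℕ) < k := h1
  have h2' : (k : ℕ) < b := h2
  rcases lt_trichotomy (π a) (π k) with h3 | h3 | h3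
  · have := (h a k h1 h3).1
    omega
  · exact absurd (π.injective h3) (ne_of_lt h1)
  · have h3' : (π k : ℕ) < π a := h3
    have h4 : π k < π b := by show (π k : ℕ) < π b; omega
    have := (h k b h2 h4).1
    omega

theorem Good.sym {π : Equiv.Perm (Fin n)} {t : Fin n → K} (h : Good π t) (j : Fin n) :
    π (Fin.rev (π j)) = Fin.rev j ∧ t (Fin.rev (π j)) = t j := by
  let C : Finset (Fin n) := Finset.univ.filter fun k => (π k : ℕ) + j = π j + k
  have hC : ∀ k, k ∈ C ↔ (π k : ℕ) + j = π j + k := fun k => by simp [C]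
  have hne : C.Nonempty := ⟨j, (hC j).2 rfl⟩
  set a := C.min' hne with ha
  set b := C.max' hne with hb
  have haC : (π a : ℕ) + j = π j + a := (hC a).1 (Finset.min'_mem _ _)
  have hbC : (π b : ℕ) + j = π j + b := (hC b).1 (Finset.max'_mem _ _)
  have haj : a ≤ j := Finset.min'_le _ _ ((hC j).2 rfl)
  have hjb : j ≤ b := Finset.le_max' _ _ ((hC j).2 rfl)
  have hconv : ∀ k, a ≤ k → k ≤ b → (π k : ℕ) + j = π j + k := by
    intro k hak hkb
    have := h.conv (a := a) (b := b) (by omega) k hak hkb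
    omega
  have hset : (Finset.univ.filter fun k => π k < π j) = Finset.Ico a j ∪ Finset.Ioi b := by
    ext k
    simp only [Finset.mem_filter, Finset.mem_univ, true_and, Finset.mem_union, Finset.mem_Ico,
      Finset.mem_Ioi]
    rcases lt_trichotomy k j with h1 | h1 | h1
    · rw [h.rel h1]
      constructor
      · intro h2
        exact Or.inl ⟨Finset.min'_le _ _ ((hC k).2 (by omega)), h1⟩
      · rintro (⟨h2, _⟩ | h2)
        · have := hconv k h2 (le_trans (le_of_lt h1) hjb); omega
        · exact absurd (lt_of_le_of_lt hjb h2) (not_lt_of_gt h1)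
    · subst h1
      simp [hjb]
    · have h3 : π k < π j ↔ ¬ (π j < π k) := by
        rw [not_lt]
        exact ⟨le_of_lt, fun hle => lt_of_le_of_ne hle fun hc => ne_of_gt h1 (π.injective hc)⟩
      rw [h3, h.rel h1]
      constructor
      · intro h2
        right
        by_contra hc
        exact h2 (hconv k (le_trans haj (le_of_lt h1)) (not_lt.1 hc))
      · rintro (⟨_, h2⟩ | h2)
        · exact absurd h2 (not_lt_of_gt h1)
        · intro h4
          exact absurd (Finset.le_max' C k ((hC k).2 h4)) (not_le.2 h2)
  have hval : (π j : ℕ) = (j - a) + (n - 1 - b) := by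
    rw [perm_val, hset, Finset.card_union_of_disjoint, Fin.card_Ico, Fin.card_Ioi]
    rw [Finset.disjoint_left]
    intro k h1 h2
    rw [Finset.mem_Ico] at h1
    rw [Finset.mem_Ioi] at h2
    exact absurd (lt_of_le_of_lt hjb h2) (not_lt_of_gt h1.2)
  have haj' : (a : ℕ) ≤ j := haj
  have hjb' : (j : ℕ) ≤ b := hjb
  have hb' := b.2
  set k := Fin.rev (π j) with hk
  have hkv : (k : ℕ) = a + b - j := by rw [hk, Fin.val_rev, hval]; omega
  have hak : a ≤ k := by show (a : ℕ) ≤ k; omega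
  have hkb : k ≤ b := by show (k : ℕ) ≤ b; omega
  have hkc := hconv k hak hkb
  constructor
  · apply Fin.ext
    rw [Fin.val_rev]
    omega
  · rcases lt_trichotomy k j with h1 | h1 | h1
    · exact (h k j h1 ((h.rel h1).2 (by omega))).2
    · rw [h1]
    · exact (h j k h1 ((h.rel h1).2 (by omega))).2.symm

/-- rank permutation associated with an injective key -/
theorem exists_rank {L : Type} [LinearOrder L] (key : Fin n → L) (hk : Function.Injective key) :
    ∃ π : Equiv.Perm (Fin n), (∀ i j, π i < π j ↔ key i < key j) ∧
      ∀ j, (π j : ℕ) = (Finset.univ.filter fun k => key k < key j).card := by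
  have hcard : ∀ j, (Finset.univ.filter fun k => key k < key j).card < n := by
    intro j
    calc _ < (Finset.univ : Finset (Fin n)).card := by
          apply Finset.card_lt_card
          rw [Finset.ssubset_univ_iff]
          intro hc
          have := Finset.mem_univ j
          rw [← hc] at this
          simp at this
      _ = n := by simp
  let p : Fin n → Fin n := fun j => ⟨_, hcard j⟩
  have hmono : ∀ i j, key i < key j → p i < p j := by
    intro i j hij
    show (Finset.univ.filter fun k => key k < key i).card
      < (Finset.univ.filter fun k => key k < key j).card
    apply Finset.card_lt_card
    rw [Finset.ssubset_iff_of_subset]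
    · exact ⟨i, by simp [hij], by simp⟩
    · intro k; simp only [Finset.mem_filter, Finset.mem_univ, true_and]
      exact fun h => lt_trans h hij
  have hiff : ∀ i j, p i < p j ↔ key i < key j := by
    intro i j
    refine ⟨fun h => ?_, hmono i j⟩
    by_contra hc
    rcases eq_or_lt_of_le (not_lt.1 hc) with h1 | h1
    · rw [hk h1] at h; exact lt_irrefl _ h
    · exact lt_asymm h (hmono _ _ h1)
  have hinj : Function.Injective p := by
    intro i j hij
    apply hk
    by_contra hc
    rcases lt_or_gt_of_ne hc with h1 | h1
    · exact absurd hij (ne_of_lt (hmono _ _ h1))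
    · exact absurd hij (ne_of_gt (hmono _ _ h1))
  exact ⟨Equiv.ofBijective p (Finite.injective_iff_bijective.1 hinj), hiff, fun j => rfl⟩

variable {m : ℕ} {F : Type} [Field F] [Fintype F]

abbrev GX (m : ℕ) (F : Type) [Field F] : Type :=
  {x : Equiv.Perm (Fin (m+1)) × (Fin (m+1) → Fˣ) // Good x.1 x.2 ∧ x.2 (Fin.last m) = 1}

noncomputable def code (x : GX m F) : Fin m → F := fun i =>
  if x.1.1 i.castSucc < x.1.1 i.succ then 0 else (x.1.2 i.castSucc : F)

omit [Fintype F] in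
theorem code_zero_iff (x : GX m F) (i : Fin m) :
    code x i = 0 ↔ x.1.1 i.castSucc < x.1.1 i.succ := by
  unfold code
  split_ifs with h
  · simp [h]
  · simp [h]

omit [Fintype F] in
theorem code_rel (x : GX m F) (i j : Fin (m+1)) (hij : i < j) :
    x.1.1 i < x.1.1 j ↔ ∀ k : Fin m, i ≤ k.castSucc → k.castSucc < j → code x k = 0 := by
  simp only [code_zero_iff]
  obtain ⟨⟨π, t⟩, h⟩ := x
  simp only at h ⊢
  have hij' : (i : ℕ) < j := hij
  constructor
  · intro hlt k hik hkj
    have h1 := (h.1 i j hij hlt).1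
    have hle : i ≤ k.succ := le_trans hik (le_of_lt (Fin.castSucc_lt_succ))
    have hle2 : k.succ ≤ j := by
      have : (k : ℕ) < j := hkj
      show (k : ℕ) + 1 ≤ j
      omega
    have h2 := h.1.conv (a := i) (b := j) (by omega) k.castSucc hik (le_of_lt hkj)
    have h3 := h.1.conv (a := i) (b := j) (by omega) k.succ hle hle2
    have h4 : ((k.succ : Fin (m+1)) : ℕ) = k + 1 := rfl
    have h5 : ((k.castSucc : Fin (m+1)) : ℕ) = k := rfl
    show (π k.castSucc : ℕ) < π k.succ
    omega
  · have key : ∀ d : ℕ, ∀ j : Fin (m+1), (j : ℕ) = i + (d + 1) →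
        (∀ k : Fin m, i ≤ k.castSucc → k.castSucc < j → π k.castSucc < π k.succ) → π i < π j := by
      intro d
      induction d with
      | zero =>
        intro j hj hk
        have hi : (i : ℕ) < m := by omega
        have e1 : i = (⟨i, hi⟩ : Fin m).castSucc := rfl
        have e2 : j = (⟨i, hi⟩ : Fin m).succ := Fin.ext hj
        rw [e2]
        exact hk _ le_rfl (by rw [e2]; exact Fin.castSucc_lt_succ)
      | succ d ih =>
        intro j hj hk
        let k : Fin m := ⟨i + (d + 1), by omega⟩
        have hkv : (k : ℕ) = i + (d + 1) := rfl
        have e2 : j = k.succ := Fin.ext (by rw [Fin.val_succ, hkv, hj]; omega)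
        have h1 := ih k.castSucc hkv (fun k' h1 h2 => hk k' h1 (lt_trans h2 (by
          rw [e2]; exact Fin.castSucc_lt_succ)))
        refine lt_trans h1 ?_
        rw [e2]
        refine hk k ?_ (by rw [e2]; exact Fin.castSucc_lt_succ)
        show (i : ℕ) ≤ k
        omega
    intro hk
    exact key (j - i - 1) j (by omega) hk

omit [Fintype F] in
theorem code_inj : Function.Injective (code (m := m) (F := F)) := by
  intro x y hxy
  have h1 : ∀ i j, x.1.1 i < x.1.1 j ↔ y.1.1 i < y.1.1 j := by
    intro i j
    rcases lt_trichotomy i j with h | h | h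
    · rw [code_rel x i j h, code_rel y i j h, hxy]
    · subst h; simp
    · have e : ∀ z : GX m F, z.1.1 i < z.1.1 j ↔ ¬ z.1.1 j < z.1.1 i := fun z => by
        rw [not_lt]
        exact ⟨le_of_lt, fun hle => lt_of_le_of_ne hle fun hc => ne_of_gt h (z.1.1.injective hc)⟩
      rw [e, e, code_rel x j i h, code_rel y j i h, hxy]
  have h2 : x.1.1 = y.1.1 := by
    ext j
    rw [perm_val, perm_val]
    congr 1
    ext k
    simp [h1 k j]
  have h3 : x.1.2 = y.1.2 := by
    funext j
    induction j using Fin.reverseInduction with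
    | last => rw [x.2.2, y.2.2]
    | cast i ih =>
      by_cases hb : x.1.1 i.castSucc < x.1.1 i.succ
      · rw [(x.2.1 _ _ Fin.castSucc_lt_succ hb).2,
          (y.2.1 _ _ Fin.castSucc_lt_succ ((h1 _ _).1 hb)).2, ih]
      · have := congrFun hxy i
        unfold code at this
        rw [if_neg hb, if_neg (fun hc => hb ((h1 _ _).2 hc))] at this
        exact Units.ext this
  exact Subtype.ext (Prod.ext h2 h3)

omit [Fintype F] in
theorem code_surj : Function.Surjective (code (m := m) (F := F)) := by
  intro c
  let S : Fin (m+1) → Finset (Fin m) := fun j =>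
    Finset.univ.filter fun k => k.castSucc < j ∧ c k ≠ 0
  have hS : ∀ i j, i ≤ j → S i ⊆ S j := by
    intro i j hij k
    simp only [S, Finset.mem_filter, Finset.mem_univ, true_and]
    exact fun h => ⟨lt_of_lt_of_le h.1 hij, h.2⟩
  let s : Fin (m+1) → ℕ := fun j => (S j).card
  have hsm : ∀ i j, i ≤ j → s i ≤ s j := fun i j h => Finset.card_le_card (hS i j h)
  have hs : ∀ i : Fin m, s i.castSucc = s i.succ ↔ c i = 0 := by
    intro i
    constructor
    · intro h
      by_contra hc
      have h1 := Finset.eq_of_subset_of_card_le (hS i.castSucc i.succ (le_of_lt Fin.castSucc_lt_succ))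
        (le_of_eq h.symm)
      have h2 : i ∈ S i.succ := by
        simp only [S, Finset.mem_filter, Finset.mem_univ, true_and]
        exact ⟨Fin.castSucc_lt_succ, hc⟩
      rw [← h1] at h2
      simp [S] at h2
    · intro h
      show (S i.castSucc).card = (S i.succ).card
      congr 1
      apply Finset.Subset.antisymm (hS _ _ (le_of_lt Fin.castSucc_lt_succ))
      intro k
      simp only [S, Finset.mem_filter, Finset.mem_univ, true_and]
      rintro ⟨h1, h2⟩
      refine ⟨?_, h2⟩
      have h3 : k ≠ i := fun hc => h2 (hc ▸ h)
      have h4 : (k : ℕ) ≠ i := fun hc => h3 (Fin.ext hc)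
      have h1' : (k : ℕ) < i + 1 := h1
      show (k : ℕ) < i
      omega
  let key : Fin (m+1) → ℕᵒᵈ ×ₗ Fin (m+1) := fun j => toLex (OrderDual.toDual (s j), j)
  have hkey : ∀ i j, key i < key j ↔ s j < s i ∨ (s i = s j ∧ i < j) := by
    intro i j
    rw [Prod.Lex.lt_iff]
    simp [key]
  have hinj : Function.Injective key := by
    intro i j h
    exact congrArg (fun z => (ofLex z).2) h
  obtain ⟨π, h1, h2⟩ := exists_rank key hinj
  let t : Fin (m+1) → Fˣ := Fin.reverseInduction (motive := fun _ => Fˣ) 1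
    (fun i ih => if h : c i = 0 then ih else Units.mk0 (c i) h)
  have ht1 : t (Fin.last m) = 1 := by simp only [t, Fin.reverseInduction_last]
  have ht2 : ∀ i : Fin m, t i.castSucc = if h : c i = 0 then t i.succ else Units.mk0 (c i) h := by
    intro i; simp only [t, Fin.reverseInduction_castSucc]
  have hlt : ∀ i : Fin m, π i.castSucc < π i.succ ↔ c i = 0 := by
    intro i
    rw [h1, hkey, ← hs]
    have := hsm i.castSucc i.succ (le_of_lt Fin.castSucc_lt_succ)
    constructor
    · rintro (h | h)
      · omega
      · exact h.1
    · exact fun h => Or.inr ⟨h, Fin.castSucc_lt_succ⟩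
  have hgood : Good π t := by
    apply good_of_local
    intro i j hij hl
    have hi : (i : ℕ) < m := by omega
    have e1 : i = (⟨i, hi⟩ : Fin m).castSucc := rfl
    have e2 : j = (⟨i, hi⟩ : Fin m).succ := Fin.ext hij
    generalize (⟨i, hi⟩ : Fin m) = k at e1 e2
    subst e1 e2
    have hck := (hlt k).1 hl
    refine ⟨?_, by rw [ht2, dif_pos hck]⟩
    have hsk := (hs k).2 hck
    rw [h2, h2]
    have : (Finset.univ.filter fun a => key a < key k.succ)
        = insert k.castSucc (Finset.univ.filter fun a => key a < key k.castSucc) := by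
      ext a
      simp only [Finset.mem_filter, Finset.mem_univ, true_and, Finset.mem_insert, hkey, hsk]
      constructor
      · rintro (h | ⟨h, h'⟩)
        · exact Or.inr (Or.inl h)
        · rcases lt_or_eq_of_le (Fin.le_castSucc_iff.2 h') with h3 | h3
          · exact Or.inr (Or.inr ⟨h, h3⟩)
          · exact Or.inl h3
      · rintro (h | h | ⟨h, h'⟩)
        · subst h; exact Or.inr ⟨hsk, Fin.castSucc_lt_succ⟩
        · exact Or.inl h
        · exact Or.inr ⟨h, lt_trans h' Fin.castSucc_lt_succ⟩
    rw [this, Finset.card_insert_of_notMem (by simp)]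
  refine ⟨⟨(π, t), hgood, ht1⟩, ?_⟩
  funext i
  unfold code
  simp only
  by_cases hc : c i = 0
  · rw [if_pos ((hlt i).2 hc), hc]
  · rw [if_neg (fun h => hc ((hlt i).1 h)), ht2, dif_neg hc]; rfl

theorem card_GX : Fintype.card (GX m F) = Fintype.card F ^ m := by
  rw [Fintype.card_congr (Equiv.ofBijective _ ⟨code_inj, code_surj⟩), Fintype.card_fun,
    Fintype.card_fin]

end goodperm
end PSLeps
end

section
namespace PSLeps
open Matrix

section pgl
variable {n : ℕ} {F : Type} [Field F] [Fintype F]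

abbrev PG (n : ℕ) (F : Type) [Field F] : Type := Matrix.ProjGenLinGroup (Fin n) F

abbrev mkP (n : ℕ) (F : Type) [Field F] : GL (Fin n) F →* PG n F := ProjGenLinGroup.mk

instance : Finite (PG n F) :=
  Finite.of_surjective (mkP n F) ProjGenLinGroup.mk_surjective

noncomputable instance : Fintype (PG n F) := Fintype.ofFinite _

/-- elementary unipotents -/
def xM (i j : Fin n) (c : F) : Matrix (Fin n) (Fin n) F :=
  Matrix.of fun a b => (1 : Matrix (Fin n) (Fin n) F) a b + if a = i ∧ b = j then c else 0

omit [Fintype F] in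
theorem xM_apply (i j : Fin n) (c : F) (a b : Fin n) :
    xM i j c a b = (1 : Matrix (Fin n) (Fin n) F) a b + if a = i ∧ b = j then c else 0 := rfl

omit [Fintype F] in
theorem mul_xM (M : Matrix (Fin n) (Fin n) F) (i j : Fin n) (c : F) (a b : Fin n) :
    (M * xM i j c) a b = M a b + if b = j then M a i * c else 0 := by
  rw [Matrix.mul_apply]
  simp only [xM_apply, mul_add, Finset.sum_add_distrib]
  rw [← Matrix.mul_apply, mul_one]
  congr 1
  by_cases h : b = j
  · rw [if_pos h, Finset.sum_eq_single i]
    · rw [if_pos ⟨rfl, h⟩]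
    · intro k _ hk; rw [if_neg (fun hc => hk hc.1), mul_zero]
    · simp
  · rw [if_neg h]
    exact Finset.sum_eq_zero fun k _ => by rw [if_neg (fun hc => h hc.2), mul_zero]

omit [Fintype F] in
theorem xM_mul (M : Matrix (Fin n) (Fin n) F) (i j : Fin n) (c : F) (a b : Fin n) :
    (xM i j c * M) a b = M a b + if a = i then c * M j b else 0 := by
  rw [Matrix.mul_apply]
  simp only [xM_apply, add_mul, Finset.sum_add_distrib]
  rw [← Matrix.mul_apply, one_mul]
  congr 1
  by_cases h : a = i
  · rw [if_pos h, Finset.sum_eq_single j]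
    · rw [if_pos ⟨h, rfl⟩]
    · intro k _ hk; rw [if_neg (fun hc => hk hc.2), zero_mul]
    · simp
  · rw [if_neg h]
    exact Finset.sum_eq_zero fun k _ => by rw [if_neg (fun hc => h hc.1), zero_mul]

omit [Fintype F] in
theorem xM_add {i j : Fin n} (h : i ≠ j) (c d : F) : xM i j c * xM i j d = xM i j (c + d) := by
  ext a b
  rw [mul_xM, xM_apply, xM_apply, xM_apply, Matrix.one_apply]
  have h' : ¬ (a = i ∧ i = j) := fun hc => h hc.2
  rw [if_neg h']
  by_cases ha : a = i <;> by_cases hb : b = j <;> simp [ha, hb, Matrix.one_apply] <;> ring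

omit [Fintype F] in
theorem xM_zero (i j : Fin n) : xM i j (0 : F) = 1 := by
  ext a b
  rw [xM_apply]; simp

/-- elementary unipotents in GL -/
def xg (i j : Fin n) (h : i ≠ j) (c : F) : GL (Fin n) F where
  val := xM i j c
  inv := xM i j (-c)
  val_inv := by rw [xM_add h, add_neg_cancel, xM_zero]
  inv_val := by rw [xM_add h, neg_add_cancel, xM_zero]

omit [Fintype F] in
theorem xg_val (i j : Fin n) (h : i ≠ j) (c : F) : (xg i j h c).val = xM i j c := rfl

omit [Fintype F] in
theorem xM_isUT {i j : Fin n} (h : i < j) (c : F) : IsUT (xM i j c) := by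
  constructor
  · intro a
    rw [xM_apply, if_neg, add_zero, Matrix.one_apply_eq]
    rintro ⟨rfl, h2⟩; exact ne_of_lt h h2
  · intro a b hab
    rw [xM_apply, if_neg, add_zero, Matrix.one_apply_ne (ne_of_gt hab)]
    rintro ⟨rfl, rfl⟩; exact lt_asymm h hab

theorem xg_mem_UT {i j : Fin n} (h : i < j) (c : F) : xg i j (ne_of_lt h) c ∈ UT n F :=
  mem_UT.2 (xM_isUT h c)

omit [Fintype F] in
theorem mono_xg (π : Equiv.Perm (Fin n)) (t : Fin n → Fˣ) (i j : Fin n) (h : i ≠ j) (c : F) :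
    mono π t * xg i j h c =
      xg (π i) (π j) (fun hc => h (π.injective hc)) (c * t i / t j) * mono π t := by
  apply Units.ext
  ext a b
  rw [Units.val_mul, Units.val_mul, xg_val, xg_val, mul_xM, xM_mul]
  congr 1
  rw [mono_val, mono_val]
  by_cases ha : a = π i <;> by_cases hb : b = j
  · rw [if_pos hb, if_pos ha, if_pos ha, hb, if_pos rfl]
    have := (t j).ne_zero
    field_simp
  · rw [if_neg hb, if_pos ha, if_neg (fun hc => hb (π.injective hc.symm)), mul_zero]
  · rw [if_pos hb, if_neg ha, if_neg ha, zero_mul]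
  · rw [if_neg hb, if_neg ha]

omit [Fintype F] in
theorem scalar_eq_mono (z : Fˣ) : GeneralLinearGroup.scalar (Fin n) z = mono 1 (fun _ => z) := by
  apply Units.ext
  ext i j
  rw [GeneralLinearGroup.coe_scalar, Matrix.scalar_apply, mono_val, Matrix.diagonal_apply,
    Equiv.Perm.one_apply]

omit [Fintype F] in
theorem mono_scalar (π : Equiv.Perm (Fin n)) (t : Fin n → Fˣ) (z : Fˣ) :
    mono π t * GeneralLinearGroup.scalar (Fin n) z = mono π (fun j => z * t j) := by
  rw [scalar_eq_mono, mono_mul]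
  simp

omit [Fintype F] in
theorem scalar_comm (g : GL (Fin n) F) (z : Fˣ) :
    g * GeneralLinearGroup.scalar (Fin n) z = GeneralLinearGroup.scalar (Fin n) z * g := by
  apply Units.ext
  rw [Units.val_mul, Units.val_mul, GeneralLinearGroup.coe_scalar]
  exact (Matrix.scalar_commute (z : F) (fun r => mul_comm _ _) g.val).symm

omit [Fintype F] in
theorem mkP_mono_smul (π : Equiv.Perm (Fin n)) (t : Fin n → Fˣ) (z : Fˣ) :
    mkP n F (mono π (fun j => z * t j)) = mkP n F (mono π t) := by
  rw [← mono_scalar, map_mul, ProjGenLinGroup.mk_scalar, mul_one]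

/-- Bruhat disjointness in PGL -/
theorem mono_disjoint_P {u u' : GL (Fin n) F} (hu : u ∈ UT n F) (hu' : u' ∈ UT n F)
    {π σ : Equiv.Perm (Fin n)} {t s : Fin n → Fˣ}
    (h : mkP n F u * mkP n F (mono π t) * mkP n F u' = mkP n F (mono σ s)) :
    π = σ ∧ ∃ z : Fˣ, (∀ j, s j = z * t j) ∧ u * mono π t * u' = mono π t := by
  rw [← map_mul, ← map_mul, ProjGenLinGroup.mk_eq_mk_iff] at h
  obtain ⟨z, hz⟩ := h
  have h2 : u * mono π (fun j => z * t j) * u' = mono σ s := by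
    rw [← mono_scalar, ← hz, mul_assoc, mul_assoc, mul_assoc, mul_assoc, scalar_comm u' z]
  obtain ⟨h3, h4⟩ := mono_disjoint hu hu' h2
  refine ⟨h3, z, fun j => (congrFun h4 j).symm, ?_⟩
  rw [← h3, ← h4, ← mono_scalar, mul_assoc, mul_assoc, ← scalar_comm u' z, ← mul_assoc,
    ← mul_assoc] at h2
  exact mul_right_cancel h2

noncomputable def iotaP (n : ℕ) (F : Type) [Field F] [Fintype F] : UT n F →* PG n F :=
  (mkP n F).comp (UT n F).subtype

theorem iotaP_apply (u : UT n F) : iotaP n F u = mkP n F u.1 := rfl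

omit [Fintype F] in
theorem mono_one : mono (F := F) (n := n) 1 1 = 1 := Units.ext monoM_one

theorem iotaP_inj : Function.Injective (iotaP n F) := by
  rw [injective_iff_map_eq_one]
  intro u hu
  rw [iotaP_apply, ← map_one (mkP n F), eq_comm, ProjGenLinGroup.mk_eq_mk_iff] at hu
  obtain ⟨z, hz⟩ := hu
  rw [one_mul, scalar_eq_mono] at hz
  have h1 : u.1 * mono 1 1 * 1 = mono 1 (fun _ => z) := by rw [mono_one, mul_one, mul_one, hz]
  have h2 := (mono_disjoint u.2 (one_mem _) h1).2
  apply Subtype.ext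
  rw [← hz, ← h2]
  exact mono_one

/-- sum of superdiagonal entries -/
def sigma (M : Matrix (Fin n) (Fin n) F) : F := ∑ i : Fin n, ∑ j : Fin n, if (j : ℕ) = i + 1 then M i j else 0

omit [Fintype F] in
theorem sigma_mul {M N : Matrix (Fin n) (Fin n) F} (hM : IsUT M) (hN : IsUT N) :
    sigma (M * N) = sigma M + sigma N := by
  unfold sigma
  rw [← Finset.sum_add_distrib]
  refine Finset.sum_congr rfl fun i _ => ?_
  rw [← Finset.sum_add_distrib]
  refine Finset.sum_congr rfl fun j _ => ?_
  split_ifs with h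
  · have hij : i < j := by show (i : ℕ) < j; omega
    rw [Matrix.mul_apply, Finset.sum_eq_add i j (ne_of_lt hij), hM.1, hN.1]
    · ring
    · intro k _ hk
      rcases lt_trichotomy k i with h1 | h1 | h1
      · rw [hM.2 _ _ h1, zero_mul]
      · exact absurd h1 hk.1
      · have : j < k := by
          have h2 : (i : ℕ) < k := h1
          have h3 : (k : ℕ) ≠ j := fun hc => hk.2 (Fin.ext hc)
          show (j : ℕ) < k
          omega
        rw [hN.2 _ _ this, mul_zero]
    · simp
    · simp
  · simp

omit [Fintype F] in
theorem sigma_xM {i j : Fin n} (h : i < j) (c : F) :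
    sigma (xM i j c) = if (j : ℕ) = i + 1 then c else 0 := by
  unfold sigma
  rw [Finset.sum_eq_single i, Finset.sum_eq_single j]
  · rw [xM_apply, Matrix.one_apply_ne (ne_of_lt h), zero_add]; simp
  · intro b _ hb
    split_ifs with h1
    · rw [xM_apply, if_neg (fun hc => hb hc.2), Matrix.one_apply_ne, zero_add]
      intro hc; rw [hc] at h1; omega
    · rfl
  · simp
  · intro a _ ha
    refine Finset.sum_eq_zero fun b _ => ?_
    split_ifs with h1
    · rw [xM_apply, if_neg (fun hc => ha hc.1), Matrix.one_apply_ne, zero_add]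
      intro hc; rw [hc] at h1; omega
    · rfl
  · simp

noncomputable def psiU (n : ℕ) {F : Type} [Field F] [Fintype F] (Ψ : AddChar F ℂ) : UT n F →* ℂ where
  toFun u := Ψ (sigma u.1.val)
  map_one' := by
    have : sigma (1 : Matrix (Fin n) (Fin n) F) = 0 := by
      have := sigma_mul (M := (1 : Matrix (Fin n) (Fin n) F)) IsUT.one IsUT.one
      rw [mul_one] at this
      simpa using this
    show Ψ (sigma (1 : Matrix (Fin n) (Fin n) F)) = 1
    rw [this, AddChar.map_zero_eq_one]
  map_mul' u v := by
    show Ψ (sigma (u.1.val * v.1.val)) = _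
    rw [sigma_mul u.2 v.2, AddChar.map_add_eq_mul]

theorem psiU_apply (Ψ : AddChar F ℂ) (u : UT n F) : psiU n Ψ u = Ψ (sigma u.1.val) := rfl

theorem idem_zero {G U : Type} [Group G] [Fintype G] [Group U] [Fintype U] (ι : U →* G)
    (ψ : U →* ℂ) (w : G) (v v' : U) (h : w * ι v = ι v' * w) (hne : ψ v ≠ ψ v') :
    idem ι ψ * MonoidAlgebra.of ℂ G w * idem ι ψ = 0 := by
  have h1 := idem_move ι ψ 1 v w
  have h2 := idem_move ι ψ v' 1 w
  rw [map_one, map_one, one_mul, one_mul] at h1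
  rw [map_one, map_one, mul_one, mul_one] at h2
  rw [h, h2] at h1
  have h3 : (ψ v' - ψ v) • (idem ι ψ * MonoidAlgebra.of ℂ G w * idem ι ψ) = 0 := by
    rw [sub_smul, h1, sub_self]
  exact (smul_eq_zero.1 h3).resolve_left (sub_ne_zero.2 hne.symm)

theorem not_good_zero (Ψ : AddChar F ℂ) (hΨ : Ψ ≠ 1) (π : Equiv.Perm (Fin n)) (t : Fin n → Fˣ)
    (h : ¬ Good π t) :
    idem (iotaP n F) (psiU n Ψ) * MonoidAlgebra.of ℂ (PG n F) (mkP n F (mono π t)) *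
      idem (iotaP n F) (psiU n Ψ) = 0 := by
  obtain ⟨c0, hc0⟩ : ∃ c, Ψ c ≠ 1 := by
    by_contra hc
    push Not at hc
    exact hΨ (AddChar.ext _ _ (by simpa using hc))
  have h1 : ¬ ∀ i j : Fin n, (j : ℕ) = i + 1 → π i < π j → (π j : ℕ) = π i + 1 ∧ t i = t j :=
    fun hc => h (good_of_local π t hc)
  push Not at h1
  obtain ⟨i, j, hij, hlt, h2⟩ := h1
  have hij' : i < j := by show (i : ℕ) < j; omega
  have key : ∀ c : F, Ψ c ≠ Ψ (if (π j : ℕ) = π i + 1 then c * t i / t j else 0) →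
    idem (iotaP n F) (psiU n Ψ) * MonoidAlgebra.of ℂ (PG n F) (mkP n F (mono π t)) *
      idem (iotaP n F) (psiU n Ψ) = 0 := by
    intro c hc
    refine idem_zero _ _ _ ⟨_, xg_mem_UT hij' c⟩ ⟨_, xg_mem_UT hlt (c * t i / t j)⟩ ?_ ?_
    · rw [iotaP_apply, iotaP_apply, ← map_mul, ← map_mul]
      congr 1
      exact mono_xg π t i j (ne_of_lt hij') c
    · rw [psiU_apply, psiU_apply, xg_val, xg_val, sigma_xM hij', sigma_xM hlt, if_pos hij]
      exact hc
  by_cases h3 : (π j : ℕ) = π i + 1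
  · have h4 : (t i : F) / t j ≠ 1 := by
      intro hc
      rw [div_eq_one_iff_eq (t j).ne_zero] at hc
      exact h2 h3 (Units.ext hc)
    have h5 : (1 - (t i : F) / t j) ≠ 0 := sub_ne_zero.2 h4.symm
    apply key (c0 / (1 - (t i : F) / t j))
    rw [if_pos h3]
    intro hc
    apply hc0
    have h6 : c0 / (1 - (t i : F) / t j) = c0 + c0 / (1 - (t i : F) / t j) * t i / t j := by
      have := (t j).ne_zero
      rw [div_eq_iff h5]
      rw [add_mul, mul_div_assoc, mul_assoc, mul_comm ((t i : F) / t j), ← mul_assoc,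
        div_mul_cancel₀ _ h5]
      ring
    rw [h6, AddChar.map_add_eq_mul] at hc
    rw [← h6] at hc
    have hne : Ψ (c0 / (1 - (t i : F) / t j) * t i / t j) ≠ 0 := by
      intro h0
      have := AddChar.map_add_eq_mul Ψ (c0 / (1 - (t i : F) / t j) * t i / t j)
        (-(c0 / (1 - (t i : F) / t j) * t i / t j))
      rw [h0, zero_mul, add_neg_cancel, AddChar.map_zero_eq_one] at this
      exact one_ne_zero this
    exact mul_right_cancel₀ hne (by rw [hc, one_mul])
  · apply key c0
    rw [if_neg h3, AddChar.map_zero_eq_one]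
    exact hc0

end pgl
end PSLeps
end

section
namespace PSLeps
open Matrix

section gg
variable {n m : ℕ} {F : Type} [Field F] [Fintype F]

def tauM (M : Matrix (Fin n) (Fin n) F) : Matrix (Fin n) (Fin n) F :=
  Matrix.of fun i j => M (Fin.rev j) (Fin.rev i)

omit [Fintype F] in
theorem tauM_apply (M : Matrix (Fin n) (Fin n) F) (i j) :
  tauM M i j = M (Fin.rev j) (Fin.rev i) := rfl

omit [Fintype F] in
theorem tauM_mul (M N : Matrix (Fin n) (Fin n) F) : tauM (M * N) = tauM N * tauM M := by
  ext i j
  rw [tauM_apply, Matrix.mul_apply, Matrix.mul_apply, ← Equiv.sum_comp Fin.revPerm]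
  refine Finset.sum_congr rfl fun k _ => ?_
  rw [tauM_apply, tauM_apply, mul_comm]
  rfl

omit [Fintype F] in
theorem tauM_one : tauM (1 : Matrix (Fin n) (Fin n) F) = 1 := by
  ext i j
  rw [tauM_apply, Matrix.one_apply, Matrix.one_apply]
  by_cases h : i = j
  · rw [if_pos h, if_pos (by rw [h])]
  · rw [if_neg h, if_neg (fun hc => h (Fin.rev_injective hc).symm)]

def tauGL (g : GL (Fin n) F) : GL (Fin n) F where
  val := tauM g.val
  inv := tauM (g⁻¹).val
  val_inv := by rw [← tauM_mul, ← Units.val_mul, inv_mul_cancel, Units.val_one, tauM_one]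
  inv_val := by rw [← tauM_mul, ← Units.val_mul, mul_inv_cancel, Units.val_one, tauM_one]

omit [Fintype F] in
theorem tauGL_val (g : GL (Fin n) F) : (tauGL g).val = tauM g.val := rfl

omit [Fintype F] in
theorem tauGL_mul (g h : GL (Fin n) F) : tauGL (g * h) = tauGL h * tauGL g := by
  apply Units.ext
  rw [Units.val_mul, tauGL_val, tauGL_val, tauGL_val, Units.val_mul, tauM_mul]

omit [Fintype F] in
theorem tauGL_scalar (z : Fˣ) : tauGL (GeneralLinearGroup.scalar (Fin n) z)
    = GeneralLinearGroup.scalar (Fin n) z := by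
  rw [scalar_eq_mono]
  apply Units.ext
  ext i j
  rw [tauGL_val, tauM_apply, mono_val, mono_val, Equiv.Perm.one_apply, Equiv.Perm.one_apply]
  by_cases h : i = j
  · rw [if_pos h, if_pos (by rw [h])]
  · rw [if_neg h, if_neg (fun hc => h (Fin.rev_injective hc).symm)]

def tauHom (n : ℕ) (F : Type) [Field F] : GL (Fin n) F →* (PG n F)ᵐᵒᵖ where
  toFun g := MulOpposite.op (mkP n F (tauGL g))
  map_one' := by
    have : tauGL (1 : GL (Fin n) F) = 1 := Units.ext tauM_one
    rw [this, map_one]; rfl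
  map_mul' g h := by rw [tauGL_mul, map_mul]; rfl

noncomputable def tauP (n : ℕ) (F : Type) [Field F] : PG n F →* (PG n F)ᵐᵒᵖ :=
  QuotientGroup.lift (Subgroup.center (GL (Fin n) F)) (tauHom n F) (by
    rw [GeneralLinearGroup.center_eq_range_scalar]
    rintro _ ⟨z, rfl⟩
    show MulOpposite.op (mkP n F (tauGL (GeneralLinearGroup.scalar (Fin n) z))) = 1
    rw [tauGL_scalar, ProjGenLinGroup.mk_scalar]; rfl)

omit [Fintype F] in
theorem tauP_mk (g : GL (Fin n) F) : tauP n F (mkP n F g) = MulOpposite.op (mkP n F (tauGL g)) := rfl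

theorem tauGL_UT {g : GL (Fin n) F} (h : g ∈ UT n F) : tauGL g ∈ UT n F := by
  rw [mem_UT] at h ⊢
  rw [tauGL_val]
  exact ⟨fun i => h.1 _, fun i j hij => h.2 _ _ (Fin.rev_lt_rev.2 hij)⟩

omit [Fintype F] in
theorem tauGL_tauGL (g : GL (Fin n) F) : tauGL (tauGL g) = g := by
  apply Units.ext
  ext i j
  simp only [tauGL_val, tauM_apply, Fin.rev_rev]

omit [Fintype F] in
theorem sigma_tau (M : Matrix (Fin n) (Fin n) F) : sigma (tauM M) = sigma M := by
  unfold sigma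
  rw [Finset.sum_comm, ← Equiv.sum_comp Fin.revPerm]
  refine Finset.sum_congr rfl fun i _ => ?_
  rw [← Equiv.sum_comp Fin.revPerm]
  refine Finset.sum_congr rfl fun j _ => ?_
  simp only [Fin.revPerm_apply, tauM_apply, Fin.rev_rev, Fin.val_rev]
  have e : (n - (↑i + 1) = n - (↑j + 1) + 1) ↔ (j : ℕ) = i + 1 := by omega
  by_cases h : (j : ℕ) = i + 1
  · rw [if_pos h, if_pos (e.2 h)]
  · rw [if_neg h, if_neg (fun hc => h (e.1 hc))]

omit [Fintype F] in
theorem tau_mono {π : Equiv.Perm (Fin n)} {t : Fin n → Fˣ} (h : Good π t) :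
    tauGL (mono π t) = mono π t := by
  apply Units.ext
  ext i j
  rw [tauGL_val, tauM_apply, mono_val, mono_val]
  obtain ⟨h1, h2⟩ := h.sym j
  by_cases hi : i = π j
  · rw [if_pos hi, if_pos (by rw [hi, h1]), hi, h2]
  · rw [if_neg hi, if_neg]
    intro hc
    rw [← h1] at hc
    exact hi (Fin.rev_injective (π.injective hc)).symm

theorem psi_inv {U : Type} [Group U] [Fintype U] (ψ : U →* ℂ) (u : U) : ψ u⁻¹ = (ψ u)⁻¹ :=
  eq_inv_of_mul_eq_one_right (psi_inv_mul ψ u)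

theorem good_psi (Ψ : AddChar F ℂ) {u u' : UT n F} {π : Equiv.Perm (Fin n)} {t : Fin n → Fˣ}
    (hg : Good π t) (h : u.1 * mono π t * u'.1 = mono π t) :
    psiU n Ψ u * psiU n Ψ u' = 1 := by
  have h0 : u.1 * mono π t = mono π t * (u'⁻¹).1 := by
    rw [Subgroup.coe_inv, eq_mul_inv_iff_mul_eq, h]
  have hL : ∀ i j, (u.1 * mono π t).val i j = u.1.val i (π j) * t j := by
    intro i j
    rw [Units.val_mul, Matrix.mul_apply, Finset.sum_eq_single (π j)]
    · rw [mono_val, if_pos rfl]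
    · intro k _ hk; rw [mono_val, if_neg hk, mul_zero]
    · simp
  have hR : ∀ i j, (mono π t * (u'⁻¹).1).val (π i) j = t i * (u'⁻¹).1.val i j := by
    intro i j
    rw [Units.val_mul, Matrix.mul_apply, Finset.sum_eq_single i]
    · rw [mono_val, if_pos rfl]
    · intro k _ hk
      rw [mono_val, if_neg (fun hc => hk (π.injective hc.symm)), zero_mul]
    · simp
  have hent : ∀ i j, u.1.val (π i) (π j) * t j = t i * (u'⁻¹).1.val i j := by
    intro i j; rw [← hL, ← hR, h0]
  have hu := mem_UT.1 u.2
  have hv := mem_UT.1 (u'⁻¹).2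
  have hs : sigma u.1.val = sigma (u'⁻¹).1.val := by
    unfold sigma
    rw [← Equiv.sum_comp π]
    refine Finset.sum_congr rfl fun i _ => ?_
    rw [← Equiv.sum_comp π]
    refine Finset.sum_congr rfl fun j _ => ?_
    have he := hent i j
    by_cases h1 : (j : ℕ) = i + 1
    · have hij : i < j := by show (i : ℕ) < j; omega
      rw [if_pos h1]
      by_cases h2 : π i < π j
      · obtain ⟨h3, h4⟩ := hg i j hij h2
        rw [if_pos (by omega)]
        rw [h4, mul_comm] at he
        exact mul_left_cancel₀ (t j).ne_zero he
      · have h2' : ¬ (π i : ℕ) < π j := h2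
        rw [if_neg (by omega)]
        have h5 : π j < π i := lt_of_le_of_ne (not_lt.1 h2) fun hc => ne_of_gt hij (π.injective hc)
        rw [hu.2 _ _ h5, zero_mul] at he
        exact (mul_eq_zero.1 he.symm).resolve_left (t i).ne_zero |>.symm
    · rw [if_neg h1]
      split_ifs with h2
      · have h3 : π i < π j := by show (π i : ℕ) < π j; omega
        rcases lt_trichotomy i j with h4 | h4 | h4
        · have := (hg i j h4 h3).1; omega
        · subst h4; exact absurd h3 (lt_irrefl _)
        · rw [hv.2 _ _ h4, mul_zero] at he
          exact (mul_eq_zero.1 he).resolve_right (t j).ne_zero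
      · rfl
  have : psiU n Ψ u = psiU n Ψ u'⁻¹ := by rw [psiU_apply, psiU_apply, hs]
  rw [this, mul_comm]
  exact psi_inv_mul _ _

noncomputable def eGG (m : ℕ) {F : Type} [Field F] [Fintype F] (Ψ : AddChar F ℂ) :
    MonoidAlgebra ℂ (PG (m+1) F) := idem (iotaP (m+1) F) (psiU (m+1) Ψ)

noncomputable def wGG (x : GX m F) : PG (m+1) F := mkP (m+1) F (mono x.1.1 x.1.2)

theorem GG_ha (Ψ : AddChar F ℂ) (hΨ : Ψ ≠ 1) (g : PG (m+1) F) :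
    idem (iotaP (m+1) F) (psiU (m+1) Ψ) * MonoidAlgebra.of ℂ _ g *
      idem (iotaP (m+1) F) (psiU (m+1) Ψ) = 0 ∨
    ∃ (x : GX m F) (u u' : UT (m+1) F), g = iotaP (m+1) F u * wGG x * iotaP (m+1) F u' := by
  obtain ⟨g0, rfl⟩ := ProjGenLinGroup.mk_surjective g
  obtain ⟨u, hu, u', hu', π, t, rfl⟩ := bruhat g0
  set z := (t (Fin.last m))⁻¹ with hz
  have h1 : mkP (m+1) F (u * mono π t * u') = iotaP (m+1) F ⟨u, hu⟩ *
      mkP (m+1) F (mono π (fun j => z * t j)) * iotaP (m+1) F ⟨u', hu'⟩ := by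
    rw [mkP_mono_smul, map_mul, map_mul]; rfl
  by_cases hg : Good π (fun j => z * t j)
  · right
    exact ⟨⟨(π, fun j => z * t j), hg, by simp [hz]⟩, ⟨u, hu⟩, ⟨u', hu'⟩, h1⟩
  · left
    change _ * MonoidAlgebra.of ℂ (PG (m+1) F) (mkP (m+1) F (u * mono π t * u')) * _ = 0
    rw [h1, idem_move, not_good_zero Ψ hΨ π _ hg, smul_zero]

theorem GG_hb (x y : GX m F) (u u' : UT (m+1) F)
    (h : iotaP (m+1) F u * wGG x * iotaP (m+1) F u' = wGG y) :
    x = y ∧ u.1 * mono x.1.1 x.1.2 * u'.1 = mono x.1.1 x.1.2 := by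
  obtain ⟨h1, z, h2, h3⟩ := mono_disjoint_P u.2 u'.2 h
  refine ⟨?_, h3⟩
  have hz := h2 (Fin.last m)
  rw [x.2.2, y.2.2, mul_one] at hz
  apply Subtype.ext
  apply Prod.ext h1
  funext j
  rw [h2 j, ← hz, one_mul]

theorem eGG_idem (Ψ : AddChar F ℂ) : eGG m Ψ * eGG m Ψ = eGG m Ψ := idem_idem _ _

theorem GG_comm (Ψ : AddChar F ℂ) (hΨ : Ψ ≠ 1) :
    ∀ x y, (eGG m Ψ * x * eGG m Ψ) * (eGG m Ψ * y * eGG m Ψ) =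
      (eGG m Ψ * y * eGG m Ψ) * (eGG m Ψ * x * eGG m Ψ) := by
  refine gelfand_comm (iotaP (m+1) F) (psiU (m+1) Ψ) wGG (GG_ha Ψ hΨ)
    (fun g => (tauP (m+1) F g).unop) (by simp) (fun g h => by rw [map_mul]; rfl)
    (fun u => ⟨tauGL u.1, tauGL_UT u.2⟩) ?_ (fun u => rfl) ?_ ?_
  · apply Function.Involutive.bijective
    intro u
    exact Subtype.ext (tauGL_tauGL u.1)
  · intro u
    rw [psi_inv, psi_inv]
    congr 1
    rw [psiU_apply, psiU_apply, tauGL_val, sigma_tau]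
  · intro x
    show mkP (m+1) F (tauGL (mono x.1.1 x.1.2)) = _
    rw [tau_mono x.2.1]; rfl

theorem GG_main (Ψ : AddChar F ℂ) (hΨ : Ψ ≠ 1) (W : WD (PG (m+1) F)) :
    (∀ i, W.rk i (eGG m Ψ) ≤ 1) ∧ ∑ i, W.rk i (eGG m Ψ) ^ 2 = Fintype.card F ^ m ∧
    Fintype.card (UT (m+1) F) * ∑ i, W.d i * W.rk i (eGG m Ψ) = Fintype.card (PG (m+1) F) := by
  refine ⟨W.rk_le_one _ (eGG_idem Ψ) (GG_comm Ψ hΨ), ?_, ?_⟩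
  · rw [W.sum_rk_sq _ (eGG_idem Ψ), ← card_GX]
    exact gelfand_dim _ _ wGG (GG_ha Ψ hΨ) (fun x y u u' h => (GG_hb x y u u' h).1)
      (fun x u u' h => good_psi Ψ x.2.1 (GG_hb x x u u' h).2)
  · have h1 := W.sum_d_rk _ (eGG_idem (m := m) Ψ)
    unfold eGG at h1 ⊢
    rw [idem_coeff_one _ _ iotaP_inj] at h1
    have h2 : (Fintype.card (UT (m+1) F) : ℂ) ≠ 0 := by
      exact_mod_cast Fintype.card_ne_zero
    rw [← div_eq_mul_inv, eq_div_iff h2, mul_comm] at h1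
    exact_mod_cast h1

end gg
end PSLeps
end

section
namespace PSLeps
open Matrix

section cards
variable {n m : ℕ} {F : Type} [Field F] [Fintype F]

abbrev PS (n : ℕ) (F : Type) [Field F] : Type := ProjectiveSpecialLinearGroup (Fin n) F

instance instFinitePS : Finite (PS n F) :=
  Finite.of_injective _ (ProjectiveSpecialLinearGroup.toPGL_injective (n := Fin n) (R := F))

def Aq (q m : ℕ) : ℕ := ∏ i ∈ Finset.range m, (q ^ (i + 2) - 1)
def Pq (q m : ℕ) : ℕ := ∏ i ∈ Finset.range m, (q ^ (i + 1) - 1)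

theorem prod_GL (q n : ℕ) : ∏ i ∈ Finset.range n, (q ^ n - q ^ i) =
    q ^ (n * (n - 1) / 2) * ∏ i ∈ Finset.range n, (q ^ (i + 1) - 1) := by
  rw [← Finset.prod_range_reflect (fun i => q ^ (i + 1) - 1), ← Finset.sum_range_id,
    ← Finset.prod_pow_eq_pow_sum, ← Finset.prod_mul_distrib]
  refine Finset.prod_congr rfl fun i hi => ?_
  have hi' := Finset.mem_range.1 hi
  rw [Nat.mul_sub, ← pow_add, mul_one]
  congr 2
  omega

theorem card_units_F : Nat.card Fˣ = Fintype.card F - 1 := by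
  rw [Nat.card_eq_fintype_card, Fintype.card_units]

theorem card_PG : Fintype.card (PG (m+1) F) =
    Fintype.card F ^ ((m+1) * m / 2) * Aq (Fintype.card F) m := by
  have hq : 2 ≤ Fintype.card F := Fintype.one_lt_card
  have h1 : Nat.card (GL (Fin (m+1)) F) = Nat.card (PG (m+1) F) * Nat.card Fˣ := by
    rw [Subgroup.card_eq_card_quotient_mul_card_subgroup (Subgroup.center (GL (Fin (m+1)) F))]
    congr 1
    rw [GeneralLinearGroup.center_eq_range_scalar]
    refine (Nat.card_congr (MonoidHom.ofInjective (f := GeneralLinearGroup.scalar (Fin (m+1)) (R := F)) ?_).toEquiv).symm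
    intro a b hab
    rw [scalar_eq_mono, scalar_eq_mono] at hab
    exact congrFun (mono_inj hab).2 0
  rw [Matrix.card_GL_field, Fin.prod_univ_eq_prod_range (fun i => Fintype.card F ^ (m+1) - Fintype.card F ^ i),
    prod_GL, Finset.prod_range_succ', card_units_F, Nat.card_eq_fintype_card, zero_add, pow_one,
    ← mul_assoc] at h1
  have := Nat.eq_of_mul_eq_mul_right (by omega) h1
  rw [← this]; rfl

theorem card_PS : ∃ g : ℕ, g ∣ m + 1 ∧ g ∣ Fintype.card F - 1 ∧
    Nat.card (PG (m+1) F) = g * Nat.card (PS (m+1) F) := by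
  have hq : 2 ≤ Fintype.card F := Fintype.one_lt_card
  refine ⟨Nat.card (rootsOfUnity (m+1) F), ?_, ?_, ?_⟩
  · obtain ⟨x, hx⟩ := IsCyclic.exists_generator (α := rootsOfUnity (m+1) F)
    rw [← orderOf_eq_card_of_forall_mem_zpowers hx]
    apply orderOf_dvd_of_pow_eq_one
    exact Subtype.ext ((mem_rootsOfUnity _ _).1 x.2)
  · rw [← card_units_F]
    exact Subgroup.card_subgroup_dvd_card _
  · have h1 : Nat.card (GL (Fin (m+1)) F) = Nat.card (PG (m+1) F) * Nat.card Fˣ := by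
      rw [Subgroup.card_eq_card_quotient_mul_card_subgroup (Subgroup.center (GL (Fin (m+1)) F))]
      congr 1
      rw [GeneralLinearGroup.center_eq_range_scalar]
      refine (Nat.card_congr (MonoidHom.ofInjective (f := GeneralLinearGroup.scalar (Fin (m+1)) (R := F)) ?_).toEquiv).symm
      intro a b hab
      rw [scalar_eq_mono, scalar_eq_mono] at hab
      exact congrFun (mono_inj hab).2 0
    have h2 : Nat.card (SpecialLinearGroup (Fin (m+1)) F) =
        Nat.card (PS (m+1) F) * Nat.card (rootsOfUnity (m+1) F) := by
      rw [Subgroup.card_eq_card_quotient_mul_card_subgroup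
        (Subgroup.center (SpecialLinearGroup (Fin (m+1)) F))]
      congr 1
      rw [Nat.card_congr (SpecialLinearGroup.center_equiv_rootsOfUnity (n := Fin (m+1)) (R := F)).toEquiv]
      simp
    have h3 : Nat.card (GL (Fin (m+1)) F) = Nat.card Fˣ * Nat.card (SpecialLinearGroup (Fin (m+1)) F) := by
      rw [Subgroup.card_eq_card_quotient_mul_card_subgroup
        (MonoidHom.ker (GeneralLinearGroup.det (n := Fin (m+1)) (R := F)))]
      congr 1
      · exact Nat.card_congr (QuotientGroup.quotientKerEquivOfSurjective _
          GeneralLinearGroup.det_surjective).toEquiv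
      · symm
        refine Nat.card_congr (Equiv.ofBijective (fun g => ⟨SpecialLinearGroup.toGL g, ?_⟩) ⟨?_, ?_⟩)
        · rw [MonoidHom.mem_ker]
          apply Units.ext
          exact g.2
        · intro a b hab
          exact SpecialLinearGroup.toGL_injective (congrArg Subtype.val hab)
        · rintro ⟨g, hg⟩
          rw [MonoidHom.mem_ker] at hg
          refine ⟨⟨g.val, congrArg Units.val hg⟩, ?_⟩
          apply Subtype.ext
          apply Units.ext
          rfl
    have h4 : 0 < Nat.card Fˣ := Nat.card_pos
    have : Nat.card (PG (m+1) F) * Nat.card Fˣ =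
        (Nat.card (rootsOfUnity (m+1) F) * Nat.card (PS (m+1) F)) * Nat.card Fˣ := by
      rw [← h1, h3, h2]; ring
    exact Nat.eq_of_mul_eq_mul_right h4 this

end cards
end PSLeps
end

section
namespace PSLeps
open Matrix

section idemgen
variable {G U : Type} [Group G] [Fintype G] [Group U] [Fintype U] (ι : U →* G)

theorem idem_conj (ψ ψ' : U →* ℂ) (θ : U ≃ U) (g : G) (h : ∀ u, g * ι u = ι (θ u) * g)
    (hψ : ∀ u, ψ' (θ u)⁻¹ = ψ u⁻¹) :
    MonoidAlgebra.of ℂ G g * idem ι ψ = idem ι ψ' * MonoidAlgebra.of ℂ G g := by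
  unfold idem
  rw [mul_smul_comm, smul_mul_assoc, Finset.mul_sum, Finset.sum_mul]
  congr 1
  rw [← Equiv.sum_comp θ (fun u => (ψ' u⁻¹ • MonoidAlgebra.of ℂ G (ι u)) * MonoidAlgebra.of ℂ G g)]
  refine Finset.sum_congr rfl fun u _ => ?_
  rw [mul_smul_comm, smul_mul_assoc, ← map_mul, ← map_mul, h, hψ]

theorem idem_comm (ψ : U →* ℂ) (E : MonoidAlgebra ℂ G)
    (h : ∀ u, MonoidAlgebra.of ℂ G (ι u) * E = E * MonoidAlgebra.of ℂ G (ι u)) :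
    idem ι ψ * E = E * idem ι ψ := by
  unfold idem
  rw [mul_smul_comm, smul_mul_assoc, Finset.mul_sum, Finset.sum_mul]
  congr 1
  refine Finset.sum_congr rfl fun u _ => ?_
  rw [mul_smul_comm, smul_mul_assoc, h]

theorem idem_absorb (ψ : U →* ℂ) (e : MonoidAlgebra ℂ G)
    (h : ∀ u, MonoidAlgebra.of ℂ G (ι u) * e = ψ u • e) : idem ι ψ * e = e := by
  unfold idem
  rw [smul_mul_assoc, Finset.sum_mul]
  have : ∀ u ∈ (Finset.univ : Finset U), ψ u⁻¹ • MonoidAlgebra.of ℂ G (ι u) * e = e := by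
    intro u _
    rw [smul_mul_assoc, h, smul_smul, mul_comm, psi_inv_mul, one_smul]
  rw [Finset.sum_congr rfl this, Finset.sum_const, Finset.card_univ, ← Nat.cast_smul_eq_nsmul ℂ,
    smul_smul, inv_mul_cancel₀, one_smul]
  exact_mod_cast Fintype.card_ne_zero

end idemgen

section column
variable {n m : ℕ} {F : Type} [Field F] [Fintype F]

def NM (k : Fin n) (a : Fin n → F) : Matrix (Fin n) (Fin n) F :=
  Matrix.of fun r s => if s = k ∧ r < k then a r else 0

omit [Fintype F] in
theorem NM_apply (k : Fin n) (a : Fin n → F) (r s) :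
  NM k a r s = if s = k ∧ r < k then a r else 0 := rfl

omit [Fintype F] in
theorem NM_add (k : Fin n) (a b : Fin n → F) : NM k (a + b) = NM k a + NM k b := by
  ext r s
  rw [Matrix.add_apply, NM_apply, NM_apply, NM_apply]
  split_ifs <;> simp

omit [Fintype F] in
theorem NM_mul (k : Fin n) (a b : Fin n → F) : NM k a * NM k b = 0 := by
  ext r s
  rw [Matrix.mul_apply]
  refine Finset.sum_eq_zero fun j _ => ?_
  rw [NM_apply, NM_apply]
  by_cases h : j = k
  · rw [if_neg (c := s = k ∧ j < k) (fun hc => absurd hc.2 (by rw [h]; exact lt_irrefl _)), mul_zero]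
  · rw [if_neg (fun hc => h hc.1), zero_mul]

omit [Fintype F] in
theorem Y_mul (k : Fin n) (a b : Fin n → F) : (1 + NM k a) * (1 + NM k b) = 1 + NM k (a + b) := by
  rw [mul_add, add_mul, add_mul, mul_one, NM_mul, NM_add, add_zero, one_mul, mul_one, add_assoc]

omit [Fintype F] in
theorem NM_zero (k : Fin n) : NM k (0 : Fin n → F) = 0 := by
  ext r s; rw [NM_apply]; simp

def Yg (k : Fin n) (a : Fin n → F) : GL (Fin n) F where
  val := 1 + NM k a
  inv := 1 + NM k (-a)
  val_inv := by rw [Y_mul, add_neg_cancel, NM_zero, add_zero]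
  inv_val := by rw [Y_mul, neg_add_cancel, NM_zero, add_zero]

omit [Fintype F] in
theorem Yg_val (k : Fin n) (a : Fin n → F) : (Yg k a).val = 1 + NM k a := rfl

theorem Yg_UT (k : Fin n) (a : Fin n → F) : Yg k a ∈ UT n F := by
  rw [mem_UT, Yg_val]
  constructor
  · intro i
    rw [Matrix.add_apply, NM_apply, if_neg, Matrix.one_apply_eq, add_zero]
    rintro ⟨h1, h2⟩; exact absurd h1 (ne_of_lt h2)
  · intro i j hij
    rw [Matrix.add_apply, NM_apply, if_neg, Matrix.one_apply_ne (ne_of_gt hij), add_zero]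
    rintro ⟨h1, h2⟩; rw [h1] at hij; exact lt_asymm hij h2

noncomputable def yP (k : Fin n) : Multiplicative (Fin n → F) →* PG n F where
  toFun a := mkP n F (Yg k a.toAdd)
  map_one' := by
    have : Yg k (0 : Fin n → F) = 1 := Units.ext (by rw [Yg_val, NM_zero, add_zero]; rfl)
    rw [toAdd_one, this, map_one]
  map_mul' a b := by
    rw [← map_mul]
    congr 1
    exact Units.ext (Y_mul k _ _).symm

noncomputable def psiL (Ψ : AddChar F ℂ) (l : Fin n → F) : Multiplicative (Fin n → F) →* ℂ where
  toFun a := Ψ (l ⬝ᵥ a.toAdd)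
  map_one' := by rw [toAdd_one, dotProduct_zero, AddChar.map_zero_eq_one]
  map_mul' a b := by rw [toAdd_mul, dotProduct_add, AddChar.map_add_eq_mul]

theorem psiL_apply (Ψ : AddChar F ℂ) (l : Fin n → F) (a) : psiL Ψ l a = Ψ (l ⬝ᵥ a.toAdd) := rfl

noncomputable def fK (Ψ : AddChar F ℂ) (k : Fin n) (l : Fin n → F) : MonoidAlgebra ℂ (PG n F) :=
  idem (yP k) (psiL Ψ l)

theorem char_sum (Ψ : AddChar F ℂ) (hΨ : Ψ ≠ 1) (a : Fin n → F) :
    ∑ l : Fin n → F, Ψ (l ⬝ᵥ a) = if a = 0 then (Fintype.card (Fin n → F) : ℂ) else 0 := by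
  split_ifs with h
  · subst h
    simp
  · obtain ⟨i, hi⟩ : ∃ i, a i ≠ 0 := by
      by_contra hc; push Not at hc; exact h (funext hc)
    obtain ⟨c0, hc0⟩ : ∃ c, Ψ c ≠ 1 := by
      by_contra hc
      push Not at hc
      exact hΨ (AddChar.ext _ _ (by simpa using hc))
    have h1 := Equiv.sum_comp (Equiv.addRight (Pi.single i (c0 / a i) : Fin n → F))
      (fun l : Fin n → F => Ψ (l ⬝ᵥ a))
    simp only [Equiv.coe_addRight, add_dotProduct, single_dotProduct, AddChar.map_add_eq_mul,
      div_mul_cancel₀ _ hi] at h1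
    rw [← Finset.sum_mul] at h1
    by_contra hS
    exact hc0 (mul_left_cancel₀ hS (by rw [h1, mul_one]))

theorem sum_fK (Ψ : AddChar F ℂ) (hΨ : Ψ ≠ 1) (k : Fin n) : ∑ l, fK Ψ k l = 1 := by
  unfold fK idem
  rw [← Finset.smul_sum, Finset.sum_comm]
  have h1 : ∀ a : Multiplicative (Fin n → F), ∑ l : Fin n → F, psiL Ψ l a⁻¹ •
      MonoidAlgebra.of ℂ (PG n F) (yP k a) =
      if a = 1 then (Fintype.card (Fin n → F) : ℂ) • 1 else 0 := by
    intro a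
    rw [← Finset.sum_smul]
    simp only [psiL_apply, char_sum Ψ hΨ]
    by_cases h : a = 1
    · subst h
      rw [if_pos rfl, inv_one, toAdd_one, if_pos rfl, map_one, map_one]
    · rw [if_neg h, if_neg, zero_smul]
      intro hc
      apply h
      rw [toAdd_inv, neg_eq_zero] at hc
      exact hc
  rw [Finset.sum_congr rfl fun a _ => h1 a, Finset.sum_ite_eq' Finset.univ, if_pos (Finset.mem_univ _),
    smul_smul]
  have : (Fintype.card (Multiplicative (Fin n → F)) : ℂ) = Fintype.card (Fin n → F) := by
    rw [Fintype.card_multiplicative]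
  rw [this, inv_mul_cancel₀, one_smul]
  exact_mod_cast Fintype.card_ne_zero

/-- matrices with identity rows and columns from k on -/
def kT (k : Fin n) (g : GL (Fin n) F) : Prop :=
  (∀ r s, k ≤ r → g.val r s = (1 : Matrix (Fin n) (Fin n) F) r s) ∧
  (∀ r s, k ≤ s → g.val r s = (1 : Matrix (Fin n) (Fin n) F) r s)

omit [Fintype F] in
theorem kT_conj {k : Fin n} {g : GL (Fin n) F} (hg : kT k g) (a : Fin n → F) :
    g * Yg k a = Yg k (g.val *ᵥ a) * g := by
  apply Units.ext
  rw [Units.val_mul, Units.val_mul, Yg_val, Yg_val, mul_add, add_mul, mul_one, one_mul]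
  congr 1
  ext r s
  rw [Matrix.mul_apply, Matrix.mul_apply]
  have hR : ∑ j, NM k (g.val *ᵥ a) r j * g.val j s =
      if s = k ∧ r < k then (g.val *ᵥ a) r else 0 := by
    rw [Finset.sum_eq_single k]
    · rw [NM_apply, hg.1 k s le_rfl]
      by_cases h : s = k
      · subst h; simp
      · rw [Matrix.one_apply_ne (Ne.symm h), mul_zero, if_neg (fun hc => h hc.1)]
    · intro j _ hj
      rw [NM_apply, if_neg (fun hc => hj hc.1), zero_mul]
    · simp
  rw [hR]
  by_cases hs : s = k
  · by_cases hr : r < k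
    · rw [if_pos ⟨hs, hr⟩]
      show _ = ∑ j, g.val r j * a j
      refine Finset.sum_congr rfl fun j _ => ?_
      rw [NM_apply]
      by_cases hj : j < k
      · rw [if_pos ⟨hs, hj⟩]
      · rw [if_neg (fun hc => hj hc.2), hg.2 r j (not_lt.1 hj), Matrix.one_apply_ne, zero_mul, zero_mul]
        rintro rfl; exact hj hr
    · rw [if_neg (fun hc => hr hc.2)]
      refine Finset.sum_eq_zero fun j _ => ?_
      rw [NM_apply]
      by_cases hj : j < k
      · rw [hg.1 r j (not_lt.1 hr), Matrix.one_apply_ne, zero_mul]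
        rintro rfl; exact hr hj
      · rw [if_neg (fun hc => hj hc.2), mul_zero]
  · rw [if_neg (fun hc => hs hc.1)]
    refine Finset.sum_eq_zero fun j _ => ?_
    rw [NM_apply, if_neg (fun hc => hs hc.1), mul_zero]

theorem fK_conj (Ψ : AddChar F ℂ) {k : Fin n} {g : GL (Fin n) F} (hg : kT k g) (μ : Fin n → F) :
    MonoidAlgebra.of ℂ (PG n F) (mkP n F g) * fK Ψ k (μ ᵥ* g.val) =
      fK Ψ k μ * MonoidAlgebra.of ℂ (PG n F) (mkP n F g) := by
  let θ : Multiplicative (Fin n → F) ≃ Multiplicative (Fin n → F) :=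
    { toFun := fun a => Multiplicative.ofAdd (g.val *ᵥ a.toAdd)
      invFun := fun a => Multiplicative.ofAdd ((g⁻¹).val *ᵥ a.toAdd)
      left_inv := fun a => by
        show Multiplicative.ofAdd ((g⁻¹).val *ᵥ (g.val *ᵥ a.toAdd)) = a
        rw [Matrix.mulVec_mulVec, ← Units.val_mul, inv_mul_cancel, Units.val_one, Matrix.one_mulVec]
        rfl
      right_inv := fun a => by
        show Multiplicative.ofAdd (g.val *ᵥ ((g⁻¹).val *ᵥ a.toAdd)) = a
        rw [Matrix.mulVec_mulVec, ← Units.val_mul, mul_inv_cancel, Units.val_one, Matrix.one_mulVec]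
        rfl }
  refine idem_conj _ _ _ θ _ ?_ ?_
  · intro a
    show mkP n F g * mkP n F (Yg k a.toAdd) = mkP n F (Yg k (g.val *ᵥ a.toAdd)) * mkP n F g
    rw [← map_mul, ← map_mul, kT_conj hg]
  · intro a
    rw [psiL_apply, psiL_apply, toAdd_inv, toAdd_inv, dotProduct_neg, dotProduct_neg,
      ← Matrix.dotProduct_mulVec]
    rfl

end column
end PSLeps
end

section
namespace PSLeps
open Matrix

section gk
variable {n m : ℕ} {F : Type} [Field F] [Fintype F]

def RM (p : Fin n) (v : Fin n → F) : Matrix (Fin n) (Fin n) F :=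
  Matrix.of fun r s => if r = p then v s else (1 : Matrix (Fin n) (Fin n) F) r s

omit [Fintype F] in
theorem RM_apply (p : Fin n) (v : Fin n → F) (r s) :
  RM p v r s = if r = p then v s else (1 : Matrix (Fin n) (Fin n) F) r s := rfl

omit [Fintype F] in
theorem RM_mul (p : Fin n) (v : Fin n → F) (hv : v p ≠ 0) :
    RM p v * RM p (fun s => if s = p then (v p)⁻¹ else - v s / v p) = 1 := by
  ext r s
  rw [Matrix.mul_apply]
  by_cases hr : r = p
  · subst hr
    rw [← Finset.add_sum_erase _ _ (Finset.mem_univ r), RM_apply, RM_apply, if_pos rfl, if_pos rfl]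
    have : ∀ j ∈ Finset.univ.erase r, RM r v r j * RM r (fun s => if s = r then (v r)⁻¹ else - v s / v r) j s
        = if s = j then v j else 0 := by
      intro j hj
      rw [RM_apply, RM_apply, if_pos rfl, if_neg (Finset.ne_of_mem_erase hj), Matrix.one_apply]
      by_cases h : j = s
      · subst h; simp
      · rw [if_neg h, if_neg (Ne.symm h), mul_zero]
    rw [Finset.sum_congr rfl this, Finset.sum_ite_eq]
    by_cases h : s = r
    · subst h; simp [hv]
    · rw [if_neg h, if_pos (by simp [h]), Matrix.one_apply_ne (Ne.symm h)]
      field_simp; ring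
  · rw [Finset.sum_eq_single r]
    · rw [RM_apply, RM_apply, if_neg hr, if_neg hr, Matrix.one_apply_eq, one_mul]
    · intro j _ hj
      rw [RM_apply, if_neg hr, Matrix.one_apply_ne (Ne.symm hj), zero_mul]
    · simp

def Rg (p : Fin n) (v : Fin n → F) (hv : v p ≠ 0) : GL (Fin n) F where
  val := RM p v
  inv := RM p (fun s => if s = p then (v p)⁻¹ else - v s / v p)
  val_inv := RM_mul p v hv
  inv_val := mul_eq_one_comm.1 (RM_mul p v hv)

theorem Rg_val (p : Fin n) (v : Fin n → F) (hv : v p ≠ 0) : (Rg p v hv).val = RM p v := rfl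

theorem Rg_kT {p k : Fin n} (hp : p < k) (v : Fin n → F) (hv : v p ≠ 0) (hs : ∀ r, k ≤ r → v r = 0) :
    kT k (Rg p v hv) := by
  constructor
  · intro r s h
    rw [Rg_val, RM_apply, if_neg (ne_of_gt (lt_of_lt_of_le hp h))]
  · intro r s h
    rw [Rg_val, RM_apply]
    by_cases hr : r = p
    · rw [if_pos hr, hs s h, hr, Matrix.one_apply_ne (ne_of_lt (lt_of_lt_of_le hp h))]
    · rw [if_neg hr]

theorem single_Rg (p : Fin n) (v : Fin n → F) (hv : v p ≠ 0) :
    (Pi.single p 1 : Fin n → F) ᵥ* (Rg p v hv).val = v := by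
  funext s
  rw [Matrix.single_one_vecMul, Rg_val]
  show RM p v p s = _
  rw [RM_apply, if_pos rfl]

omit [Fintype F] in
theorem swap_kT {p s k : Fin n} (hp : p < k) (hs : s < k) :
    kT k (mono (F := F) (Equiv.swap p s) 1) := by
  constructor
  · intro r c h
    rw [mono_val, Matrix.one_apply]
    have h1 : Equiv.swap p s r = r :=
      Equiv.swap_apply_of_ne_of_ne (ne_of_gt (lt_of_lt_of_le hp h)) (ne_of_gt (lt_of_lt_of_le hs h))
    have h2 : (r = Equiv.swap p s c) ↔ r = c := by
      constructor
      · intro h3; rw [← h1, h3, Equiv.swap_apply_self]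
      · rintro rfl; exact h1.symm
    by_cases h3 : r = c
    · rw [if_pos (h2.2 h3), if_pos h3]; rfl
    · rw [if_neg (fun hc => h3 (h2.1 hc)), if_neg h3]
  · intro r c h
    rw [mono_val, Matrix.one_apply]
    have h1 : Equiv.swap p s c = c :=
      Equiv.swap_apply_of_ne_of_ne (ne_of_gt (lt_of_lt_of_le hp h)) (ne_of_gt (lt_of_lt_of_le hs h))
    rw [h1]; rfl

omit [Fintype F] in
theorem vecMul_mono (v : Fin n → F) (π : Equiv.Perm (Fin n)) :
    v ᵥ* (mono (F := F) π 1).val = v ∘ π := by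
  funext s
  show ∑ j, v j * (mono (F := F) π 1).val j s = v (π s)
  rw [Finset.sum_eq_single (π s)]
  · rw [mono_val, if_pos rfl]; simp
  · intro j _ hj; rw [mono_val, if_neg hj, mul_zero]
  · simp

def HK (k : ℕ) (g : GL (Fin n) F) : Prop :=
  (∀ r s : Fin n, k ≤ (r : ℕ) → g.val r s = (1 : Matrix (Fin n) (Fin n) F) r s) ∧
  (∀ r s : Fin n, k < (s : ℕ) → g.val r s = (1 : Matrix (Fin n) (Fin n) F) r s)

def ext0 (k : ℕ) (v : Fin k → F) : Fin n → F := fun r => if h : (r : ℕ) < k then v ⟨r, h⟩ else 0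

omit [Fintype F] in
theorem ext0_inj (k : ℕ) (hk : k ≤ n) : Function.Injective (ext0 (n := n) (F := F) k) := by
  intro v w h
  funext r
  have := congrFun h ⟨r, lt_of_lt_of_le r.2 hk⟩
  simpa [ext0] using this

variable (Ψ : AddChar F ℂ) (W : WD (PG n F)) (i : Fin W.k)

theorem tr_fE {k : Fin n} {g : GL (Fin n) F} (hg : kT k g) (E : MonoidAlgebra ℂ (PG n F))
    (hE : MonoidAlgebra.of ℂ _ (mkP n F g) * E = E * MonoidAlgebra.of ℂ _ (mkP n F g)) (μ : Fin n → F) :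
    W.tr i (fK Ψ k (μ ᵥ* g.val) * E) = W.tr i (fK Ψ k μ * E) := by
  have h1 : fK Ψ k (μ ᵥ* g.val) * E = MonoidAlgebra.of ℂ _ (mkP n F g)⁻¹ *
      (fK Ψ k μ * E * MonoidAlgebra.of ℂ _ (mkP n F g)) := by
    rw [mul_assoc, ← hE, ← mul_assoc (fK Ψ k μ), ← fK_conj Ψ hg, mul_assoc, ← mul_assoc, ← map_mul,
      inv_mul_cancel, map_one, one_mul]
  rw [h1, W.tr_mul_comm, mul_assoc, ← map_mul, mul_inv_cancel, map_one, mul_one]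

theorem step (hΨ : Ψ ≠ 1) {p k : Fin n} (hk : (k : ℕ) = p + 1) (E : MonoidAlgebra ℂ (PG n F))
    (hEE : E * E = E)
    (hE : ∀ g : GL (Fin n) F, HK k g → MonoidAlgebra.of ℂ _ (mkP n F g) * E =
      E * MonoidAlgebra.of ℂ _ (mkP n F g)) :
    ∃ E' : MonoidAlgebra ℂ (PG n F), E' * E' = E' ∧
      (∀ g : GL (Fin n) F, HK p g → MonoidAlgebra.of ℂ _ (mkP n F g) * E' =
        E' * MonoidAlgebra.of ℂ _ (mkP n F g)) ∧
      (Fintype.card F ^ (k : ℕ) - 1) * W.rk i E' ≤ W.rk i E ∧ 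
      E' = fK Ψ k (Pi.single p 1) * E := by
  have hpk : p < k := by rw [Fin.lt_def]; omega
  have hcomm : ∀ l, fK Ψ k l * E = E * fK Ψ k l := by
    intro l
    refine idem_comm _ _ _ fun a => hE _ ?_
    rw [HK]
    constructor
    · intro r s h
      rw [Yg_val, Matrix.add_apply, NM_apply, if_neg, add_zero]
      rintro ⟨_, h2⟩; rw [Fin.lt_def] at h2; omega
    · intro r s h
      rw [Yg_val, Matrix.add_apply, NM_apply, if_neg, add_zero]
      rintro ⟨h2, _⟩; rw [h2] at h; omega
  have hff : ∀ l, fK Ψ k l * fK Ψ k l = fK Ψ k l := fun l => idem_idem _ _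
  have hid : ∀ l, (fK Ψ k l * E) * (fK Ψ k l * E) = fK Ψ k l * E := by
    intro l
    rw [mul_assoc, ← mul_assoc E, ← hcomm, mul_assoc (fK Ψ k l) E E, hEE, ← mul_assoc, hff]
  have hkTH : ∀ g : GL (Fin n) F, kT k g → HK k g := by
    intro g hg
    exact ⟨fun r s h => hg.1 r s h, fun r s h => hg.2 r s (le_of_lt h)⟩
  refine ⟨fK Ψ k (Pi.single p 1) * E, hid _, ?_, ?_, rfl⟩
  · intro g hg
    have hgk : kT k g := by
      constructor
      · intro r s h; exact hg.1 r s (by rw [Fin.le_def] at h; omega)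
      · intro r s h; exact hg.2 r s (by rw [Fin.le_def] at h; omega)
    have hrow : (Pi.single p 1 : Fin n → F) ᵥ* g.val = Pi.single p 1 := by
      funext s
      rw [Matrix.single_one_vecMul]
      show g.val p s = _
      rw [hg.1 p s le_rfl, Matrix.one_apply, Pi.single_apply]
      by_cases h : p = s
      · rw [if_pos h, if_pos h.symm]
      · rw [if_neg h, if_neg (Ne.symm h)]
    have h2 := fK_conj Ψ hgk (Pi.single p 1)
    rw [hrow] at h2
    rw [← mul_assoc, h2, mul_assoc, hE g (hkTH g hgk), mul_assoc]
  · have hsum : W.rk i E = ∑ l, W.rk i (fK Ψ k l * E) := by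
      have : (W.rk i E : ℂ) = ∑ l, (W.rk i (fK Ψ k l * E) : ℂ) := by
        rw [← W.tr_eq_rk i E hEE]
        conv_lhs => rw [← one_mul E, ← sum_fK Ψ hΨ k, Finset.sum_mul, W.tr_sum]
        exact Finset.sum_congr rfl fun l _ => W.tr_eq_rk i _ (hid l)
      exact_mod_cast this
    have hrk : ∀ v : Fin k → F, v ≠ 0 → W.rk i (fK Ψ k (ext0 k v) * E) =
        W.rk i (fK Ψ k (Pi.single p 1) * E) := by
      intro v hv
      obtain ⟨s0, hs0⟩ : ∃ s, v s ≠ 0 := by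
        by_contra hc; push Not at hc; exact hv (funext hc)
      let s : Fin n := ⟨s0, lt_trans s0.2 k.2⟩
      have hs : s < k := by rw [Fin.lt_def]; exact s0.2
      set w : Fin n → F := (ext0 k v) ∘ Equiv.swap p s with hw
      have hwp : w p ≠ 0 := by
        rw [hw]; simp [ext0, s, hs0]
      have hw0 : ∀ r, k ≤ r → w r = 0 := by
        intro r hr
        rw [hw, Function.comp_apply, Equiv.swap_apply_of_ne_of_ne (ne_of_gt (lt_of_lt_of_le hpk hr))
          (ne_of_gt (lt_of_lt_of_le hs hr)), ext0, dif_neg]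
        rw [Fin.le_def] at hr; omega
      have hkR := Rg_kT hpk w hwp hw0
      have hkS := swap_kT (F := F) hpk hs
      have h1 := tr_fE Ψ W i hkR E (hE _ (hkTH _ hkR)) (Pi.single p 1)
      have h2 := tr_fE Ψ W i hkS E (hE _ (hkTH _ hkS)) w
      rw [single_Rg] at h1
      rw [vecMul_mono] at h2
      have h3 : w ∘ (Equiv.swap p s) = ext0 k v := by
        funext r; simp [hw]
      rw [h3, h1, W.tr_eq_rk i _ (hid _), W.tr_eq_rk i _ (hid _)] at h2
      exact_mod_cast h2
    rw [hsum]
    calc (Fintype.card F ^ (k : ℕ) - 1) * W.rk i (fK Ψ k (Pi.single p 1) * E)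
        = ∑ v ∈ Finset.univ.erase (0 : Fin k → F), W.rk i (fK Ψ k (ext0 k v) * E) := by
          rw [Finset.sum_congr rfl fun v hv => hrk v (Finset.ne_of_mem_erase hv), Finset.sum_const,
            Finset.card_erase_of_mem (Finset.mem_univ _), Finset.card_univ, smul_eq_mul]
          simp
      _ = ∑ l ∈ (Finset.univ.erase (0 : Fin k → F)).image (ext0 k), W.rk i (fK Ψ k l * E) := by
          rw [Finset.sum_image]
          intro a _ b _ h
          exact ext0_inj k (le_of_lt k.2) h
      _ ≤ _ := Finset.sum_le_sum_of_subset (Finset.subset_univ _)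

end gk

section gk2
variable {m : ℕ} {F : Type} [Field F] [Fintype F] (Ψ : AddChar F ℂ) (W : WD (PG (m+1) F)) (i : Fin W.k)

omit [Fintype F] in
theorem sigma_Y {p k : Fin (m+1)} (hk : (k : ℕ) = p + 1) (a : Fin (m+1) → F) :
    sigma (1 + NM k a) = a p := by
  unfold sigma
  rw [Finset.sum_eq_single p, Finset.sum_eq_single k]
  · rw [if_pos hk, Matrix.add_apply, NM_apply, Matrix.one_apply_ne, zero_add, if_pos ⟨rfl, by rw [Fin.lt_def]; omega⟩]
    intro h; rw [h] at hk; omega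
  · intro b _ hb
    rw [if_neg]; intro h; apply hb; apply Fin.ext; omega
  · simp
  · intro r _ hr
    refine Finset.sum_eq_zero fun s _ => ?_
    by_cases h : (s : ℕ) = r + 1
    · rw [if_pos h, Matrix.add_apply, NM_apply, if_neg, Matrix.one_apply_ne, zero_add]
      · intro h2; rw [h2] at h; omega
      · rintro ⟨h2, _⟩; apply hr; apply Fin.ext; rw [h2] at h; omega
    · rw [if_neg h]
  · simp

theorem fK_absorb {p k : Fin (m+1)} (hk : (k : ℕ) = p + 1) :
    fK Ψ k (Pi.single p 1) * eGG m Ψ = eGG m Ψ := by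
  refine idem_absorb _ _ _ fun a => ?_
  have h1 := of_mul_idem (iotaP (m+1) F) (psiU (m+1) Ψ) ⟨Yg k a.toAdd, Yg_UT k a.toAdd⟩
  rw [psiU_apply, Yg_val, sigma_Y hk] at h1
  rw [psiL_apply, single_one_dotProduct]
  exact h1

theorem chain (hΨ : Ψ ≠ 1) (k : ℕ) (hk : k ≤ m) :
    ∃ E : MonoidAlgebra ℂ (PG (m+1) F), E * E = E ∧
      (∀ g : GL (Fin (m+1)) F, HK k g → MonoidAlgebra.of ℂ _ (mkP (m+1) F g) * E =
        E * MonoidAlgebra.of ℂ _ (mkP (m+1) F g)) ∧ E * eGG m Ψ = eGG m Ψ ∧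
      (∏ j ∈ Finset.Ico k m, (Fintype.card F ^ (j+1) - 1)) * W.rk i E ≤ W.d i := by
  induction hk using Nat.decreasingInduction with
  | self =>
    refine ⟨1, one_mul _, fun g _ => by rw [one_mul, mul_one], one_mul _, ?_⟩
    have h1 := W.tr_eq_rk i 1 (one_mul _)
    rw [W.tr_one] at h1
    have h2 : W.d i = W.rk i 1 := by exact_mod_cast h1
    rw [Finset.Ico_self, Finset.prod_empty, one_mul, h2]
  | of_succ p hp ih =>
    obtain ⟨E, h1, h2, h3, h4⟩ := ih
    obtain ⟨E', e1, e2, e3, e4⟩ := step Ψ W i hΨ (p := ⟨p, by omega⟩) (k := ⟨p+1, by omega⟩) rfl E h1 h2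
    refine ⟨E', e1, e2, ?_, ?_⟩
    · rw [e4, mul_assoc, h3, fK_absorb Ψ rfl]
    · rw [Finset.prod_eq_prod_Ico_succ_bot (by omega)]
      refine le_trans ?_ h4
      rw [mul_comm (Fintype.card F ^ (p+1) - 1), mul_assoc]
      exact Nat.mul_le_mul_left _ e3

theorem Pq_le (hΨ : Ψ ≠ 1) (hi : W.rk i (eGG m Ψ) ≠ 0) : Pq (Fintype.card F) m ≤ W.d i := by
  obtain ⟨E, h1, h2, h3, h4⟩ := chain Ψ W i hΨ 0 (Nat.zero_le m)
  have h5 : W.rk i E ≠ 0 := by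
    intro h
    rw [W.rk_eq_zero] at h
    apply hi
    rw [W.rk_eq_zero, ← h3, map_mul, Pi.mul_apply, h, zero_mul]
  rw [Nat.Ico_zero_eq_range] at h4
  refine le_trans ?_ h4
  unfold Pq
  exact Nat.le_mul_of_pos_right _ (Nat.pos_of_ne_zero h5)

end gk2
end PSLeps
end

section
namespace PSLeps
open Matrix

section st
variable {n m : ℕ} {F : Type} [Field F] [Fintype F]

def pm (n : ℕ) (F : Type) [Field F] : Equiv.Perm (Fin n) →* GL (Fin n) F where
  toFun π := mono π 1
  map_one' := mono_one
  map_mul' π σ := by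
    rw [mono_mul]; congr 1; funext j; simp

omit [Fintype F] in
theorem pm_apply (π : Equiv.Perm (Fin n)) : pm n F π = mono π 1 := rfl

omit [Fintype F] in
theorem pm_val (π : Equiv.Perm (Fin n)) (i j) : (pm n F π).val i j = if i = π j then 1 else 0 := by
  rw [pm_apply, mono_val]; rfl

omit [Fintype F] in
theorem pm_mul_val (π : Equiv.Perm (Fin n)) (g : GL (Fin n) F) (i j) :
    (pm n F π * g).val i j = g.val (π⁻¹ i) j := by
  rw [Units.val_mul, Matrix.mul_apply, Finset.sum_eq_single (π⁻¹ i)]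
  · rw [pm_val, if_pos (by simp), one_mul]
  · intro b _ hb
    rw [pm_val, if_neg, zero_mul]
    rintro rfl; apply hb; simp
  · simp

omit [Fintype F] in
theorem mul_pm_val (π : Equiv.Perm (Fin n)) (g : GL (Fin n) F) (i j) :
    (g * pm n F π).val i j = g.val i (π j) := by
  rw [Units.val_mul, Matrix.mul_apply, Finset.sum_eq_single (π j)]
  · rw [pm_val, if_pos (by simp), mul_one]
  · intro b _ hb
    rw [pm_val, if_neg hb, mul_zero]
  · simp

def RK (i : Fin m) (a b : Fin (m+1)) : Prop := a ≤ b ∨ (a = i.succ ∧ b = i.castSucc)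

theorem RK_trans (i : Fin m) {a b c : Fin (m+1)} (h1 : RK i a b) (h2 : RK i b c) : RK i a c := by
  unfold RK at *
  simp only [Fin.le_def, Fin.ext_iff, Fin.val_succ, Fin.val_castSucc] at *
  omega

def PKm (i : Fin m) (F : Type) [Field F] : Submonoid (GL (Fin (m+1)) F) where
  carrier := {g | ∀ a b, ¬ RK i a b → g.val a b = 0}
  one_mem' := by
    intro a b h
    refine Matrix.one_apply_ne ?_
    rintro rfl; exact h (Or.inl le_rfl)
  mul_mem' := by
    intro x y hx hy a b h
    rw [Units.val_mul, Matrix.mul_apply]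
    refine Finset.sum_eq_zero fun c _ => ?_
    by_cases h1 : RK i a c
    · rw [hy c b (fun h2 => h (RK_trans i h1 h2)), mul_zero]
    · rw [hx a c h1, zero_mul]

def PK (i : Fin m) (F : Type) [Field F] [Fintype F] : Subgroup (GL (Fin (m+1)) F) where
  __ := PKm i F
  inv_mem' := fun {x} h => inv_mem_of_finite (PKm i F) x h

theorem mem_PK (i : Fin m) {g : GL (Fin (m+1)) F} :
    g ∈ PK i F ↔ ∀ a b, ¬ RK i a b → g.val a b = 0 := Iff.rfl

theorem BT_le_PK (i : Fin m) : BT (m+1) F ≤ PK i F := by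
  intro g hg a b h
  refine hg a b ?_
  by_contra hc
  exact h (Or.inl (not_lt.1 hc))

abbrev rr (i : Fin m) : Equiv.Perm (Fin (m+1)) := Equiv.swap i.castSucc i.succ

theorem rr_mem (i : Fin m) : pm (m+1) F (rr i) ∈ PK i F := by
  intro a b h
  rw [pm_val, if_neg]
  rintro rfl
  apply h
  by_cases h1 : b = i.castSucc
  · subst h1; right; simp
  · by_cases h2 : b = i.succ
    · subst h2; left; simp [Fin.le_def]
    · left; rw [Equiv.swap_apply_of_ne_of_ne h1 h2]

theorem rr_notMem (i : Fin m) : pm (m+1) F (rr i) ∉ BT (m+1) F := by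
  intro h
  have := h i.succ i.castSucc (by simp [Fin.lt_def])
  rw [pm_val, if_pos (by simp)] at this
  exact one_ne_zero this

omit [Fintype F] in
theorem rr_mul_self (i : Fin m) : pm (m+1) F (rr i) * pm (m+1) F (rr i) = 1 := by
  rw [← map_mul, Equiv.swap_mul_self, map_one]

theorem cs_lt (i : Fin m) : i.castSucc < i.succ := by simp [Fin.lt_def]

theorem PK_decomp (i : Fin m) {p : GL (Fin (m+1)) F} (hp : p ∈ PK i F) (hb : p ∉ BT (m+1) F) :
    ∃ a : F, ∃ b ∈ BT (m+1) F, p = xg i.castSucc i.succ (ne_of_lt (cs_lt i)) a * pm (m+1) F (rr i) * b := by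
  have h0 : p.val i.succ i.castSucc ≠ 0 := by
    intro h
    apply hb
    intro a b hab
    by_cases h1 : RK i a b
    · rcases h1 with h1 | ⟨rfl, rfl⟩
      · exact absurd hab (not_lt.2 h1)
      · exact h
    · exact hp a b h1
  set a := p.val i.castSucc i.castSucc / p.val i.succ i.castSucc with ha
  set x := xg (F := F) i.castSucc i.succ (ne_of_lt (cs_lt i)) a with hx
  have hxU : x ∈ UT (m+1) F := xg_mem_UT (cs_lt i) a
  refine ⟨a, pm (m+1) F (rr i) * (x⁻¹ * p), ?_, ?_⟩
  · have hP : pm (m+1) F (rr i) * (x⁻¹ * p) ∈ PK i F :=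
      (PK i F).mul_mem (rr_mem i) ((PK i F).mul_mem ((PK i F).inv_mem (BT_le_PK i (UT_le_BT hxU))) hp)
    intro c d hcd
    by_cases h1 : RK i c d
    · rcases h1 with h1 | ⟨rfl, rfl⟩
      · exact absurd hcd (not_lt.2 h1)
      · rw [pm_mul_val, Equiv.swap_inv, Equiv.swap_apply_right]
        set y := x⁻¹ * p with hy
        have hxy : x * y = p := by rw [hy]; group
        have e1 : p.val i.castSucc i.castSucc = (x * y).val i.castSucc i.castSucc := by rw [hxy]
        have e2 : p.val i.succ i.castSucc = (x * y).val i.succ i.castSucc := by rw [hxy]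
        rw [Units.val_mul, hx, xg_val, xM_mul] at e1 e2
        rw [if_pos rfl] at e1
        rw [if_neg (ne_of_gt (cs_lt i)), add_zero] at e2
        rw [← e2, ha, div_mul_cancel₀ _ h0] at e1
        exact right_eq_add.1 e1
    · exact hP c d h1
  · rw [mul_assoc, ← mul_assoc (pm (m+1) F (rr i)), rr_mul_self, one_mul, ← hx, mul_inv_cancel_left]

theorem BT_decomp {b : GL (Fin n) F} (hb : b ∈ BT n F) : ∃ t, ∃ u ∈ UT n F, b = mono 1 t * u := by
  have hd : ∀ j, b.val j j ≠ 0 := by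
    have h1 : b.val.det ≠ 0 := by
      have := (GeneralLinearGroup.det b).ne_zero
      simpa using this
    rw [Matrix.det_of_upperTriangular (fun i j h => hb i j h), Finset.prod_ne_zero_iff] at h1
    intro j; exact h1 j (Finset.mem_univ j)
  let t : Fin n → Fˣ := fun j => Units.mk0 _ (hd j)
  refine ⟨t, mono 1 t⁻¹ * b, ?_, ?_⟩
  · have : ∀ i j, (mono 1 t⁻¹ * b).val i j = (b.val i i)⁻¹ * b.val i j := by
      intro i j
      rw [Units.val_mul, Matrix.mul_apply, Finset.sum_eq_single i]
      · rw [mono_val, Equiv.Perm.one_apply, if_pos rfl]; simp [t]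
      · intro c _ hc
        rw [mono_val, if_neg, zero_mul]; intro h; exact hc h.symm
      · simp
    constructor
    · intro i; show (mono 1 t⁻¹ * b).val i i = 1; rw [this, inv_mul_cancel₀ (hd i)]
    · intro i j hij
      show (mono 1 t⁻¹ * b).val i j = 0
      rw [this, hb i j hij, mul_zero]
  · rw [← mul_assoc, mono_mul]
    have : mono (F := F) (n := n) (1 * 1) (fun j => t⁻¹ j * t ((1 : Equiv.Perm (Fin n)) j)) = 1 := by
      rw [← mono_one]; congr 1; funext j; simp
    rw [this, one_mul]

theorem diag_mem (t : Fin n → Fˣ) : mono 1 t ∈ BT n F := by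
  intro i j h
  show (mono 1 t : GL (Fin n) F).val i j = 0
  rw [mono_val, if_neg]; intro hc; exact ne_of_gt h hc

theorem mono_eq_pm (π : Equiv.Perm (Fin n)) (t : Fin n → Fˣ) : mono (F := F) π t = pm n F π * mono 1 t := by
  rw [pm_apply, mono_mul]; congr 1; funext j; simp

/-- value set of the Solomon-Tits element on the big cell -/
theorem big_cell {u : GL (Fin n) F} (hu : u ∈ UT n F) (π : Equiv.Perm (Fin n))
    (h : (pm n F π)⁻¹ * (u * pm n F Fin.revPerm) ∈ BT n F) : π = Fin.revPerm ∧ u = 1 := by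
  obtain ⟨t, u', hu', h1⟩ := BT_decomp h
  have h2 : u * mono Fin.revPerm 1 * u'⁻¹ = mono π t := by
    rw [mono_eq_pm π t, ← pm_apply, mul_inv_eq_iff_eq_mul, mul_assoc, ← h1]; group
  obtain ⟨h3, h4⟩ := mono_disjoint hu ((UT n F).inv_mem hu') h2
  refine ⟨h3.symm, ?_⟩
  subst h3
  apply Units.ext
  ext i j
  show u.val i j = (1 : Matrix (Fin n) (Fin n) F) i j
  rcases lt_trichotomy i j with hij | hij | hij
  · have h5 := h (Fin.rev i) (Fin.rev j) (by simpa using hij)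
    change ((pm n F Fin.revPerm)⁻¹ * (u * pm n F Fin.revPerm)).val _ _ = 0 at h5
    rw [← map_inv, pm_mul_val, mul_pm_val] at h5
    rw [Matrix.one_apply_ne (ne_of_lt hij), ← h5]
    simp
  · subst hij; rw [Matrix.one_apply_eq]; exact hu.1 i
  · rw [Matrix.one_apply_ne (ne_of_gt hij)]; exact hu.2 i j hij

theorem mem_of_mkP {g h : GL (Fin n) F} (e : mkP n F g = mkP n F h) :
    ∃ z : Fˣ, g * mono 1 (fun _ => z) = h := by
  rw [ProjGenLinGroup.mk_eq_mk_iff] at e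
  obtain ⟨z, hz⟩ := e
  exact ⟨z, by rw [← scalar_eq_mono, hz]⟩

theorem det_diag (t : Fin n → Fˣ) : (mono (F := F) 1 t).val.det = ∏ j, (t j : F) := by
  rw [Matrix.det_of_upperTriangular (fun i j h => diag_mem t i j h)]
  refine Finset.prod_congr rfl fun j _ => ?_
  rw [mono_val, Equiv.Perm.one_apply, if_pos rfl]

theorem of_det_one (g : GL (Fin n) F) (h : g.val.det = 1) :
    ∃ x : PS n F, ProjectiveSpecialLinearGroup.toPGL x = mkP n F g := by
  refine ⟨QuotientGroup.mk ⟨g.val, h⟩, ?_⟩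
  refine (ProjectiveSpecialLinearGroup.toPGL_mk _).trans ?_
  congr 1
  exact Units.ext rfl

theorem UT_SL {u : GL (Fin n) F} (hu : u ∈ UT n F) :
    ∃ x : PS n F, ProjectiveSpecialLinearGroup.toPGL x = mkP n F u :=
  of_det_one u (IsUT.det hu)

theorem exists_SL (g : GL (Fin (m+1)) F) :
    ∃ x : PS (m+1) F, ∃ b ∈ BT (m+1) F, mkP (m+1) F g = ProjectiveSpecialLinearGroup.toPGL x * mkP (m+1) F b := by
  let t : Fin (m+1) → Fˣ := fun j => if j = 0 then GeneralLinearGroup.det g else 1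
  have h1 : (mono (F := F) 1 t).val.det = g.val.det := by
    rw [det_diag, Finset.prod_eq_single 0]
    · simp [t]
    · intro b _ hb; simp [t, hb]
    · simp
  obtain ⟨x, hx⟩ := of_det_one (g * (mono 1 t)⁻¹) (by
    have h2 : GeneralLinearGroup.det (g * (mono 1 t)⁻¹) = 1 := by
      rw [map_mul, map_inv, mul_inv_eq_one]
      exact Units.ext h1.symm
    exact congrArg Units.val h2)
  refine ⟨x, mono 1 t, diag_mem t, ?_⟩
  rw [hx, ← map_mul]; group

end st
end PSLeps
end

section
namespace PSLeps
open Matrix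

section st
variable {n m : ℕ} {F : Type} [Field F] [Fintype F]

theorem mkP_mem_map {S : Subgroup (GL (Fin n) F)} (hS : BT n F ≤ S) (h : GL (Fin n) F) :
    mkP n F h ∈ S.map (mkP n F) ↔ h ∈ S := by
  constructor
  · rintro ⟨x, hx, e⟩
    obtain ⟨z, hz⟩ := mem_of_mkP e
    rw [← hz]
    exact S.mul_mem hx (hS (diag_mem _))
  · intro hh; exact ⟨h, hh, rfl⟩

noncomputable def StM (m : ℕ) (F : Type) [Field F] [Fintype F] : Submodule ℂ (PG (m+1) F → ℂ) where
  carrier := {f | (∀ y, ∀ b ∈ BT (m+1) F, f (y * mkP (m+1) F b) = f y) ∧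
    ∀ i : Fin m, ∀ y, ∑ p : PK i F, f (y * mkP (m+1) F p) = 0}
  zero_mem' := by
    constructor
    · intro y b _; rfl
    · intro i y; simp
  add_mem' := by
    rintro f g ⟨hf1, hf2⟩ ⟨hg1, hg2⟩
    constructor
    · intro y b hb; rw [Pi.add_apply, Pi.add_apply, hf1 y b hb, hg1 y b hb]
    · intro i y
      simp only [Pi.add_apply]
      rw [Finset.sum_add_distrib, hf2, hg2, add_zero]
  smul_mem' := by
    rintro c f ⟨hf1, hf2⟩
    constructor
    · intro y b hb; rw [Pi.smul_apply, Pi.smul_apply, hf1 y b hb]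
    · intro i y
      simp only [Pi.smul_apply]
      rw [← Finset.smul_sum, hf2, smul_zero]

theorem mem_StM {f : PG (m+1) F → ℂ} : f ∈ StM m F ↔
    (∀ y, ∀ b ∈ BT (m+1) F, f (y * mkP (m+1) F b) = f y) ∧
    ∀ i : Fin m, ∀ y, ∑ p : PK i F, f (y * mkP (m+1) F p) = 0 := Iff.rfl

noncomputable def sT (m : ℕ) (F : Type) [Field F] [Fintype F] : PG (m+1) F → ℂ := fun y =>
  ∑ π : Equiv.Perm (Fin (m+1)), ((Equiv.Perm.sign π : ℤ) : ℂ) *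
    (if mkP (m+1) F (pm (m+1) F π)⁻¹ * y ∈ (BT (m+1) F).map (mkP (m+1) F) then 1 else 0)

theorem N_eq (i : Fin m) : ∃ c : ℂ, ∀ z : PG (m+1) F,
    ∑ p : PK i F, (if z * mkP (m+1) F p ∈ (BT (m+1) F).map (mkP (m+1) F) then (1:ℂ) else 0) =
      if z ∈ (PK i F).map (mkP (m+1) F) then c else 0 := by
  refine ⟨∑ p : PK i F, (if p.1 ∈ BT (m+1) F then (1:ℂ) else 0), fun z => ?_⟩
  by_cases hz : z ∈ (PK i F).map (mkP (m+1) F)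
  · rw [if_pos hz]
    obtain ⟨h, hh, rfl⟩ := hz
    rw [← Equiv.sum_comp (Equiv.mulLeft (⟨h, hh⟩ : PK i F)) (fun p => if p.1 ∈ BT (m+1) F then (1:ℂ) else 0)]
    refine Finset.sum_congr rfl fun p _ => ?_
    have : (mkP (m+1) F h * mkP (m+1) F p ∈ (BT (m+1) F).map (mkP (m+1) F)) ↔
      ((Equiv.mulLeft (⟨h, hh⟩ : PK i F)) p).1 ∈ BT (m+1) F := by
      rw [← map_mul, mkP_mem_map le_rfl]; rfl
    by_cases h1 : mkP (m+1) F h * mkP (m+1) F p ∈ (BT (m+1) F).map (mkP (m+1) F)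
    · rw [if_pos h1, if_pos (this.1 h1)]
    · rw [if_neg h1, if_neg (fun h2 => h1 (this.2 h2))]
  · rw [if_neg hz]
    refine Finset.sum_eq_zero fun p _ => ?_
    rw [if_neg]
    intro hc
    apply hz
    have h2 := Subgroup.map_mono (f := mkP (m+1) F) (BT_le_PK i) hc
    have h3 : mkP (m+1) F p ∈ (PK i F).map (mkP (m+1) F) := ⟨p, p.2, rfl⟩
    exact (Subgroup.mul_mem_cancel_right _ h3).1 h2

theorem sT_mem : sT m F ∈ StM m F := by
  rw [mem_StM]
  constructor
  · intro y b hb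
    unfold sT
    refine Finset.sum_congr rfl fun π _ => ?_
    congr 1
    have h3 : mkP (m+1) F b ∈ (BT (m+1) F).map (mkP (m+1) F) := ⟨b, hb, rfl⟩
    rw [← mul_assoc]
    have := Subgroup.mul_mem_cancel_right ((BT (m+1) F).map (mkP (m+1) F))
      (y := mkP (m+1) F (pm (m+1) F π)⁻¹ * y) h3
    simp only [this]
  · intro i y
    unfold sT
    rw [Finset.sum_comm]
    obtain ⟨c, hc⟩ := N_eq (F := F) i
    have h1 : ∀ π : Equiv.Perm (Fin (m+1)), ∑ p : PK i F, ((Equiv.Perm.sign π : ℤ) : ℂ) *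
      (if mkP (m+1) F (pm (m+1) F π)⁻¹ * (y * mkP (m+1) F p) ∈ (BT (m+1) F).map (mkP (m+1) F) then 1 else 0)
      = ((Equiv.Perm.sign π : ℤ) : ℂ) * if mkP (m+1) F (pm (m+1) F π)⁻¹ * y ∈ (PK i F).map (mkP (m+1) F)
        then c else 0 := by
      intro π
      rw [← Finset.mul_sum, ← hc]
      simp only [mul_assoc]
    rw [Finset.sum_congr rfl fun π _ => h1 π]
    have h2 := Equiv.sum_comp (Equiv.mulRight (rr i)) (fun π => ((Equiv.Perm.sign π : ℤ) : ℂ) *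
      if mkP (m+1) F (pm (m+1) F π)⁻¹ * y ∈ (PK i F).map (mkP (m+1) F) then c else 0)
    have h3 : ∀ π : Equiv.Perm (Fin (m+1)),
        (fun π => ((Equiv.Perm.sign π : ℤ) : ℂ) * if mkP (m+1) F (pm (m+1) F π)⁻¹ * y ∈
          (PK i F).map (mkP (m+1) F) then c else 0) (Equiv.mulRight (rr i) π) =
        - (((Equiv.Perm.sign π : ℤ) : ℂ) * if mkP (m+1) F (pm (m+1) F π)⁻¹ * y ∈
          (PK i F).map (mkP (m+1) F) then c else 0) := by
      intro π
      have hs : Equiv.Perm.sign (π * rr i) = - Equiv.Perm.sign π := by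
        rw [Equiv.Perm.sign_mul, Equiv.Perm.sign_swap (ne_of_lt (cs_lt i)), mul_neg_one]
      have hm : mkP (m+1) F (pm (m+1) F (π * rr i))⁻¹ * y ∈ (PK i F).map (mkP (m+1) F) ↔
          mkP (m+1) F (pm (m+1) F π)⁻¹ * y ∈ (PK i F).map (mkP (m+1) F) := by
        rw [map_mul, _root_.mul_inv_rev, map_mul, mul_assoc]
        exact Subgroup.mul_mem_cancel_left _ ⟨_, (PK i F).inv_mem (rr_mem i), rfl⟩
      simp only [Equiv.coe_mulRight, hs, hm]
      push_cast
      ring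
    rw [Finset.sum_congr rfl fun π _ => h3 π, Finset.sum_neg_distrib] at h2
    have := h2
    exact self_eq_neg.1 h2.symm

theorem sT_big {u : GL (Fin (m+1)) F} (hu : u ∈ UT (m+1) F) :
    sT m F (mkP (m+1) F (u * pm (m+1) F Fin.revPerm)) =
      if u = 1 then ((Equiv.Perm.sign (Fin.revPerm (n := m+1)) : ℤ) : ℂ) else 0 := by
  unfold sT
  have h1 : ∀ π : Equiv.Perm (Fin (m+1)), 
      (mkP (m+1) F (pm (m+1) F π)⁻¹ * mkP (m+1) F (u * pm (m+1) F Fin.revPerm) ∈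
        (BT (m+1) F).map (mkP (m+1) F)) ↔ (π = Fin.revPerm ∧ u = 1) := by
    intro π
    rw [← map_mul, mkP_mem_map le_rfl]
    constructor
    · exact big_cell hu π
    · rintro ⟨rfl, rfl⟩; rw [one_mul, inv_mul_cancel]; exact (BT _ F).one_mem
  simp only [h1]
  by_cases h : u = 1
  · simp [h]
  · simp [h]

theorem st_step (f : PG (m+1) F → ℂ) (hf : f ∈ StM m F)
    (hU : ∀ u ∈ UT (m+1) F, ∀ y, f (mkP (m+1) F u * y) = f y) (i : Fin m)
    (π : Equiv.Perm (Fin (m+1))) (h : π i.castSucc < π i.succ) :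
    (f (mkP (m+1) F (pm (m+1) F π)) = 0 ↔ f (mkP (m+1) F (pm (m+1) F (π * rr i))) = 0) := by
  rw [mem_StM] at hf
  have h1 := hf.2 i (mkP (m+1) F (pm (m+1) F π))
  have h2 : ∀ p : PK i F, f (mkP (m+1) F (pm (m+1) F π) * mkP (m+1) F p) =
      (if p.1 ∈ BT (m+1) F then 1 else 0) * f (mkP (m+1) F (pm (m+1) F π)) + 
      (if p.1 ∈ BT (m+1) F then 0 else 1) * f (mkP (m+1) F (pm (m+1) F (π * rr i))) := by
    intro p
    by_cases hp : p.1 ∈ BT (m+1) F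
    · rw [if_pos hp, if_pos hp, hf.1 _ _ hp]; ring
    · rw [if_neg hp, if_neg hp]
      obtain ⟨a, b, hb, hpe⟩ := PK_decomp i p.2 hp
      have h3 : pm (m+1) F π * p.1 = xg (π i.castSucc) (π i.succ) (ne_of_lt h) (a * ((1 : Fin (m+1) → Fˣ) i.castSucc : Fˣ) / ((1 : Fin (m+1) → Fˣ) i.succ : Fˣ)) *
          (pm (m+1) F (π * rr i) * b) := by
        rw [hpe, ← mul_assoc, ← mul_assoc, pm_apply π, mono_xg, map_mul, pm_apply π]
        simp only [mul_assoc]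
      rw [← map_mul, h3, map_mul, hU _ (xg_mem_UT h _), map_mul, hf.1 _ _ hb]; ring
  rw [Finset.sum_congr rfl fun p _ => h2 p, Finset.sum_add_distrib, ← Finset.sum_mul, ← Finset.sum_mul] at h1
  have hA : ∑ p : PK i F, (if p.1 ∈ BT (m+1) F then (1:ℂ) else 0) ≠ 0 := by
    rw [Finset.sum_boole, Nat.cast_ne_zero, Finset.card_ne_zero]
    exact ⟨1, by simp [Subgroup.one_mem]⟩
  have hB : ∑ p : PK i F, (if p.1 ∈ BT (m+1) F then (0:ℂ) else 1) ≠ 0 := by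
    have : ∀ p : PK i F, (if p.1 ∈ BT (m+1) F then (0:ℂ) else 1) = if ¬ p.1 ∈ BT (m+1) F then 1 else 0 := by
      intro p; split_ifs <;> simp_all
    rw [Finset.sum_congr rfl fun p _ => this p]
    rw [Finset.sum_boole, Nat.cast_ne_zero, Finset.card_ne_zero]
    exact ⟨⟨_, rr_mem i⟩, by simp [rr_notMem]⟩
  constructor
  · intro h3; rw [h3, mul_zero, zero_add] at h1
    exact (mul_eq_zero.1 h1).resolve_left hB
  · intro h3; rw [h3, mul_zero, add_zero] at h1
    exact (mul_eq_zero.1 h1).resolve_left hA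

theorem st_unique (f : PG (m+1) F → ℂ) (hf : f ∈ StM m F)
    (hU : ∀ u ∈ UT (m+1) F, ∀ y, f (mkP (m+1) F u * y) = f y) (h1 : f 1 = 0) : f = 0 := by
  have hpm : ∀ π : Equiv.Perm (Fin (m+1)), f (mkP (m+1) F (pm (m+1) F π)) = 0 := by
    intro π
    have hπ : π ∈ Submonoid.closure (Set.range fun i : Fin m => Equiv.swap i.castSucc i.succ) := by
      rw [Equiv.Perm.mclosure_swap_castSucc_succ]; trivial
    induction hπ using Submonoid.closure_induction_right with
    | one => rw [map_one, map_one, h1]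
    | mul_right x hx y hy ih =>
      obtain ⟨i, rfl⟩ := hy
      rcases lt_trichotomy (x i.castSucc) (x i.succ) with h | h | h
      · exact (st_step f hf hU i x h).1 ih
      · exact absurd (x.injective h) (ne_of_lt (cs_lt i))
      · have := st_step f hf hU i (x * rr i) (by simpa using h)
        rw [mul_assoc, Equiv.swap_mul_self, mul_one] at this
        exact this.2 ih
  funext y
  obtain ⟨g, rfl⟩ := ProjGenLinGroup.mk_surjective y
  obtain ⟨u, hu, u', hu', π, t, rfl⟩ := bruhat g
  rw [mono_eq_pm, mul_assoc, mul_assoc]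
  change f (mkP (m+1) F (u * (pm (m+1) F π * (mono 1 t * u')))) = 0
  rw [map_mul, hU u hu, map_mul, (mem_StM.1 hf).1 _ _ ((BT _ F).mul_mem (diag_mem t) (UT_le_BT hu')), hpm]

end st
end PSLeps
end

section
namespace PSLeps
open Matrix

section st
variable {n m : ℕ} {F : Type} [Field F] [Fintype F]

abbrev toP (n : ℕ) (F : Type) [Field F] : PS n F →* PG n F := ProjectiveSpecialLinearGroup.toPGL

noncomputable def rhoS (m : ℕ) (F : Type) [Field F] [Fintype F] :
    Representation ℂ (PS (m+1) F) (PG (m+1) F → ℂ) where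
  toFun x := LinearMap.funLeft ℂ ℂ (fun y => (toP (m+1) F x)⁻¹ * y)
  map_one' := by
    refine LinearMap.ext fun f => ?_
    funext y
    rw [LinearMap.funLeft_apply, map_one, inv_one, one_mul]; rfl
  map_mul' a b := by
    refine LinearMap.ext fun f => ?_
    funext y
    rw [Module.End.mul_apply, LinearMap.funLeft_apply, LinearMap.funLeft_apply, LinearMap.funLeft_apply,
      map_mul, _root_.mul_inv_rev, mul_assoc]

theorem rhoS_apply (x : PS (m+1) F) (f : PG (m+1) F → ℂ) (y) :
    rhoS m F x f y = f ((toP (m+1) F x)⁻¹ * y) := rfl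

theorem StM_inv (x : PS (m+1) F) (f : PG (m+1) F → ℂ) (hf : f ∈ StM m F) : rhoS m F x f ∈ StM m F := by
  rw [mem_StM] at hf ⊢
  constructor
  · intro y b hb
    rw [rhoS_apply, rhoS_apply, ← mul_assoc, hf.1 _ b hb]
  · intro i y
    simp only [rhoS_apply, ← mul_assoc]
    exact hf.2 i _

theorem exists_phi (X : Submodule ℂ (PG (m+1) F → ℂ)) (hX : X ≤ StM m F) (h0 : X ≠ ⊥)
    (hinv : ∀ g, ∀ x ∈ X, rhoS m F g x ∈ X) :
    ∃ φ ∈ X, (∀ u ∈ UT (m+1) F, ∀ y, φ (mkP (m+1) F u * y) = φ y) ∧ φ 1 = 1 := by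
  obtain ⟨f, hfX, hf0⟩ := Submodule.exists_mem_ne_zero_of_ne_bot h0
  obtain ⟨y0, hy0⟩ : ∃ y, f y ≠ 0 := by
    by_contra hc; push Not at hc; exact hf0 (funext hc)
  obtain ⟨g, rfl⟩ := ProjGenLinGroup.mk_surjective y0
  obtain ⟨x, b, hb, hxb⟩ := exists_SL g
  change mkP (m+1) F g = _ at hxb
  change f (mkP (m+1) F g) ≠ 0 at hy0
  rw [hxb, (mem_StM.1 (hX hfX)).1 _ b hb] at hy0
  set f1 := rhoS m F x⁻¹ f with hf1
  have hf1X : f1 ∈ X := hinv _ _ hfX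
  have hf11 : f1 1 ≠ 0 := by
    rw [hf1, rhoS_apply, map_inv, inv_inv, mul_one]; exact hy0
  have hξ : ∀ u : UT (m+1) F, ∃ x : PS (m+1) F, toP (m+1) F x = mkP (m+1) F u := fun u => UT_SL u.2
  choose ξ hξ using hξ
  set f2 := ∑ u, rhoS m F (ξ u) f1 with hf2
  have hf2X : f2 ∈ X := X.sum_mem fun u _ => hinv _ _ hf1X
  have hf2a : ∀ y, f2 y = ∑ u : UT (m+1) F, f1 (mkP (m+1) F (u⁻¹ : UT (m+1) F) * y) := by
    intro y
    rw [hf2, Finset.sum_apply]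
    refine Finset.sum_congr rfl fun u _ => ?_
    rw [rhoS_apply, hξ, ← map_inv]; rfl
  have hf21 : f2 1 ≠ 0 := by
    have : ∀ u : UT (m+1) F, f1 (mkP (m+1) F (u⁻¹ : UT (m+1) F) * 1) = f1 1 := by
      intro u
      rw [mul_one, ← one_mul (mkP (m+1) F _), (mem_StM.1 (hX hf1X)).1 _ _ (UT_le_BT (u⁻¹).2)]
    rw [hf2a, Finset.sum_congr rfl fun u _ => this u, Finset.sum_const, nsmul_eq_mul]
    refine mul_ne_zero ?_ hf11
    rw [Finset.card_univ, Nat.cast_ne_zero]; exact Fintype.card_ne_zero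
  have hf2U : ∀ u ∈ UT (m+1) F, ∀ y, f2 (mkP (m+1) F u * y) = f2 y := by
    intro v hv y
    rw [hf2a, hf2a, ← Equiv.sum_comp (Equiv.mulLeft (⟨v, hv⟩ : UT (m+1) F))]
    refine Finset.sum_congr rfl fun u _ => ?_
    rw [← mul_assoc, ← map_mul]
    congr 3
    rw [Equiv.coe_mulLeft, _root_.mul_inv_rev]
    show (u⁻¹).1 * v⁻¹ * v = _
    group
  refine ⟨(f2 1)⁻¹ • f2, X.smul_mem _ hf2X, ?_, ?_⟩
  · intro u hu y; rw [Pi.smul_apply, Pi.smul_apply, hf2U u hu]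
  · rw [Pi.smul_apply, smul_eq_mul, inv_mul_cancel₀ hf21]

theorem StM_star (f : PG (m+1) F → ℂ) (hf : f ∈ StM m F) : star f ∈ StM m F := by
  rw [mem_StM] at hf ⊢
  constructor
  · intro y b hb
    rw [Pi.star_apply, Pi.star_apply, hf.1 _ b hb]
  · intro i y
    simp only [Pi.star_apply]
    rw [← star_sum, hf.2, star_zero]

theorem phi_unique {φ φ' : PG (m+1) F → ℂ} (h : φ ∈ StM m F) (h' : φ' ∈ StM m F)
    (hU : ∀ u ∈ UT (m+1) F, ∀ y, φ (mkP (m+1) F u * y) = φ y)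
    (hU' : ∀ u ∈ UT (m+1) F, ∀ y, φ' (mkP (m+1) F u * y) = φ' y) (e : φ 1 = φ' 1) : φ = φ' := by
  refine sub_eq_zero.1 (st_unique _ ((StM m F).sub_mem h h') ?_ ?_)
  · intro u hu y; rw [Pi.sub_apply, Pi.sub_apply, hU u hu, hU' u hu]
  · rw [Pi.sub_apply, e, sub_self]

noncomputable def orthK (X : Submodule ℂ (PG (m+1) F → ℂ)) : Submodule ℂ (PG (m+1) F → ℂ) where
  carrier := {f | f ∈ StM m F ∧ ∀ x ∈ X, ∑ y, f y * x y = 0}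
  zero_mem' := ⟨(StM m F).zero_mem, fun x _ => by simp⟩
  add_mem' := by
    rintro f g ⟨hf1, hf2⟩ ⟨hg1, hg2⟩
    refine ⟨(StM m F).add_mem hf1 hg1, fun x hx => ?_⟩
    simp only [Pi.add_apply, add_mul]
    rw [Finset.sum_add_distrib, hf2 x hx, hg2 x hx, add_zero]
  smul_mem' := by
    rintro c f ⟨hf1, hf2⟩
    refine ⟨(StM m F).smul_mem c hf1, fun x hx => ?_⟩
    simp only [Pi.smul_apply, smul_mul_assoc]
    rw [← Finset.smul_sum, hf2 x hx, smul_zero]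

theorem orthK_bot (X : Submodule ℂ (PG (m+1) F → ℂ)) (hX : X ≤ StM m F) (h0 : X ≠ ⊥)
    (hinv : ∀ g, ∀ x ∈ X, rhoS m F g x ∈ X) : orthK X = ⊥ := by
  by_contra hc
  obtain ⟨φ, hφ, hφU, hφ1⟩ := exists_phi X hX h0 hinv
  obtain ⟨φ', hφ', hφU', hφ1'⟩ := exists_phi (orthK X) (fun f hf => hf.1) hc (by
    rintro g f ⟨hf1, hf2⟩
    refine ⟨StM_inv g f hf1, fun x hx => ?_⟩
    rw [← hf2 _ (hinv g⁻¹ x hx), ← Equiv.sum_comp (Equiv.mulLeft (toP (m+1) F g))]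
    refine Finset.sum_congr rfl fun y _ => ?_
    rw [Equiv.coe_mulLeft, rhoS_apply, rhoS_apply, map_inv, inv_inv, inv_mul_cancel_left])
  have e1 : φ' = φ := phi_unique hφ'.1 (hX hφ) hφU' hφU (by rw [hφ1, hφ1'])
  have e2 : star φ = φ := phi_unique (StM_star _ (hX hφ)) (hX hφ)
    (fun u hu y => by rw [Pi.star_apply, Pi.star_apply, hφU u hu]) hφU
    (by rw [Pi.star_apply, hφ1, star_one])
  have h2 := hφ'.2 φ hφ
  rw [e1] at h2
  have h3 : ∀ y, φ y * φ y = ((‖φ y‖^2 : ℝ) : ℂ) := by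
    intro y
    have : star (φ y) = φ y := congrFun e2 y
    nth_rewrite 1 [← this]
    rw [mul_comm]
    push_cast
    exact Complex.mul_conj' _
  rw [Finset.sum_congr rfl fun y _ => h3 y, ← Complex.ofReal_sum, Complex.ofReal_eq_zero,
    Finset.sum_eq_zero_iff_of_nonneg (fun y _ => by positivity)] at h2
  have := h2 1 (Finset.mem_univ _)
  rw [hφ1] at this
  simp at this

theorem finrank_X (X : Submodule ℂ (PG (m+1) F → ℂ)) (hX : X ≤ StM m F) (h0 : X ≠ ⊥)
    (hinv : ∀ g, ∀ x ∈ X, rhoS m F g x ∈ X) :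
    Module.finrank ℂ (StM m F) ≤ Module.finrank ℂ X := by
  let L : (StM m F) →ₗ[ℂ] (Module.Dual ℂ X) := LinearMap.mk₂ ℂ (fun f x => ∑ y, f.1 y * x.1 y)
    (fun f g x => by
      rw [← Finset.sum_add_distrib]; refine Finset.sum_congr rfl fun y _ => ?_
      show (f.1 y + g.1 y) * _ = _; ring)
    (fun c f x => by
      rw [Finset.smul_sum]; refine Finset.sum_congr rfl fun y _ => ?_
      show (c • f.1 y) * _ = _; rw [smul_mul_assoc])
    (fun f g x => by
      rw [← Finset.sum_add_distrib]; refine Finset.sum_congr rfl fun y _ => ?_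
      show _ * (g.1 y + x.1 y) = _; ring)
    (fun c f x => by
      rw [Finset.smul_sum]; refine Finset.sum_congr rfl fun y _ => ?_
      show _ * (c • x.1 y) = _; rw [mul_smul_comm])
  have hL : Function.Injective L := by
    rw [injective_iff_map_eq_zero]
    intro f hf
    have : f.1 ∈ orthK X := ⟨f.2, fun x hx => by
      have := congrArg (fun l : Module.Dual ℂ X => l ⟨x, hx⟩) hf
      exact this⟩
    rw [orthK_bot X hX h0 hinv, Submodule.mem_bot] at this
    exact Subtype.ext this
  calc _ ≤ _ := LinearMap.finrank_le_finrank_of_injective hL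
    _ = _ := Subspace.dual_finrank_eq

theorem card_le_StM : Fintype.card (UT (m+1) F) ≤ Module.finrank ℂ (StM m F) := by
  have hξ : ∀ u : UT (m+1) F, ∃ x : PS (m+1) F, toP (m+1) F x = mkP (m+1) F u := fun u => UT_SL u.2
  choose ξ hξ using hξ
  let v : UT (m+1) F → StM m F := fun u => ⟨rhoS m F (ξ u) (sT m F), StM_inv _ _ sT_mem⟩
  have hli : LinearIndependent ℂ v := by
    rw [Fintype.linearIndependent_iff]
    intro c hc w
    have h1 : (∑ u, c u • v u).1 (mkP (m+1) F (w.1 * pm (m+1) F Fin.revPerm)) = 0 := by rw [hc]; rfl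
    rw [AddSubmonoidClass.coe_finsetSum, Finset.sum_apply, Finset.sum_eq_single w] at h1
    · change c w * rhoS m F (ξ w) (sT m F) (mkP (m+1) F (w.1 * pm (m+1) F Fin.revPerm)) = 0 at h1
      rw [rhoS_apply, hξ, map_mul, inv_mul_cancel_left, ← one_mul (pm (m+1) F Fin.revPerm),
        sT_big (UT _ F).one_mem, if_pos rfl] at h1
      refine (mul_eq_zero.1 h1).resolve_right ?_
      exact Int.cast_ne_zero.2 (Units.ne_zero _)
    · intro u _ hu
      show c u * rhoS m F (ξ u) (sT m F) (mkP (m+1) F (w.1 * pm (m+1) F Fin.revPerm)) = 0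
      rw [rhoS_apply, hξ, ← map_inv, ← map_mul, ← mul_assoc,
        sT_big ((UT _ F).mul_mem ((UT _ F).inv_mem u.2) w.2), if_neg, mul_zero]
      intro h
      apply hu
      exact Subtype.ext (inv_mul_eq_one.1 h)
    · simp
  exact hli.fintype_card_le_finrank

noncomputable instance : Fintype (PS (m+1) F) := Fintype.ofFinite _

theorem Q_le (W : WD (PS (m+1) F)) : ∃ j, Fintype.card F ^ ((m+1)*m/2) ≤ W.d j := by
  have h0 : sT m F ≠ 0 := by
    intro h
    have h1 := sT_big (F := F) (m := m) (UT _ F).one_mem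
    rw [h, if_pos rfl] at h1
    exact Units.ne_zero (Equiv.Perm.sign (Fin.revPerm (n := m+1))) (Int.cast_eq_zero.1 h1.symm)
  refine W.exists_big (rhoS m F) _ (sT m F) h0 (StM m F) sT_mem (fun g x hx => StM_inv g x hx) ?_
  intro X hX hX0 hinv
  refine le_trans ?_ (finrank_X X hX hX0 hinv)
  refine le_trans (le_of_eq ?_) card_le_StM
  rw [card_UT]; simp

end st
end PSLeps
end

section
namespace PSLeps
open Matrix

section n2
variable {F : Type} [Field F] [Fintype F] (Ψ : AddChar F ℂ) (W : WD (PG 2 F)) (i : Fin W.k)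

theorem UT2 (u : GL (Fin 2) F) (hu : u ∈ UT 2 F) : u = Yg 1 ![u.val 0 1, 0] := by
  apply Units.ext
  rw [Yg_val]
  have h1 := hu.1
  have h2 := hu.2 1 0 (by decide)
  ext a b
  rw [Matrix.add_apply, NM_apply]
  fin_cases a <;> fin_cases b
  · simpa using h1 0
  · simp
  · simpa using h2
  · simpa using h1 1

theorem fK_e0 : eGG 1 Ψ * fK Ψ (1 : Fin 2) (Pi.single 0 1) = fK Ψ (1 : Fin 2) (Pi.single 0 1) := by
  refine idem_absorb _ _ _ fun u => ?_
  have h := of_mul_idem (yP (F := F) (1 : Fin 2)) (psiL Ψ (Pi.single 0 1)) (Multiplicative.ofAdd ![u.1.val 0 1, 0])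
  rw [psiL_apply, single_one_dotProduct] at h
  have e : yP (F := F) (1 : Fin 2) (Multiplicative.ofAdd ![u.1.val 0 1, 0]) = iotaP 2 F u := by
    show mkP 2 F (Yg 1 ![u.1.val 0 1, 0]) = mkP 2 F u.1
    rw [← UT2 u.1 u.2]
  rw [e] at h
  unfold fK
  rw [h, psiU_apply]
  congr 2
  conv_rhs => rw [UT2 u.1 u.2, Yg_val]
  exact (sigma_Y (p := (0 : Fin 2)) (k := 1) rfl _).symm

theorem fK_l1 (hΨ : Ψ ≠ 1) (l : Fin 2 → F) (hl : l 1 ≠ 0) : fK Ψ (1 : Fin 2) l = 0 := by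
  obtain ⟨c0, hc0⟩ : ∃ c, Ψ c ≠ 1 := by
    by_contra hc
    push Not at hc
    exact hΨ (AddChar.ext _ _ (by simpa using hc))
  have h := of_mul_idem (yP (F := F) (1 : Fin 2)) (psiL Ψ l) (Multiplicative.ofAdd ![0, c0 / l 1])
  have e : yP (F := F) (1 : Fin 2) (Multiplicative.ofAdd ![0, c0 / l 1]) = 1 := by
    show mkP 2 F (Yg 1 ![0, c0 / l 1]) = 1
    rw [← map_one (mkP 2 F)]
    congr 1
    apply Units.ext
    rw [Yg_val]
    ext a b
    rw [Matrix.add_apply, NM_apply]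
    fin_cases a <;> fin_cases b <;> simp
  rw [e, map_one, one_mul, psiL_apply] at h
  have e2 : l ⬝ᵥ ![0, c0 / l 1] = c0 := by
    simp [dotProduct, Fin.sum_univ_two]; field_simp
  change idem (yP 1) (psiL Ψ l) = Ψ (l ⬝ᵥ ![0, c0 / l 1]) • _ at h
  rw [e2] at h
  have h2 : (Ψ c0 - 1) • idem (yP (1 : Fin 2)) (psiL Ψ l) = 0 := by
    rw [sub_smul, one_smul, ← h, sub_self]
  exact (smul_eq_zero.1 h2).resolve_left (sub_ne_zero.2 hc0)

theorem fK_zero (hΨ : Ψ ≠ 1) (hi : W.rk i (eGG 1 Ψ) = 0) (l : Fin 2 → F) (hl : l ≠ 0) :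
    W.Φ (fK Ψ (1 : Fin 2) l) i = 0 := by
  by_cases h1 : l 1 = 0
  · have h0 : l 0 ≠ 0 := by
      intro h0; apply hl; funext a; fin_cases a; exacts [h0, h1]
    have hk := Rg_kT (p := (0 : Fin 2)) (k := 1) (by decide) l h0 (by
      intro r hr; fin_cases r
      · exact absurd hr (by decide)
      · exact h1)
    have h2 := tr_fE Ψ W i hk 1 (by rw [one_mul, mul_one]) (Pi.single 0 1)
    have hff : ∀ l, fK Ψ (1:Fin 2) l * fK Ψ 1 l = fK Ψ 1 l := fun l => idem_idem _ _
    rw [single_Rg, mul_one, mul_one, W.tr_eq_rk i _ (hff _), W.tr_eq_rk i _ (hff _)] at h2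
    rw [← W.rk_eq_zero]
    have h3 : W.rk i (fK Ψ (1 : Fin 2) l) = W.rk i (fK Ψ (1 : Fin 2) (Pi.single 0 1)) := by exact_mod_cast h2
    rw [h3, W.rk_eq_zero, ← fK_e0, map_mul, Pi.mul_apply, (W.rk_eq_zero _ _).1 hi, zero_mul]
  · rw [fK_l1 Ψ hΨ l h1, map_zero]; rfl

theorem fK_triv (hΨ : Ψ ≠ 1) (hi : W.rk i (eGG 1 Ψ) = 0) (a : Fin 2 → F) :
    W.Φ (MonoidAlgebra.of ℂ _ (mkP 2 F (Yg 1 a))) i = 1 := by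
  have h0 : W.Φ (fK Ψ (1 : Fin 2) 0) i = 1 := by
    have h1 : W.Φ (∑ l, fK Ψ (1 : Fin 2) l) i = 1 := by rw [sum_fK Ψ hΨ, map_one]; rfl
    rw [map_sum, Finset.sum_apply, Finset.sum_eq_single 0] at h1
    · exact h1
    · intro l _ hl; exact fK_zero Ψ W i hΨ hi l hl
    · simp
  have h := of_mul_idem (yP (F := F) (1 : Fin 2)) (psiL Ψ 0) (Multiplicative.ofAdd a)
  rw [psiL_apply, zero_dotProduct, AddChar.map_zero_eq_one, one_smul] at h
  have h2 : W.Φ (MonoidAlgebra.of ℂ _ (mkP 2 F (Yg 1 a)) * fK Ψ (1 : Fin 2) 0) i = W.Φ (fK Ψ (1 : Fin 2) 0) i :=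
    congrArg (fun z => W.Φ z i) h
  rwa [map_mul, Pi.mul_apply, h0, mul_one] at h2

def kerI : Subgroup (PG 2 F) where
  carrier := {x | W.Φ (MonoidAlgebra.of ℂ _ x) i = 1}
  one_mem' := by
    show W.Φ (MonoidAlgebra.of ℂ _ 1) i = 1
    rw [map_one, map_one]; rfl
  mul_mem' := by
    intro a b ha hb
    show W.Φ (MonoidAlgebra.of ℂ _ (a * b)) i = 1
    rw [map_mul, map_mul, Pi.mul_apply, ha, hb, mul_one]
  inv_mem' := by
    intro a ha
    have h : W.Φ (MonoidAlgebra.of ℂ _ (a * a⁻¹)) i = 1 := by rw [mul_inv_cancel, map_one, map_one]; rfl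
    rw [map_mul, map_mul, Pi.mul_apply, ha, one_mul] at h
    exact h

theorem mem_kerI {x : PG 2 F} : x ∈ kerI W i ↔ W.Φ (MonoidAlgebra.of ℂ _ x) i = 1 := Iff.rfl

theorem kerI_conj {x : PG 2 F} (hx : x ∈ kerI W i) (y : PG 2 F) : y * x * y⁻¹ ∈ kerI W i := by
  rw [mem_kerI] at hx ⊢
  rw [map_mul, map_mul, map_mul, map_mul, Pi.mul_apply, Pi.mul_apply, hx, mul_one, ← Pi.mul_apply, ← map_mul,
    ← map_mul, mul_inv_cancel, map_one, map_one]; rfl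

theorem x01_mem (hΨ : Ψ ≠ 1) (hi : W.rk i (eGG 1 Ψ) = 0) (c : F) :
    mkP 2 F (xg 0 1 (by decide) c) ∈ kerI W i := by
  rw [UT2 (xg 0 1 (by decide) c) (xg_mem_UT (by decide) c)]
  exact fK_triv Ψ W i hΨ hi _

theorem x10_mem (hΨ : Ψ ≠ 1) (hi : W.rk i (eGG 1 Ψ) = 0) (c : F) :
    mkP 2 F (xg 1 0 (by decide) c) ∈ kerI W i := by
  have h := kerI_conj W i (x01_mem Ψ W i hΨ hi c) (mkP 2 F (mono (Equiv.swap 0 1) 1))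
  rw [← map_mul, mono_xg, map_mul, mul_inv_cancel_right] at h
  have e : xg (F := F) ((Equiv.swap (0 : Fin 2) 1) 0) ((Equiv.swap (0 : Fin 2) 1) 1) (by decide)
    (c * ((1 : Fin 2 → Fˣ) 0 : Fˣ) / ((1 : Fin 2 → Fˣ) 1 : Fˣ)) = xg 1 0 (by decide) c := by
    apply Units.ext
    rw [xg_val, xg_val, Equiv.swap_apply_left, Equiv.swap_apply_right]
    simp
  rw [← e]; exact h

theorem sl2_gen (g : GL (Fin 2) F) (hd : g.val.det = 1) (hc : g.val 1 0 ≠ 0) :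
    g = xg 0 1 (by decide) ((g.val 0 0 - 1) / g.val 1 0) * (xg 1 0 (by decide) (g.val 1 0) *
      xg 0 1 (by decide) ((g.val 1 1 - 1) / g.val 1 0)) := by
  rw [Matrix.det_fin_two] at hd
  apply Units.ext
  rw [Units.val_mul, Units.val_mul, xg_val, xg_val, xg_val]
  ext a b
  rw [Matrix.mul_apply, Fin.sum_univ_two, Matrix.mul_apply, Matrix.mul_apply, Fin.sum_univ_two, Fin.sum_univ_two]
  simp only [xM_apply, Matrix.one_apply]
  fin_cases a <;> fin_cases b
  · simp
    field_simp
    ring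
  · simp
    field_simp
    linear_combination -hd
  · simp
  · simp
    field_simp
    ring

theorem sl2_mem (hΨ : Ψ ≠ 1) (hi : W.rk i (eGG 1 Ψ) = 0) (g : GL (Fin 2) F) (hd : g.val.det = 1) :
    mkP 2 F g ∈ kerI W i := by
  have key : ∀ g : GL (Fin 2) F, g.val.det = 1 → g.val 1 0 ≠ 0 → mkP 2 F g ∈ kerI W i := by
    intro g hd hc
    rw [sl2_gen g hd hc, map_mul, map_mul]
    exact mul_mem (x01_mem Ψ W i hΨ hi _) (mul_mem (x10_mem Ψ W i hΨ hi _) (x01_mem Ψ W i hΨ hi _))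
  by_cases hc : g.val 1 0 = 0
  · have h1 : mkP 2 F (xg 1 0 (by decide) 1 * g) ∈ kerI W i := by
      apply key
      · rw [Units.val_mul, Matrix.det_mul, hd, xg_val, Matrix.det_fin_two]
        simp [xM_apply]
      · rw [Units.val_mul, xg_val, xM_mul]
        rw [Matrix.det_fin_two, hc, mul_zero, sub_zero] at hd
        simp only [hc, if_true, one_mul, zero_add]
        exact left_ne_zero_of_mul_eq_one hd
    rw [map_mul] at h1
    exact (Subgroup.mul_mem_cancel_left _ (x10_mem Ψ W i hΨ hi 1)).1 h1
  · exact key g hd hc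

theorem psl_mem (hΨ : Ψ ≠ 1) (hi : W.rk i (eGG 1 Ψ) = 0) (x : PS 2 F) : toP 2 F x ∈ kerI W i := by
  induction x using QuotientGroup.induction_on with
  | H s => exact sl2_mem Ψ W i hΨ hi (SpecialLinearGroup.toGL s) s.2

/-- total square mass of the degenerate part in rank one -/
theorem degenerate_le (hΨ : Ψ ≠ 1) :
    Fintype.card (PS 2 F) * ∑ i ∈ Finset.univ.filter (fun i => W.rk i (eGG 1 Ψ) = 0), W.d i ^ 2 ≤
      Fintype.card (PG 2 F) := by
  set e := idem (toP 2 F) (1 : PS 2 F →* ℂ) with he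
  have h1 := W.sum_d_rk e (idem_idem _ _)
  rw [idem_coeff_one _ _ ProjectiveSpecialLinearGroup.toPGL_injective] at h1
  have h2 : (Fintype.card (PS 2 F) : ℂ) ≠ 0 := by exact_mod_cast Fintype.card_ne_zero
  rw [← div_eq_mul_inv, eq_div_iff h2, mul_comm] at h1
  have h3 : Fintype.card (PS 2 F) * ∑ i, W.d i * W.rk i e = Fintype.card (PG 2 F) := by exact_mod_cast h1
  rw [← h3]
  refine Nat.mul_le_mul_left _ (le_trans ?_ (Finset.sum_le_sum_of_subset (Finset.subset_univ
    (Finset.univ.filter (fun i => W.rk i (eGG 1 Ψ) = 0)))))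
  refine Finset.sum_le_sum fun i hi => ?_
  rw [Finset.mem_filter] at hi
  have h4 : W.Φ e i = W.Φ 1 i := by
    rw [he, idem, map_smul, map_sum, Pi.smul_apply, Finset.sum_apply]
    have : ∀ u : PS 2 F, W.Φ ((1 : PS 2 F →* ℂ) u⁻¹ • MonoidAlgebra.of ℂ _ (toP 2 F u)) i = W.Φ 1 i := by
      intro u
      rw [MonoidHom.one_apply, one_smul, map_one]
      exact psl_mem Ψ W i hΨ hi.2 u
    rw [Finset.sum_congr rfl fun u _ => this u, Finset.sum_const, Finset.card_univ,
      ← Nat.cast_smul_eq_nsmul ℂ, smul_smul, inv_mul_cancel₀ h2, one_smul]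
  have h5 : W.rk i e = W.d i := by
    have h6 := W.tr_eq_rk i 1 (one_mul _)
    rw [W.tr_one] at h6
    have h7 : W.d i = W.rk i 1 := by exact_mod_cast h6
    rw [h7]
    unfold WD.rk
    rw [h4]
  rw [h5, sq]

end n2
end PSLeps
end

section
namespace PSLeps
open Matrix

/-- numerical data extracted from the representation theory -/
structure Dat (q m b S : ℕ) where
  k : ℕ
  d : Fin k → ℕ
  I : Finset (Fin k)
  I1 : Finset (Fin k)
  mm : ℕ
  g : ℕ
  G : ℕ
  P : ℕ
  hS : S + mm * b ^ 2 = G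
  hPG : P = g * G
  hPA : P = q ^ ((m+1)*m/2) * Aq q m
  hg1 : g ∣ m + 1
  hg2 : g ∣ q - 1
  hQ : q ^ ((m+1)*m/2) ≤ b
  hsum : ∑ i, d i ^ 2 = P
  hI : I.card = q ^ m
  hIA : ∑ i ∈ I, d i = Aq q m
  hId : ∀ i ∈ I, Pq q m ≤ d i
  hne : I1.Nonempty
  hI1 : ∀ i ∈ I1, b ≤ d i
  hT : ∑ i ∈ Finset.univ \ I1, d i ^ 2 ≤ g * S
  hR : ∑ i ∈ I1, d i ≤ g * (mm * b)
  hone : ∃ i, d i = 1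
  hdeg : m = 1 → ∑ i ∈ Finset.univ \ I, d i ^ 2 ≤ g

theorem exists_one {G : Type} [Group G] [Fintype G] (W : WD G) : ∃ i, W.d i = 1 := by
  have h1 := W.sum_d_rk (idem (MonoidHom.id G) (1 : G →* ℂ)) (idem_idem _ _)
  rw [idem_coeff_one _ _ (fun _ _ h => h)] at h1
  have h2 : (Fintype.card G : ℂ) ≠ 0 := by exact_mod_cast Fintype.card_ne_zero
  rw [mul_inv_cancel₀ h2] at h1
  have h3 : ∑ i, W.d i * W.rk i (idem (MonoidHom.id G) (1 : G →* ℂ)) = 1 := by exact_mod_cast h1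
  by_contra hne
  push Not at hne
  have h4 : ∀ i, W.d i * W.rk i (idem (MonoidHom.id G) (1 : G →* ℂ)) = 0 := by
    intro i
    have h5 := Finset.single_le_sum (f := fun i => W.d i * W.rk i (idem (MonoidHom.id G) (1 : G →* ℂ)))
      (fun _ _ => Nat.zero_le _) (Finset.mem_univ i)
    simp only [h3] at h5
    have h6 : 2 ≤ W.d i := by have := W.hd i; have := hne i; omega
    rcases Nat.eq_zero_or_pos (W.rk i (idem (MonoidHom.id G) (1 : G →* ℂ))) with h | h
    · rw [h, mul_zero]
    · nlinarith
  rw [Finset.sum_congr rfl fun i _ => h4 i] at h3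
  simp at h3

theorem exists_dat (F : Type) [Field F] [Fintype F] (m : ℕ) :
    ∃ S, Nonempty (Dat (Fintype.card F) m (maxIrrDeg (PS (m+1) F)) S) ∧
      epsG (PS (m+1) F) = (S : ℝ) / (maxIrrDeg (PS (m+1) F) : ℝ) ^ 2 := by
  obtain ⟨V⟩ := exists_WD (PS (m+1) F)
  obtain ⟨W⟩ := exists_WD (PG (m+1) F)
  obtain ⟨Ψ, hΨ⟩ : ∃ Ψ : AddChar F ℂ, Ψ ≠ 1 := by
    obtain ⟨Ψ, h⟩ := (AddChar.exists_apply_ne_zero (a := (1 : F))).2 one_ne_zero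
    exact ⟨Ψ, fun e => h (by rw [e]; rfl)⟩
  obtain ⟨I1, h1, h2, h3, h4⟩ := mass V W (toP (m+1) F) ProjectiveSpecialLinearGroup.toPGL_injective
  obtain ⟨g, hg1, hg2, hg3⟩ := card_PS (m := m) (F := F)
  obtain ⟨r1, r2, r3⟩ := GG_main (m := m) Ψ hΨ W
  rw [Nat.card_eq_fintype_card, Nat.card_eq_fintype_card] at hg3
  have hGpos : 0 < Fintype.card (PS (m+1) F) := Fintype.card_pos
  have hrk : ∀ i, W.rk i (eGG m Ψ) = if W.rk i (eGG m Ψ) ≠ 0 then 1 else 0 := by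
    intro i
    by_cases h : W.rk i (eGG m Ψ) = 0
    · rw [if_neg (not_not.2 h), h]
    · rw [if_pos h]; have := r1 i; omega
  refine ⟨_, ⟨Dat.mk W.k W.d (Finset.univ.filter (fun i => W.rk i (eGG m Ψ) ≠ 0)) I1
    (Finset.univ.filter (fun j => V.d j = maxIrrDeg (PS (m+1) F))).card g
    (Fintype.card (PS (m+1) F)) (Fintype.card (PG (m+1) F))
    V.sum_split hg3 card_PG hg1 hg2 ?_ W.sum_sq ?_ ?_ ?_ h1 h2 ?_ ?_ (exists_one W) ?_⟩, V.epsG_eq⟩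
  · obtain ⟨j, hj⟩ := Q_le V
    exact hj.trans (V.d_le j)
  · rw [← r2, Finset.card_filter]
    refine Finset.sum_congr rfl fun i _ => ?_
    by_cases h : W.rk i (eGG m Ψ) = 0
    · rw [if_neg (not_not.2 h), h]; rfl
    · rw [if_pos h]
      have := hrk i
      rw [if_pos h] at this
      rw [this]; rfl
  · rw [card_PG, card_UT] at r3
    have hq : 0 < Fintype.card F := Fintype.card_pos
    rw [Nat.add_sub_cancel] at r3
    have := Nat.eq_of_mul_eq_mul_left (pow_pos hq _) r3
    rw [← this, Finset.sum_filter]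
    refine Finset.sum_congr rfl fun i _ => ?_
    by_cases h : W.rk i (eGG m Ψ) = 0
    · rw [if_neg (not_not.2 h), h, mul_zero]
    · rw [if_pos h]
      have := hrk i
      rw [if_pos h] at this
      rw [this, mul_one]
  · intro i hi
    exact Pq_le Ψ W i hΨ (Finset.mem_filter.1 hi).2
  · rw [hg3] at h3
    refine Nat.le_of_mul_le_mul_left (h3.trans (le_of_eq ?_)) hGpos
    ring
  · rw [hg3] at h4
    refine Nat.le_of_mul_le_mul_left (h4.trans (le_of_eq ?_)) hGpos
    ring
  · intro hm
    subst hm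
    have h := degenerate_le Ψ W hΨ
    rw [hg3, mul_comm g] at h
    have := Nat.le_of_mul_le_mul_left h hGpos
    refine le_trans (le_of_eq ?_) this
    congr 1
    ext i; simp

/-- consequences used for numerics -/
theorem Dat.ext' {q m b S : ℕ} (X : Dat q m b S) : ∃ R x y T Z : ℕ,
    R ≤ q ^ m ∧ R * b ≤ x ∧ (q ^ m - R) * Pq q m ≤ y ∧ x + y = Aq q m ∧
    y ^ 2 ≤ (q ^ m - R) * T ∧ x ^ 2 ≤ R * Z ∧ T + Z ≤ X.P ∧ T ≤ X.g * S ∧ R * b ^ 2 ≤ Z ∧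
    (q ^ m - R) * Pq q m ^ 2 ≤ T ∧ x ≤ X.g * (X.mm * b) ∧ R = (X.I ∩ X.I1).card := by
  have hc : (X.I \ X.I1).card = q ^ m - (X.I ∩ X.I1).card := by
    have := Finset.card_inter_add_card_sdiff X.I X.I1
    rw [X.hI] at this; omega
  refine ⟨(X.I ∩ X.I1).card, ∑ i ∈ X.I ∩ X.I1, X.d i, ∑ i ∈ X.I \ X.I1, X.d i,
    ∑ i ∈ X.I \ X.I1, X.d i ^ 2, ∑ i ∈ X.I ∩ X.I1, X.d i ^ 2, ?_, ?_, ?_, ?_, ?_, ?_, ?_, ?_, ?_, ?_, ?_, rfl⟩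
  · rw [← X.hI]; exact Finset.card_le_card Finset.inter_subset_left
  · rw [← smul_eq_mul]
    exact Finset.card_nsmul_le_sum _ _ _ fun i hi => X.hI1 i (Finset.mem_inter.1 hi).2
  · rw [← hc, ← smul_eq_mul]
    exact Finset.card_nsmul_le_sum _ _ _ fun i hi => X.hId i (Finset.mem_sdiff.1 hi).1
  · rw [← X.hIA]; exact Finset.sum_inter_add_sum_sdiff _ _ _
  · rw [← hc]; exact sq_sum_le_card_mul_sum_sq
  · exact sq_sum_le_card_mul_sum_sq
  · rw [add_comm, Finset.sum_inter_add_sum_sdiff, ← X.hsum]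
    exact Finset.sum_le_sum_of_subset (Finset.subset_univ _)
  · exact (Finset.sum_le_sum_of_subset (Finset.sdiff_subset_sdiff (Finset.subset_univ _) subset_rfl)).trans X.hT
  · rw [← smul_eq_mul]
    exact Finset.card_nsmul_le_sum _ _ _ fun i hi => Nat.pow_le_pow_left (X.hI1 i (Finset.mem_inter.1 hi).2) 2
  · rw [← hc, ← smul_eq_mul]
    exact Finset.card_nsmul_le_sum _ _ _ fun i hi => Nat.pow_le_pow_left (X.hId i (Finset.mem_sdiff.1 hi).1) 2
  · exact (Finset.sum_le_sum_of_subset Finset.inter_subset_right).trans X.hR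

theorem Dat.mm_pos {q m b S : ℕ} (hq : 0 < q) (X : Dat q m b S) : 1 ≤ X.mm := by
  obtain ⟨i, hi⟩ := X.hne
  have h1 := X.hI1 i hi
  have h2 := Finset.single_le_sum (f := X.d) (fun _ _ => Nat.zero_le _) hi
  have h3 := X.hR
  have h4 : 0 < q ^ ((m+1)*m/2) := pow_pos hq _
  have h5 := X.hQ
  by_contra h
  have : X.mm = 0 := by omega
  rw [this] at h3
  simp only [zero_mul, mul_zero] at h3
  omega

end PSLeps
end

section
namespace PSLeps
open Matrix

set_option maxHeartbeats 2000000 in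
theorem rank_one {q b S : ℕ} (hq : 4 ≤ q) (X : Dat q 1 b S) : b ^ 2 < S := by
  by_contra hSb
  push Not at hSb
  have hA : (Aq q 1 : ℤ) = (q:ℤ) ^ 2 - 1 := by
    have : 1 ≤ q ^ 2 := Nat.one_le_pow _ _ (by omega)
    simp only [Aq, Finset.prod_range_one]
    push_cast [Nat.cast_sub this]; ring
  have hPq : Pq q 1 = q - 1 := by simp [Pq]
  have hQ : q ≤ b := by have := X.hQ; simpa using this
  have hP : (X.P : ℤ) = q * ((q:ℤ) ^ 2 - 1) := by
    have := X.hPA; rw [this]; push_cast; rw [hA]; simp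
  have hg2 : X.g ≤ 2 := Nat.le_of_dvd (by norm_num) X.hg1
  have hgq := X.hg2
  have hmm := X.mm_pos (by omega)
  have hdeg := X.hdeg rfl
  have hS := X.hS
  have hPG := X.hPG
  have hsub : X.I1 ⊆ X.I := by
    intro i hi
    by_contra hn
    have h1 := X.hI1 i hi
    have h2 := Finset.single_le_sum (f := fun i => X.d i ^ 2) (fun _ _ => Nat.zero_le _)
      (Finset.mem_sdiff.2 ⟨Finset.mem_univ i, hn⟩)
    nlinarith
  have hg1 : 1 ≤ ∑ i ∈ Finset.univ \ X.I, X.d i ^ 2 := by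
    obtain ⟨i, hi⟩ := X.hone
    have hn : i ∉ X.I := by
      intro h
      have := X.hId i h
      omega
    have h2 := Finset.single_le_sum (f := fun i => X.d i ^ 2) (fun _ _ => Nat.zero_le _)
      (Finset.mem_sdiff.2 ⟨Finset.mem_univ i, hn⟩)
    simp only [hi] at h2
    exact h2
  have hsplit : ∑ i ∈ Finset.univ \ X.I, X.d i ^ 2 + ∑ i ∈ X.I, X.d i ^ 2 = X.P := by
    rw [← X.hsum]; exact Finset.sum_sdiff (Finset.subset_univ _)
  set g' := ∑ i ∈ Finset.univ \ X.I, X.d i ^ 2 with hg'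
  set u : Fin X.k → ℤ := fun i => (X.d i : ℤ) - (q - 1) with hu
  have hd : ∀ i, (X.d i : ℤ) = u i + (q - 1) := fun i => by simp only [hu]; ring
  have hu0 : ∀ i ∈ X.I, 0 ≤ u i := by
    intro i hi
    have := X.hId i hi
    simp only [hu]; omega
  have hcard : (X.I.card : ℤ) = q := by rw [X.hI]; simp
  have hs1 : ∑ i ∈ X.I, u i = q - 1 := by
    have h := X.hIA
    have h' : ∑ i ∈ X.I, (X.d i : ℤ) = (q:ℤ) ^ 2 - 1 := by rw [← hA, ← h]; push_cast; rfl
    simp only [hu]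
    rw [Finset.sum_sub_distrib, h', Finset.sum_const, nsmul_eq_mul, hcard]; ring
  have hs2 : ∑ i ∈ X.I, u i * (u i - 1) = q - 1 - g' := by
    have h' : (g' : ℤ) + ∑ i ∈ X.I, (X.d i : ℤ) ^ 2 = q * ((q:ℤ) ^ 2 - 1) := by
      rw [← hP, ← hsplit]; push_cast; rfl
    have h2 : ∑ i ∈ X.I, (X.d i : ℤ) ^ 2 = ∑ i ∈ X.I, (u i * (u i - 1) + (2 * q - 1) * u i + (q - 1) ^ 2) :=
      Finset.sum_congr rfl fun i _ => by rw [hd i]; ring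
    rw [Finset.sum_add_distrib, Finset.sum_add_distrib, ← Finset.mul_sum, hs1, Finset.sum_const, nsmul_eq_mul,
      hcard] at h2
    rw [h2] at h'
    linear_combination h'
  have huu : ∀ i ∈ X.I, 0 ≤ u i * (u i - 1) := by
    intro i hi
    have := hu0 i hi
    rcases eq_or_lt_of_le this with h | h
    · rw [← h]; simp
    · exact mul_nonneg this (by omega)
  have hbq : (q:ℤ) ≤ b := by exact_mod_cast hQ
  have hT : ∀ J ⊆ X.I, Disjoint J X.I1 → (J.card : ℤ) * (q - 1) ^ 2 ≤ X.g * S := by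
    intro J hJ hdis
    have h1 : J.card * (q-1)^2 ≤ ∑ i ∈ J, X.d i ^ 2 := by
      rw [← smul_eq_mul]
      refine Finset.card_nsmul_le_sum _ _ _ fun i hi => Nat.pow_le_pow_left ?_ 2
      rw [← hPq]; exact X.hId i (hJ hi)
    have h2 : ∑ i ∈ J, X.d i ^ 2 ≤ ∑ i ∈ Finset.univ \ X.I1, X.d i ^ 2 := by
      refine Finset.sum_le_sum_of_subset fun i hi => Finset.mem_sdiff.2 ⟨Finset.mem_univ _, ?_⟩
      exact Finset.disjoint_left.1 hdis hi
    have h3 := h1.trans (h2.trans X.hT)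
    zify [show 1 ≤ q by omega] at h3
    exact h3
  have hq4 : (4:ℤ) ≤ q := by exact_mod_cast hq
  have hg'1 : (1:ℤ) ≤ g' := by exact_mod_cast hg1
  have hg'2 : (g':ℤ) ≤ X.g := by exact_mod_cast hdeg
  have hgpos : 1 ≤ X.g := by omega
  have hSbz : (S:ℤ) ≤ (b:ℤ)^2 := by exact_mod_cast hSb
  have hg12 : X.g = 1 ∨ (X.g = 2 ∧ q % 2 = 1) := by
    rcases (by omega : X.g = 1 ∨ X.g = 2) with h | h
    · exact Or.inl h
    · rw [h] at hgq; right; omega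
  have hG : (X.g:ℤ) * (S + X.mm * b ^ 2) = q * ((q:ℤ) ^ 2 - 1) := by
    rw [← hP, hPG, ← hS]; push_cast; ring
  by_cases hb : b = q
  · -- largest degree is the Steinberg degree
    set N := X.I.filter (fun i => u i = 0) with hN
    have hNT := hT N (Finset.filter_subset _ _) (by
      rw [Finset.disjoint_left]
      intro i hi hi1
      have h1 := X.hI1 i hi1
      have h2 := (Finset.mem_filter.1 hi).2
      simp only [hu] at h2; omega)
    have hp : ∑ i ∈ X.I, (u i - 1 + if u i = 0 then 1 else 0) = N.card - 1 := by
      rw [Finset.sum_add_distrib, Finset.sum_sub_distrib, hs1, Finset.sum_const, nsmul_eq_mul, hcard,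
        Finset.sum_boole]
      push_cast; ring
    have hp0 : ∀ i ∈ X.I, 0 ≤ (u i - 1 + if u i = 0 then 1 else 0) := by
      intro i hi
      have := hu0 i hi
      split_ifs <;> omega
    have hNN : (q:ℤ) - 1 - g' ≤ N.card * (N.card - 1) := by
      rw [← hs2, ← hp, Finset.mul_sum]
      refine Finset.sum_le_sum fun i hi => ?_
      have h1 := Finset.single_le_sum hp0 hi
      rw [hp] at h1
      have h2 := hu0 i hi
      by_cases h0 : u i = 0
      · rw [if_pos h0, h0]; simp
      · rw [if_neg h0] at h1 ⊢
        rw [add_zero] at h1 ⊢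
        exact mul_le_mul_of_nonneg_right (by omega) (by omega)
    subst hb
    have hN0 : (0:ℤ) ≤ N.card := Int.natCast_nonneg _
    rcases hg12 with h | ⟨h, hodd⟩
    · rw [h] at hNT hg'2
      have : (2:ℤ) ≤ N.card := by
        by_contra hc
        have : (N.card:ℤ) = 0 ∨ (N.card:ℤ) = 1 := by omega
        rcases this with h | h <;> rw [h] at hNN <;> push_cast at hNN hg'2 <;> omega
      push_cast at hNT
      nlinarith
    · rw [h] at hNT hg'2 hG
      have : (2:ℤ) ≤ N.card := by
        by_contra hc
        have : (N.card:ℤ) = 0 ∨ (N.card:ℤ) = 1 := by omega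
        rcases this with h | h <;> rw [h] at hNN <;> push_cast at hNN hg'2 <;> omega
      by_cases h5 : b = 5
      · subst h5
        have hmm2 : X.mm = 2 := by
          push_cast at hG hSbz
          omega
        rw [hmm2] at hG
        push_cast at hG hNT
        omega
      · have h7 : (7:ℤ) ≤ b := by omega
        have : (3:ℤ) ≤ N.card := by
          by_contra hc
          have : (N.card:ℤ) = 2 := by omega
          rw [this] at hNN; push_cast at hg'2; omega
        push_cast at hNT
        nlinarith
  · obtain ⟨β, hβ⟩ : ∃ β : ℤ, (b:ℤ) = q - 1 + β := ⟨b - (q-1), by ring⟩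
    have hβ2 : 2 ≤ β := by omega
    have hJ := hT (X.I \ X.I1) Finset.sdiff_subset Finset.sdiff_disjoint
    rw [Finset.cast_card_sdiff hsub, hcard] at hJ
    have hK1 : (1:ℤ) ≤ X.I1.card := by
      have := X.hne.card_pos
      omega
    have hKb : (X.I1.card : ℤ) * (β * (β - 1)) ≤ q - 1 - g' := by
      rw [← hs2]
      calc (X.I1.card : ℤ) * (β * (β - 1)) = ∑ i ∈ X.I1, β * (β - 1) := by rw [Finset.sum_const, nsmul_eq_mul]
        _ ≤ ∑ i ∈ X.I1, u i * (u i - 1) := by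
          refine Finset.sum_le_sum fun i hi => ?_
          have h1 := X.hI1 i hi
          have h2 : β ≤ u i := by simp only [hu]; omega
          nlinarith
        _ ≤ _ := Finset.sum_le_sum_of_subset_of_nonneg hsub fun i hi _ => huu i hi
    set K : ℤ := (X.I1.card : ℤ) with hK
    by_cases h2 : β = 2
    · subst h2
      have hb1 : (b:ℤ) = q + 1 := by rw [hβ]; ring
      rcases hg12 with h | ⟨h, hodd⟩
      · rw [h] at hJ
        rw [hb1] at hSbz
        push_cast at hJ
        have : 2 * K ≤ q - 2 := by linarith
        nlinarith
      · rw [h] at hJ hG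
        rw [hb1] at hSbz hG
        by_cases h5 : q = 5
        · subst h5
          push_cast at hG hJ hSbz hKb
          have : X.mm = 1 := by omega
          rw [this] at hG
          push_cast at hG
          omega
        · have h7 : (7:ℤ) ≤ q := by omega
          push_cast at hJ
          have : 2 * K ≤ q - 2 := by linarith
          nlinarith
    · have hβ3 : 3 ≤ β := by omega
      have hg2z : (X.g : ℤ) ≤ 2 := by exact_mod_cast hg2
      have hbb : 6 ≤ β * (β - 1) := by
        calc (6:ℤ) = 3 * 2 := by norm_num
          _ ≤ β * (β - 1) := mul_le_mul hβ3 (by linarith) (by norm_num) (by linarith)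
      have hbb2 : 2 * β ≤ β * (β - 1) := by
        rw [mul_comm]; exact mul_le_mul_of_nonneg_left (by linarith) (by linarith)
      have hβq : 2 * β ≤ q - 2 := by
        have : 1 * (β * (β - 1)) ≤ K * (β * (β - 1)) := mul_le_mul_of_nonneg_right hK1 (by linarith)
        linarith
      have hKq : 6 * K ≤ q - 2 := by
        have : K * 6 ≤ K * (β * (β - 1)) := mul_le_mul_of_nonneg_left hbb (by linarith)
        linarith
      have hb2 : 2 * (b:ℤ) ≤ 3 * q - 4 := by linarith
      have hgs : (X.g:ℤ) * S ≤ 2 * (b:ℤ)^2 := by nlinarith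
      have hq8 : (8:ℤ) ≤ q := by linarith
      have hb3 : 4 * (b:ℤ)^2 ≤ (3 * q - 4)^2 := by nlinarith
      have h8 : (5 * q + 2) * ((q:ℤ) - 1)^2 ≤ (6 * (q - K)) * ((q:ℤ) - 1)^2 :=
        mul_le_mul_of_nonneg_right (by linarith) (sq_nonneg _)
      have h9 : (5 * q + 2) * ((q:ℤ) - 1)^2 ≤ 3 * (3 * q - 4)^2 := by linarith
      obtain ⟨t, ht⟩ : ∃ t : ℤ, (q:ℤ) = 8 + t := ⟨q - 8, by ring⟩
      have ht0 : 0 ≤ t := by linarith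
      rw [ht] at h9
      have : 0 ≤ t ^ 3 := by positivity
      have : 0 ≤ t ^ 2 := by positivity
      linarith

end PSLeps
end

section
namespace PSLeps
open Matrix

theorem cs_lin {a t u s : ℝ} (ha : 0 ≤ a) (ht : 0 ≤ t) (hs : 0 ≤ s) (h : u ^ 2 ≤ a * t) :
    2 * s * u ≤ t + a * s ^ 2 := by
  have h0 : 0 ≤ t + a * s ^ 2 := by positivity
  refine le_of_abs_le (abs_le_of_sq_le_sq ?_ h0)
  have h1 : s ^ 2 * u ^ 2 ≤ s ^ 2 * (a * t) := mul_le_mul_of_nonneg_left h (sq_nonneg s)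
  nlinarith [sq_nonneg (t - a * s ^ 2)]

structure Core (r p ρ χ υ τ ζ β κ : ℝ) : Prop where
  r0 : 0 < r
  ρ0 : 0 ≤ ρ
  ρ1 : ρ ≤ 1
  hχ : ρ * β ≤ χ
  hυ : (1 - ρ) * (1 - r - r ^ 2) ≤ υ
  hsum : χ + υ = p
  cs1 : υ ^ 2 ≤ (1 - ρ) * τ
  cs2 : χ ^ 2 ≤ ρ * ζ
  τ0 : 0 ≤ τ
  ζ0 : 0 ≤ ζ
  hτζ : τ + ζ ≤ p
  hlow : (1 - ρ) * (1 - r - r ^ 2) ^ 2 ≤ τ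
  hτ : τ ≤ κ * β ^ 2
  hτ2 : 2 * τ ≤ p
  β1 : 1 ≤ β
  κ0 : 0 ≤ κ
  pu : p ≤ 1 - r ^ 2
  pl : 1 - r - r ^ 2 ≤ (1 - r) * p

variable {r p ρ χ υ τ ζ β κ : ℝ}

theorem Core.step1 (h : Core r p ρ χ υ τ ζ β κ) : ρ * (β - (1 - r - r ^ 2)) ≤ r := by
  have h1 := h.hχ
  have h2 := h.hυ
  have h3 := h.hsum
  have h4 := h.pu
  nlinarith

theorem Core.step2 (h : Core r p ρ χ υ τ ζ β κ) : 0.5112 * p ≤ 0.35 + 0.6 * ρ := by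
  have h1 := cs_lin (s := 0.7) (by linarith [h.ρ1]) h.τ0 (by norm_num) h.cs1
  have h2 := cs_lin (s := 1.9) h.ρ0 h.ζ0 (by norm_num) h.cs2
  have h3 := h.hsum
  have h4 := h.hτζ
  have h5 := h.hτ2
  have h6 := h.τ0
  norm_num at h1 h2 ⊢
  linarith

theorem Core.step3 (h : Core r p ρ χ υ τ ζ β κ) :
    (β - 1 + r ^ 2) * (1 - r - r ^ 2) ^ 2 ≤ κ * (β ^ 2 * (β - (1 - r - r ^ 2))) := by
  have h1 := h.step1
  have h2 := h.hlow
  have h3 := h.hτ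
  have h4 := h.β1
  have h0 := h.r0
  have hb : 0 ≤ β - (1 - r - r ^ 2) := by nlinarith
  calc (β - 1 + r ^ 2) * (1 - r - r ^ 2) ^ 2 ≤ ((1 - ρ) * (β - (1 - r - r ^ 2))) * (1 - r - r ^ 2) ^ 2 := by
        refine mul_le_mul_of_nonneg_right ?_ (sq_nonneg _)
        linarith
    _ = ((1 - ρ) * (1 - r - r ^ 2) ^ 2) * (β - (1 - r - r ^ 2)) := by ring
    _ ≤ (κ * β ^ 2) * (β - (1 - r - r ^ 2)) := mul_le_mul_of_nonneg_right (h2.trans h3) hb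
    _ = _ := by ring

theorem Core.false_big (h : Core r p ρ χ υ τ ζ β κ) (hr : r ≤ 1 / 4) (hβ : 2 ≤ β) : False := by
  have h1 := h.step1
  have h2 := h.step2
  have h0 := h.r0
  have h3 := h.pl
  have hρ : ρ * 21 ≤ 4 := by
    have h5 := h.ρ0
    have h6 : ρ * (1 + r + r ^ 2) ≤ r := by
      refine le_trans (mul_le_mul_of_nonneg_left ?_ h5) h1
      linarith
    have h7 : 21 * r ≤ 4 * (1 + r + r ^ 2) := by nlinarith
    have h8 : 0 < 1 + r + r ^ 2 := by positivity
    by_contra hc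
    push Not at hc
    nlinarith
  have hp : 11 / 12 ≤ p := by
    by_contra hc
    push Not at hc
    have : (1 - r) * p < (1 - r) * (11 / 12) := mul_lt_mul_of_pos_left hc (by linarith)
    nlinarith
  linarith

theorem Core.false_small (h : Core r p ρ χ υ τ ζ β κ) (hβ : β ≤ 2)
    (c1 : κ * (r * (1 + r)) < r ^ 2 * (1 - r - r ^ 2) ^ 2)
    (c2 : κ * (4 * (1 + r + r ^ 2)) < (1 + r ^ 2) * (1 - r - r ^ 2) ^ 2) : False := by
  have h3 := h.step3
  have h1 := h.β1
  have h0 := h.r0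
  obtain ⟨t, rfl⟩ : ∃ t, β = 1 + t := ⟨β - 1, by ring⟩
  have ht0 : 0 ≤ t := by linarith
  have ht1 : t ≤ 1 := by linarith
  have h4 : (1 + t) ^ 2 * ((1 + t) - (1 - r - r ^ 2)) ≤ (1 - t) * (r * (1 + r)) + t * (4 * (1 + r + r ^ 2)) := by
    have e1 : t * t ≤ t := by nlinarith
    have e2 : t * t * t ≤ t := by nlinarith [mul_nonneg ht0 ht0]
    have e3 : r * (t * t) ≤ r * t := mul_le_mul_of_nonneg_left e1 h0.le
    have e4 : r ^ 2 * (t * t) ≤ r ^ 2 * t := mul_le_mul_of_nonneg_left e1 (sq_nonneg r)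
    nlinarith
  have h5 := mul_le_mul_of_nonneg_left h4 h.κ0
  rcases eq_or_lt_of_le ht0 with h6 | h6
  · rw [← h6] at h3 h5
    nlinarith
  · have h7 := mul_lt_mul_of_pos_left c2 h6
    have h8 := mul_le_mul_of_nonneg_left c1.le (by linarith : (0:ℝ) ≤ 1 - t)
    nlinarith

theorem Core.false3 (h : Core (1/3) p ρ χ υ τ ζ β κ) (hκ : κ ≤ 1 / 10000) : False := by
  have h1 := h.step1
  have h2 := h.step2
  have h3 := h.step3
  have h4 := h.pl
  have h5 := h.ρ0
  have h6 := h.β1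
  have h7 := h.κ0
  norm_num at h1 h2 h3 h4
  rcases le_total β 4 with hb | hb
  · have : β ^ 2 * (β - 5 / 9) ≤ 64 := by nlinarith
    have h0 : 0 ≤ β ^ 2 * (β - 5 / 9) := mul_nonneg (sq_nonneg _) (by linarith)
    nlinarith
  · have : ρ * (4 - 5 / 9) ≤ 1 / 3 := le_trans (mul_le_mul_of_nonneg_left (by linarith) h5) h1
    linarith

theorem Core.falseA (h : Core r p ρ χ υ τ ζ β κ) (hr : r ≤ 1 / 4) (hκ : κ ≤ r ^ 2 * (1 - r)) : False := by
  rcases le_total 2 β with hb | hb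
  · exact h.false_big hr hb
  have h0 := h.r0
  have hf : 11 / 16 ≤ 1 - r - r ^ 2 := by nlinarith
  have hf2 : 121 / 256 ≤ (1 - r - r ^ 2) ^ 2 := by nlinarith
  refine h.false_small hb ?_ ?_
  · calc κ * (r * (1 + r)) ≤ (r ^ 2 * (1 - r)) * (r * (1 + r)) := mul_le_mul_of_nonneg_right hκ (by positivity)
      _ = r ^ 2 * (r * (1 - r ^ 2)) := by ring
      _ < _ := mul_lt_mul_of_pos_left (by nlinarith) (by positivity)
  · have : κ ≤ 1 / 16 := by nlinarith
    nlinarith [h.κ0]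

theorem Core.falseB (h : Core r p ρ χ υ τ ζ β κ) (hr : r ≤ 1 / 5) (hκ : κ ≤ r ^ 2) : False := by
  rcases le_total 2 β with hb | hb
  · exact h.false_big (by linarith) hb
  have h0 := h.r0
  have hf : 19 / 25 ≤ 1 - r - r ^ 2 := by nlinarith
  have hf2 : 361 / 625 ≤ (1 - r - r ^ 2) ^ 2 := by nlinarith
  refine h.false_small hb ?_ ?_
  · calc κ * (r * (1 + r)) ≤ (r ^ 2) * (r * (1 + r)) := mul_le_mul_of_nonneg_right hκ (by positivity)
      _ < _ := mul_lt_mul_of_pos_left (by nlinarith) (by positivity)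
  · have : κ ≤ 1 / 25 := by nlinarith
    nlinarith [h.κ0]

theorem Core.falseC (h : Core r p ρ χ υ τ ζ β κ) (hr : r ≤ 1 / 7) (hκ : κ ≤ 3 * r ^ 2) : False := by
  rcases le_total 2 β with hb | hb
  · exact h.false_big (by linarith) hb
  have h0 := h.r0
  have hf : 41 / 49 ≤ 1 - r - r ^ 2 := by nlinarith
  have hf2 : 1681 / 2401 ≤ (1 - r - r ^ 2) ^ 2 := by nlinarith
  refine h.false_small hb ?_ ?_
  · calc κ * (r * (1 + r)) ≤ (3 * r ^ 2) * (r * (1 + r)) := mul_le_mul_of_nonneg_right hκ (by positivity)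
      _ = r ^ 2 * (3 * (r * (1 + r))) := by ring
      _ < _ := mul_lt_mul_of_pos_left (by nlinarith) (by positivity)
  · have : κ ≤ 3 / 49 := by nlinarith
    nlinarith [h.κ0]

end PSLeps
end

section
namespace PSLeps
open Matrix

noncomputable def phi (r : ℝ) (m : ℕ) : ℝ := ∏ i ∈ Finset.range m, (1 - r ^ (i + 2))

theorem phi_low {r : ℝ} (h0 : 0 < r) (h1 : r < 1) (m : ℕ) :
    1 - r - r ^ 2 + r ^ (m + 2) ≤ (1 - r) * phi r m := by
  induction m with
  | zero => simp [phi]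
  | succ m ih =>
    rw [phi, Finset.prod_range_succ, ← phi, ← mul_assoc]
    have h2 : 0 < r ^ (m + 2) := by positivity
    have h3 : r ^ (m + 2) ≤ r ^ 2 := pow_le_pow_of_le_one h0.le h1.le (by omega)
    have h4 : r ^ (m + 2) ≤ 1 := pow_le_one₀ h0.le h1.le
    have h5 : r ^ (m + 1 + 2) = r * r ^ (m + 2) := by ring
    rw [h5]
    have h6 := mul_le_mul_of_nonneg_right ih (by linarith : 0 ≤ 1 - r ^ (m + 2))
    nlinarith

theorem phi_le_one {r : ℝ} (h0 : 0 < r) (h1 : r < 1) (m : ℕ) : phi r m ≤ 1 := by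
  refine Finset.prod_le_one (fun i _ => ?_) fun i _ => ?_
  · have : r ^ (i + 2) ≤ 1 := pow_le_one₀ h0.le h1.le
    linarith
  · have : 0 < r ^ (i + 2) := by positivity
    linarith

theorem phi_up {r : ℝ} (h0 : 0 < r) (h1 : r < 1) (m : ℕ) : phi r (m + 1) ≤ 1 - r ^ 2 := by
  rw [phi, Finset.prod_range_succ', zero_add]
  have h2 : ∏ i ∈ Finset.range m, (1 - r ^ (i + 1 + 2)) ≤ 1 := by
    refine Finset.prod_le_one (fun i _ => ?_) fun i _ => ?_
    · have : r ^ (i + 1 + 2) ≤ 1 := pow_le_one₀ h0.le h1.le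
      linarith
    · have : 0 < r ^ (i + 1 + 2) := by positivity
      linarith
  have h3 : r ^ 2 ≤ 1 := pow_le_one₀ h0.le h1.le
  exact mul_le_of_le_one_left (by linarith) h2

theorem tri_succ (m : ℕ) : (m + 1 + 1) * (m + 1) / 2 = (m + 1) * m / 2 + (m + 1) := by
  have : (m + 1 + 1) * (m + 1) = (m + 1) * m + (m + 1) * 2 := by ring
  rw [this, Nat.add_mul_div_right _ _ (by norm_num)]

theorem Aq_real {q : ℕ} (hq : 0 < q) (m : ℕ) :
    (Aq q m : ℝ) = phi (1 / q) m * ((q:ℝ) ^ m * (q:ℝ) ^ ((m+1)*m/2)) := by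
  have hq0 : (q:ℝ) ≠ 0 := by exact_mod_cast hq.ne'
  induction m with
  | zero => simp [Aq, phi]
  | succ m ih =>
    have h1 : 1 ≤ q ^ (m + 2) := Nat.one_le_pow _ _ hq
    have h2 : phi (1 / (q:ℝ)) (m+1) = phi (1 / (q:ℝ)) m * (1 - 1 / (q:ℝ) ^ (m+2)) := by
      rw [phi, Finset.prod_range_succ, ← phi, _root_.one_div_pow]
    rw [Aq, Finset.prod_range_succ, ← Aq, Nat.cast_mul, ih, h2, Nat.cast_sub h1,
      tri_succ, pow_add _ ((m+1)*m/2)]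
    push_cast
    field_simp
    ring

theorem Pq_real {q : ℕ} (hq : 0 < q) (m : ℕ) :
    (Pq q (m+1) : ℝ) = (1 - 1 / q) * phi (1 / q) m * ((q:ℝ) ^ ((m+1+1)*(m+1)/2)) := by
  have hq0 : (q:ℝ) ≠ 0 := by exact_mod_cast hq.ne'
  have h1 : Pq q (m+1) = (q - 1) * Aq q m := by
    rw [Pq, Finset.prod_range_succ', Aq, mul_comm]; simp
  rw [h1, Nat.cast_mul, Aq_real hq, Nat.cast_sub hq, tri_succ, pow_add]
  push_cast
  field_simp
  ring

set_option maxHeartbeats 1000000 in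
theorem Dat.core {q m b S : ℕ} (hq : 2 ≤ q) (X : Dat q (m+1) b S) (hS : S ≤ b ^ 2) :
    ∃ p ρ χ υ τ ζ β : ℝ, Core (1 / q) p ρ χ υ τ ζ β (X.g / (q:ℝ) ^ (m+1)) := by
  obtain ⟨R, x, y, T, Z, h1, h2, h3, h4, h5, h6, h7, h8, h9, h10, -, -⟩ := X.ext'
  have hmm := X.mm_pos (by omega)
  have hq0 : (0:ℝ) < q := by exact_mod_cast (by omega : 0 < q)
  have hr0 : (0:ℝ) < 1 / q := by positivity
  have hr1 : (1:ℝ) / q < 1 := by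
    rw [div_lt_one hq0]; exact_mod_cast (by omega : 1 < q)
  have hD : (0:ℝ) < (q:ℝ) ^ (m+1) := by positivity
  have hA := Aq_real (by omega : 0 < q) (m+1)
  have hPi := Pq_real (by omega : 0 < q) m
  have hQb : ((q:ℝ) ^ ((m+1+1)*(m+1)/2)) ≤ b := by exact_mod_cast X.hQ
  have hPA : (X.P:ℝ) = (q:ℝ) ^ ((m+1+1)*(m+1)/2) * Aq q (m+1) := by exact_mod_cast X.hPA
  have hQ : (0:ℝ) < (q:ℝ) ^ ((m+1+1)*(m+1)/2) := by positivity
  have hlo := phi_low hr0 hr1 m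
  have hlo1 := phi_low hr0 hr1 (m+1)
  have e1 : (0:ℝ) < (1 / q) ^ (m + 2) := by positivity
  have e2 : (0:ℝ) < (1 / q) ^ (m + 1 + 2) := by positivity
  have hup := phi_up hr0 hr1 m
  set D : ℝ := (q:ℝ) ^ (m+1) with hDd
  set Q : ℝ := (q:ℝ) ^ ((m+1+1)*(m+1)/2) with hQd
  set p := phi (1 / (q:ℝ)) (m+1) with hp
  set f : ℝ := 1 - 1 / (q:ℝ) - (1 / (q:ℝ)) ^ 2 with hf
  have hfPi : f * Q ≤ Pq q (m+1) := by
    rw [hPi]; exact mul_le_mul_of_nonneg_right (by linarith) hQ.le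
  have hf0 : 0 ≤ f := by
    have h2 : (1:ℝ) / q ≤ 1 / 2 := by
      apply one_div_le_one_div_of_le (by norm_num); exact_mod_cast hq
    rw [hf]; nlinarith
  have hDR : ((q ^ (m+1) - R : ℕ) : ℝ) = D - R := by rw [Nat.cast_sub h1, hDd]; push_cast; rfl
  have hRD : (R:ℝ) ≤ D := by rw [hDd]; exact_mod_cast h1
  have h2' : (R:ℝ) * b ≤ x := by exact_mod_cast h2
  have h3' : (D - R) * (Pq q (m+1) : ℝ) ≤ y := by rw [← hDR]; exact_mod_cast h3
  have h4' : (x:ℝ) + y = p * (D * Q) := by rw [← hA]; exact_mod_cast h4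
  have h5' : (y:ℝ) ^ 2 ≤ (D - R) * T := by rw [← hDR]; exact_mod_cast h5
  have h6' : (x:ℝ) ^ 2 ≤ R * Z := by exact_mod_cast h6
  have h7' : (T:ℝ) + Z ≤ p * (D * Q ^ 2) := by
    have : (T:ℝ) + Z ≤ X.P := by exact_mod_cast h7
    rw [hPA, hA] at this; linarith
  have h8' : (T:ℝ) ≤ X.g * b ^ 2 := by
    have : T ≤ X.g * b ^ 2 := h8.trans (Nat.mul_le_mul_left _ hS)
    exact_mod_cast this
  have h10' : (D - R) * (Pq q (m+1) : ℝ) ^ 2 ≤ T := by rw [← hDR]; exact_mod_cast h10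
  have hT2 : 2 * (T:ℝ) ≤ p * (D * Q ^ 2) := by
    have h11 : 2 * S ≤ X.G := by
      have h13 := X.hS
      have h14 : b ^ 2 ≤ X.mm * b ^ 2 := Nat.le_mul_of_pos_left _ hmm
      omega
    have h12 : 2 * T ≤ X.P := by
      rw [X.hPG]
      calc 2 * T ≤ 2 * (X.g * S) := Nat.mul_le_mul_left _ h8
        _ = X.g * (2 * S) := by ring
        _ ≤ _ := Nat.mul_le_mul_left _ h11
    have : 2 * (T:ℝ) ≤ X.P := by exact_mod_cast h12
    rw [hPA, hA] at this; linarith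
  have hDRn : 0 ≤ D - R := by linarith
  have hk : ∀ a c : ℝ, a / D ≤ c ↔ a ≤ c * D := fun a c => div_le_iff₀ hD
  refine ⟨p, R / D, x / (D * Q), y / (D * Q), T / (D * Q ^ 2), Z / (D * Q ^ 2), b / Q, ?_⟩
  have e : 1 - (R:ℝ) / D = (D - R) / D := by field_simp
  refine ⟨hr0, by positivity, ?_, ?_, ?_, ?_, ?_, ?_, by positivity, by positivity, ?_, ?_, ?_, ?_, ?_, by positivity,
    hup, by linarith⟩
  · rw [div_le_one hD]; exact hRD
  · rw [div_mul_div_comm]; exact div_le_div_of_nonneg_right h2' (by positivity)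
  · rw [e, ← hf, le_div_iff₀ (by positivity)]
    calc (D - R) / D * f * (D * Q) = (D - R) * (f * Q) := by field_simp
      _ ≤ (D - R) * Pq q (m+1) := mul_le_mul_of_nonneg_left hfPi hDRn
      _ ≤ _ := h3'
  · rw [← add_div, h4']; field_simp
  · rw [e, div_pow, div_mul_div_comm, div_le_div_iff₀ (by positivity) (by positivity)]
    calc (y:ℝ) ^ 2 * (D * (D * Q ^ 2)) ≤ ((D - R) * T) * (D * (D * Q ^ 2)) :=
          mul_le_mul_of_nonneg_right h5' (by positivity)
      _ = _ := by ring
  · rw [div_pow, div_mul_div_comm, div_le_div_iff₀ (by positivity) (by positivity)]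
    calc (x:ℝ) ^ 2 * (D * (D * Q ^ 2)) ≤ (R * Z) * (D * (D * Q ^ 2)) :=
          mul_le_mul_of_nonneg_right h6' (by positivity)
      _ = _ := by ring
  · rw [← add_div, div_le_iff₀ (by positivity)]; exact h7'
  · rw [e, ← hf, le_div_iff₀ (by positivity)]
    calc (D - R) / D * f ^ 2 * (D * Q ^ 2) = (D - R) * (f * Q) ^ 2 := by field_simp
      _ ≤ (D - R) * (Pq q (m+1) : ℝ) ^ 2 :=
        mul_le_mul_of_nonneg_left (pow_le_pow_left₀ (by positivity) hfPi 2) hDRn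
      _ ≤ _ := h10'
  · rw [div_le_iff₀ (by positivity)]
    refine h8'.trans (le_of_eq ?_)
    field_simp
  · rw [← mul_div_assoc, div_le_iff₀ (by positivity)]; exact hT2
  · rw [one_le_div hQ]; exact hQb

theorem general {q m b S : ℕ} (hq : 3 ≤ q) (X : Dat q (m+1) b S)
    (h : (q = 3 ∧ 13 ≤ m) ∨ (4 ≤ q ∧ 2 ≤ m) ∨ (5 ≤ q ∧ m = 1)) : b ^ 2 < S := by
  by_contra hS
  push Not at hS
  obtain ⟨p, ρ, χ, υ, τ, ζ, β, hc⟩ := X.core (by omega) hS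
  have hgq := Nat.le_of_dvd (by omega) X.hg2
  have hq0 : (0:ℝ) < q := by exact_mod_cast (by omega : 0 < q)
  have hr0 : (0:ℝ) < 1 / q := by positivity
  have hg0 : (0:ℝ) ≤ X.g := Nat.cast_nonneg _
  have hinv : ∀ k : ℕ, (X.g:ℝ) / (q:ℝ) ^ k = X.g * (1 / q) ^ k := fun k => by
    rw [one_div, inv_pow, div_eq_mul_inv]
  have hr : ∀ k : ℕ, 0 < k → k ≤ q → (1:ℝ) / q ≤ 1 / k := fun k h0 h => by
    apply one_div_le_one_div_of_le
    · exact_mod_cast h0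
    · exact_mod_cast h
  rcases h with ⟨rfl, hm⟩ | ⟨h4, hm⟩ | ⟨h5, rfl⟩
  · push_cast at hc
    refine hc.false3 ?_
    have h2 : (X.g:ℝ) ≤ 2 := by exact_mod_cast hgq
    have h3 : (3:ℝ) ^ 14 ≤ 3 ^ (m+1) := pow_le_pow_right₀ (by norm_num) (by omega)
    calc (X.g:ℝ) / 3 ^ (m+1) ≤ 2 / 3 ^ 14 := div_le_div₀ (by norm_num) h2 (by positivity) h3
      _ ≤ _ := by norm_num
  · refine hc.falseA (by have := hr 4 (by norm_num) h4; exact_mod_cast this) ?_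
    have h2 : (X.g:ℝ) ≤ q - 1 := by
      have : X.g + 1 ≤ q := by omega
      have : (X.g:ℝ) + 1 ≤ q := by exact_mod_cast this
      linarith
    rw [hinv]
    have h3 : (1 / (q:ℝ)) ^ (m+1) ≤ (1 / (q:ℝ)) ^ 3 :=
      pow_le_pow_of_le_one hr0.le ((hr 1 (by norm_num) (by omega)).trans (by norm_num)) (by omega)
    calc (X.g:ℝ) * (1 / (q:ℝ)) ^ (m+1) ≤ (q - 1) * (1 / (q:ℝ)) ^ 3 :=
          mul_le_mul h2 h3 (by positivity) (by linarith)
      _ = _ := by field_simp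
  · rw [hinv] at hc
    have hg1 := X.hg1
    have hg2 := X.hg2
    have hg3 := Nat.le_of_dvd (by norm_num) hg1
    by_cases h7 : 7 ≤ q
    · refine hc.falseC (by have := hr 7 (by norm_num) h7; exact_mod_cast this) ?_
      refine mul_le_mul_of_nonneg_right ?_ (by positivity)
      exact_mod_cast hg3
    · refine hc.falseB (by have := hr 5 (by norm_num) h5; exact_mod_cast this) ?_
      have : X.g = 1 := by
        have hq56 : q = 5 ∨ q = 6 := by omega
        have h1 : X.g ∣ 3 := hg1
        rcases (Nat.dvd_prime Nat.prime_three).1 h1 with h | h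
        · exact h
        · rw [h] at hg2; omega
      rw [this, Nat.cast_one, one_mul]

end PSLeps
end

section
namespace PSLeps
open Matrix

theorem chk33b : ((List.range 75).all fun b => (List.range 8).all fun mm => (List.range 10).all fun R =>
    !(Nat.ble 27 b && Nat.ble 1 mm && Nat.ble (mm * (b * b)) 5616 && Nat.ble (5616 - mm * (b * b)) (b * b) &&
      Nat.ble R mm && Nat.ble (R * b + (9 - R) * 16) 208 && Nat.ble ((9 - R) * 256) (5616 - mm * (b * b)) &&
      Nat.ble ((208 - mm * b) * (208 - mm * b)) ((9 - R) * (5616 - mm * (b * b)))) || Nat.beq R 0) = true := by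
  decide +kernel

theorem chk33 : ∀ b < 75, ∀ mm < 8, ∀ R < 10, 27 ≤ b → 1 ≤ mm → mm * b ^ 2 ≤ 5616 →
    5616 - mm * b ^ 2 ≤ b ^ 2 → R ≤ mm → R * b + (9 - R) * 16 ≤ 208 → (9 - R) * 256 ≤ 5616 - mm * b ^ 2 →
    (208 - mm * b) ^ 2 ≤ (9 - R) * (5616 - mm * b ^ 2) → R = 0 := by
  intro b hb mm hm R hR a1 a2 a3 a4 a5 a6 a7 a8
  have h := List.all_eq_true.1 chk33b b (List.mem_range.2 hb)
  have h := List.all_eq_true.1 h mm (List.mem_range.2 hm)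
  have h := List.all_eq_true.1 h R (List.mem_range.2 hR)
  rw [pow_two] at a3 a4 a7 a8
  rw [pow_two] at a8
  rw [Bool.or_eq_true] at h
  rcases h with h | h
  · rw [Nat.ble_eq_true_of_le a1, Nat.ble_eq_true_of_le a2, Nat.ble_eq_true_of_le a3, Nat.ble_eq_true_of_le a4,
      Nat.ble_eq_true_of_le a5, Nat.ble_eq_true_of_le a6, Nat.ble_eq_true_of_le a7, Nat.ble_eq_true_of_le a8] at h
    simp at h
  · exact Nat.eq_of_beq_eq_true h

theorem chk34b : ((List.range 142).all fun b => (List.range 5).all fun mm => (List.range 17).all fun R =>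
    !(Nat.ble 64 b && Nat.ble 1 mm && Nat.ble (mm * (b * b)) 20160 && Nat.ble (20160 - mm * (b * b)) (b * b) &&
      Nat.ble R (3 * mm) && Nat.ble (R * b + (16 - R) * 45) 945 &&
      Nat.ble ((16 - R) * 2025) (3 * (20160 - mm * (b * b))) &&
      Nat.ble ((945 - 3 * mm * b) * (945 - 3 * mm * b)) ((16 - R) * (3 * (20160 - mm * (b * b))))) ||
    ((Nat.beq b 64 && Nat.beq mm 4 && Nat.beq R 11) ||
      ((Nat.beq b 101 || Nat.beq b 102) && Nat.beq mm 1 && Nat.beq R 2))) = true := by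
  decide +kernel

theorem chk34 : ∀ b < 142, ∀ mm < 5, ∀ R < 17, 64 ≤ b → 1 ≤ mm → mm * b ^ 2 ≤ 20160 →
    20160 - mm * b ^ 2 ≤ b ^ 2 → R ≤ 3 * mm → R * b + (16 - R) * 45 ≤ 945 →
    (16 - R) * 2025 ≤ 3 * (20160 - mm * b ^ 2) →
    (945 - 3 * mm * b) ^ 2 ≤ (16 - R) * (3 * (20160 - mm * b ^ 2)) →
    (b = 64 ∧ mm = 4 ∧ R = 11) ∨ ((b = 101 ∨ b = 102) ∧ mm = 1 ∧ R = 2) := by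
  intro b hb mm hm R hR a1 a2 a3 a4 a5 a6 a7 a8
  have h := List.all_eq_true.1 chk34b b (List.mem_range.2 hb)
  have h := List.all_eq_true.1 h mm (List.mem_range.2 hm)
  have h := List.all_eq_true.1 h R (List.mem_range.2 hR)
  rw [pow_two] at a3 a4 a7 a8
  rw [pow_two] at a8
  rw [Bool.or_eq_true] at h
  rcases h with h | h
  · rw [Nat.ble_eq_true_of_le a1, Nat.ble_eq_true_of_le a2, Nat.ble_eq_true_of_le a3, Nat.ble_eq_true_of_le a4,
      Nat.ble_eq_true_of_le a5, Nat.ble_eq_true_of_le a6, Nat.ble_eq_true_of_le a7, Nat.ble_eq_true_of_le a8] at h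
    simp at h
  · simp only [Bool.or_eq_true, Bool.and_eq_true, Nat.beq_eq, and_assoc] at h
    exact h

theorem case33 {b S : ℕ} (X : Dat 3 2 b S) : b ^ 2 < S := by
  by_contra hS
  push Not at hS
  obtain ⟨R, x, y, T, Z, h1, h2, h3, h4, h5, h6, h7, h8, h9, h10, h11, -⟩ := X.ext'
  have hmm := X.mm_pos (by omega)
  have hA : Aq 3 2 = 208 := by decide
  have hPi : Pq 3 2 = 16 := by decide
  have hg : X.g = 1 := by
    have a1 : X.g ∣ 3 := X.hg1
    have a2 : X.g ∣ 2 := X.hg2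
    have := Nat.dvd_sub a1 a2
    exact Nat.dvd_one.1 this
  have hP := X.hPA
  have hPG := X.hPG
  have hG := X.hS
  have hQ := X.hQ
  rw [hg] at h8 hPG h11
  rw [hA] at hP h4
  rw [hPi] at h3 h10
  norm_num at hP hQ h1 h3 h5 h10
  rw [one_mul] at h8 hPG h11
  generalize X.mm = mm at *
  have hG' : S + mm * b ^ 2 = 5616 := by rw [hG, ← hPG, hP]
  rw [hP] at h7
  have hS' : S = 5616 - mm * b ^ 2 := by omega
  have hb2 : b ^ 2 ≤ mm * b ^ 2 := Nat.le_mul_of_pos_left _ hmm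
  have hb : b < 75 := by
    by_contra hc; push Not at hc
    have := Nat.pow_le_pow_left hc 2
    omega
  have hmm8 : mm < 8 := by
    by_contra hc; push Not at hc
    have := Nat.mul_le_mul hc (Nat.pow_le_pow_left hQ 2)
    omega
  have hRm : R ≤ mm := Nat.le_of_mul_le_mul_right (h2.trans h11) (by omega)
  have hR0 := chk33 b hb mm hmm8 R (by omega) hQ hmm (by omega) (by omega) hRm (by omega) (by omega) (by
    rw [← hS']
    calc (208 - mm * b) ^ 2 ≤ y ^ 2 := Nat.pow_le_pow_left (by omega) 2
      _ ≤ (9 - R) * T := h5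
      _ ≤ _ := Nat.mul_le_mul_left _ h8)
  subst hR0
  have hx : x = 0 := by
    have : x ^ 2 = 0 := by omega
    exact pow_eq_zero_iff (by norm_num) |>.1 this
  have hy : y = 208 := by omega
  subst hy
  omega

theorem case34 {b S : ℕ} (X : Dat 4 2 b S) : b ^ 2 < S := by
  by_contra hS
  push Not at hS
  by_cases hg : X.g = 3
  swap
  · -- then the divisor is one and the generic argument applies
    have hg1 : X.g = 1 := by
      have a1 : X.g ∣ 3 := X.hg1
      exact ((Nat.dvd_prime Nat.prime_three).1 a1).resolve_right hg
    obtain ⟨p, ρ, χ, υ, τ, ζ, β, hc⟩ := X.core (by omega) hS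
    rw [hg1] at hc
    push_cast at hc
    rcases le_total 2 β with hb | hb
    · exact hc.false_big (by norm_num) hb
    · exact hc.false_small hb (by norm_num) (by norm_num)
  obtain ⟨R, x, y, T, Z, h1, h2, h3, h4, h5, h6, h7, h8, h9, h10, h11, hRc⟩ := X.ext'
  have hmm := X.mm_pos (by omega)
  have hA : Aq 4 2 = 945 := by decide
  have hPi : Pq 4 2 = 45 := by decide
  have hP := X.hPA
  have hPG := X.hPG
  have hG := X.hS
  have hQ := X.hQ
  have hR := X.hR
  have hT := X.hT
  rw [hg] at h8 hPG h11 hR hT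
  rw [hA] at hP h4
  rw [hPi] at h3 h10
  norm_num at hP hQ h1 h3 h5 h10
  generalize X.mm = mm at *
  have hG' : S + mm * b ^ 2 = 20160 := by omega
  rw [hP] at h7
  have hS' : S = 20160 - mm * b ^ 2 := by omega
  have hb2 : b ^ 2 ≤ mm * b ^ 2 := Nat.le_mul_of_pos_left _ hmm
  have hb : b < 142 := by
    by_contra hc; push Not at hc
    have := Nat.pow_le_pow_left hc 2
    omega
  have hmm8 : mm < 5 := by
    by_contra hc; push Not at hc
    have := Nat.mul_le_mul hc (Nat.pow_le_pow_left hQ 2)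
    omega
  have h11' : x ≤ 3 * mm * b := by rw [mul_assoc]; exact h11
  have hRm : R ≤ 3 * mm := Nat.le_of_mul_le_mul_right (h2.trans h11') (by omega)
  have key := chk34 b hb mm hmm8 R (by omega) hQ hmm (by omega) (by omega) hRm (by omega) (by omega) (by
    rw [← hS']
    calc (945 - 3 * mm * b) ^ 2 ≤ y ^ 2 := Nat.pow_le_pow_left (by omega) 2
      _ ≤ (16 - R) * T := h5
      _ ≤ _ := Nat.mul_le_mul_left _ h8)
  rcases key with ⟨rfl, rfl, rfl⟩ | ⟨hb', rfl, rfl⟩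
  · norm_num at hS' hR h3 h5 h8
    subst hS'
    norm_num at hT h8
    by_cases hsub : X.I1 ⊆ X.I
    · have hI : X.I ∩ X.I1 = X.I1 := Finset.inter_eq_right.2 hsub
      rw [hI] at hRc
      have hx : ∑ i ∈ X.I1, X.d i ≤ 720 := by
        have e1 := Finset.sum_sdiff (f := X.d) hsub
        rw [X.hIA, hA] at e1
        have e2 : (X.I \ X.I1).card = 5 := by
          rw [Finset.card_sdiff_of_subset hsub, X.hI, ← hRc]; norm_num
        have e3 : 5 * 45 ≤ ∑ i ∈ X.I \ X.I1, X.d i := by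
          rw [← e2, ← smul_eq_mul, ← hPi]
          exact Finset.card_nsmul_le_sum _ _ _ fun i hi => X.hId i (Finset.mem_sdiff.1 hi).1
        omega
      have hd : ∀ i ∈ X.I1, X.d i ≤ 80 := by
        intro i hi
        have e1 := Finset.sum_erase_add X.I1 X.d hi
        have e2 : (X.I1.erase i).card = 10 := by rw [Finset.card_erase_of_mem hi, ← hRc]
        have e3 : 10 * 64 ≤ ∑ j ∈ X.I1.erase i, X.d j := by
          rw [← e2, ← smul_eq_mul]
          exact Finset.card_nsmul_le_sum _ _ _ fun j hj => X.hI1 j (Finset.mem_of_mem_erase hj)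
        omega
      have hsq : ∑ i ∈ X.I1, X.d i ^ 2 + ∑ i ∈ X.I1, 5120 ≤ ∑ i ∈ X.I1, 144 * X.d i := by
        rw [← Finset.sum_add_distrib]
        refine Finset.sum_le_sum fun i hi => ?_
        have e1 := hd i hi
        have e2 := X.hI1 i hi
        nlinarith
      rw [← Finset.mul_sum, Finset.sum_const, ← hRc, smul_eq_mul] at hsq
      have e4 := Finset.sum_sdiff (f := fun i => X.d i ^ 2) (Finset.subset_univ X.I1)
      rw [X.hsum, hP] at e4
      omega
    · obtain ⟨i0, hi0, hn⟩ := Finset.not_subset.1 hsub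
      have e1 : ∑ i ∈ X.I ∩ X.I1, X.d i + X.d i0 ≤ ∑ i ∈ X.I1, X.d i := by
        rw [← Finset.sum_erase_add X.I1 X.d hi0]
        refine Nat.add_le_add_right (Finset.sum_le_sum_of_subset fun i hi => ?_) _
        rw [Finset.mem_inter] at hi
        exact Finset.mem_erase.2 ⟨fun e => hn (e ▸ hi.1), hi.2⟩
      have e2 := X.hI1 i0 hi0
      have e3 : 241 ≤ ∑ i ∈ X.I \ X.I1, X.d i := by
        have e4 := Finset.sum_inter_add_sum_sdiff X.I X.I1 X.d
        rw [X.hIA, hA] at e4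
        omega
      have e5 : (∑ i ∈ X.I \ X.I1, X.d i) ^ 2 ≤ (X.I \ X.I1).card * ∑ i ∈ X.I \ X.I1, X.d i ^ 2 :=
        sq_sum_le_card_mul_sum_sq
      have e6 : (X.I \ X.I1).card = 5 := by
        have := Finset.card_inter_add_card_sdiff X.I X.I1
        rw [X.hI, ← hRc] at this; omega
      have e7 : ∑ i ∈ X.I \ X.I1, X.d i ^ 2 ≤ ∑ i ∈ Finset.univ \ X.I1, X.d i ^ 2 :=
        Finset.sum_le_sum_of_subset (Finset.sdiff_subset_sdiff (Finset.subset_univ _) subset_rfl)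
      have e8 := Nat.pow_le_pow_left e3 2
      rw [e6] at e5
      omega
  · have hy : 639 ≤ y := by omega
    have hy2 := Nat.pow_le_pow_left hy 2
    norm_num at h5 h6
    have hx : x ≤ 250 := by
      by_contra hc
      have := Nat.pow_le_pow_left (by omega : 251 ≤ x) 2
      omega
    have hy3 := Nat.pow_le_pow_left (by omega : 695 ≤ y) 2
    have hS2 : S ≤ 9959 := by
      rcases hb' with rfl | rfl <;> omega
    omega

theorem case43 {b S : ℕ} (X : Dat 3 3 b S) : b ^ 2 < S := by
  by_contra hS
  push Not at hS
  obtain ⟨R, x, y, T, Z, h1, h2, h3, h4, h5, h6, h7, h8, h9, h10, h11, -⟩ := X.ext'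
  have hmm := X.mm_pos (by omega)
  have hA : Aq 3 3 = 16640 := by decide
  have hPi : Pq 3 3 = 416 := by decide
  have hg : X.g ≤ 2 := Nat.le_of_dvd (by norm_num) X.hg2
  have hP := X.hPA
  have hPG := X.hPG
  have hG := X.hS
  have hQ := X.hQ
  rw [hA] at hP h4
  rw [hPi] at h3 h10
  norm_num at hP hQ h1 h3 h5 h10
  rw [hP] at h7 hPG
  generalize X.mm = mm at *
  generalize X.g = g at *
  have hRm : R ≤ g * mm := by
    rw [← mul_assoc] at h11
    exact Nat.le_of_mul_le_mul_right (h2.trans h11) (by omega)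
  have hT1 : T + g * mm * b ^ 2 ≤ 12130560 := by
    rw [hPG, ← hG]; nlinarith
  have hT2 : 2 * T ≤ 12130560 := by
    have : b ^ 2 ≤ mm * b ^ 2 := Nat.le_mul_of_pos_left _ hmm
    have : g * (2 * S) ≤ g * X.G := Nat.mul_le_mul_left _ (by omega)
    rw [← hPG] at this
    linarith
  have hT3 : T + R * b ^ 2 ≤ 12130560 := by
    have := Nat.mul_le_mul_right (b ^ 2) hRm
    omega
  have hT4 : T ≤ 2 * b ^ 2 := by
    calc T ≤ g * S := h8
      _ ≤ 2 * b ^ 2 := Nat.mul_le_mul hg hS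
  have k3 : (27 - (R:ℝ)) * 416 ≤ y := by
    have : ((27 - R : ℕ):ℝ) = 27 - R := by rw [Nat.cast_sub h1]; norm_num
    rw [← this]; exact_mod_cast h3
  have k10 : (27 - (R:ℝ)) * 173056 ≤ T := by
    have : ((27 - R : ℕ):ℝ) = 27 - R := by rw [Nat.cast_sub h1]; norm_num
    rw [← this]; exact_mod_cast h10
  have k5 : (y:ℝ) ^ 2 ≤ (27 - R) * T := by
    have : ((27 - R : ℕ):ℝ) = 27 - R := by rw [Nat.cast_sub h1]; norm_num
    rw [← this]; exact_mod_cast h5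
  have k6 : (x:ℝ) ^ 2 ≤ R * Z := by exact_mod_cast h6
  have k2 : (R:ℝ) * b ≤ x := by exact_mod_cast h2
  have k4 : (x:ℝ) + y = 16640 := by exact_mod_cast h4
  have k7 : (T:ℝ) + Z ≤ 12130560 := by exact_mod_cast h7
  have kT2 : 2 * (T:ℝ) ≤ 12130560 := by exact_mod_cast hT2
  have kT3 : (T:ℝ) + R * b ^ 2 ≤ 12130560 := by exact_mod_cast hT3
  have kT4 : (T:ℝ) ≤ 2 * b ^ 2 := by exact_mod_cast hT4
  have kQ : (729:ℝ) ≤ b := by exact_mod_cast hQ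
  have kR : (R:ℝ) ≤ 27 := by exact_mod_cast h1
  have kR0 : (0:ℝ) ≤ R := Nat.cast_nonneg _
  have kT0 : (0:ℝ) ≤ T := Nat.cast_nonneg _
  have kZ0 : (0:ℝ) ≤ Z := Nat.cast_nonneg _
  have kRb : (R:ℝ) * (b - 416) ≤ 5408 := by linarith
  clear h2 h3 h4 h5 h6 h7 h8 h9 h10 h11 hT1 hT2 hT3 hT4 hG hPG hP
  by_cases hb : b ≤ 1340
  · have kb : (b:ℝ) ≤ 1340 := by exact_mod_cast hb
    have e1 : (27 * (b:ℝ) - 16640) * 173056 ≤ 2 * b ^ 2 * (b - 416) := by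
      calc (27 * (b:ℝ) - 16640) * 173056 ≤ ((27 - R) * (b - 416)) * 173056 := by
            refine mul_le_mul_of_nonneg_right ?_ (by norm_num)
            linarith
        _ = ((27 - R) * 173056) * (b - 416) := by ring
        _ ≤ (2 * b ^ 2) * (b - 416) := mul_le_mul_of_nonneg_right (k10.trans kT4) (by linarith)
    generalize (b:ℝ) = B at *
    nlinarith [mul_nonneg (sub_nonneg.2 kQ) (sub_nonneg.2 kb), mul_nonneg (mul_nonneg (sub_nonneg.2 kQ) (sub_nonneg.2 kb)) (by linarith : (0:ℝ) ≤ B)]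
  · have kb : (1341:ℝ) ≤ b := by
      have : 1341 ≤ b := by omega
      exact_mod_cast this
    have hR5 : R ≤ 5 := by
      by_contra hc
      have : 6 ≤ R := by omega
      have : (6:ℝ) ≤ R := by exact_mod_cast this
      nlinarith
    have hbb : (1341:ℝ) ^ 2 ≤ b ^ 2 := pow_le_pow_left₀ (by norm_num) kb 2
    have hR0 : (0:ℝ) ≤ 27 - R := by linarith
    rcases (by omega : R ≤ 3 ∨ R = 4 ∨ R = 5) with h | h | h
    · have kR3 : (R:ℝ) ≤ 3 := by exact_mod_cast h
      have c1 := cs_lin (s := 503) hR0 kT0 (by norm_num) k5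
      have c2 := cs_lin (s := 1422) kR0 kZ0 (by norm_num) k6
      norm_num at c1 c2
      linarith
    · have kR3 : (R:ℝ) = 4 := by rw [h]; norm_num
      have c1 := cs_lin (s := 463) hR0 kT0 (by norm_num) k5
      have c2 := cs_lin (s := 1341) kR0 kZ0 (by norm_num) k6
      rw [kR3] at c1 c2 kT3
      norm_num at c1 c2 hbb
      linarith
    · have kR3 : (R:ℝ) = 5 := by rw [h]; norm_num
      have c1 := cs_lin (s := 378) hR0 kT0 (by norm_num) k5
      have c2 := cs_lin (s := 1341) kR0 kZ0 (by norm_num) k6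
      rw [kR3] at c1 c2 kT3
      norm_num at c1 c2 hbb
      linarith

end PSLeps
end

open Matrix in
theorem stmt3 (q n : ℕ) (hq : 3 ≤ q) (hn : 2 ≤ n)
    (F : Type) [Field F] [Fintype F] (hF : Fintype.card F = q)
    (h1 : ¬(n = 2 ∧ q = 3)) (h2 : ¬(q = 3 ∧ 5 ≤ n ∧ n ≤ 14)) :
    1 < epsG (ProjectiveSpecialLinearGroup (Fin n) F) := by
  obtain ⟨m, rfl⟩ : ∃ m, n = m + 1 := ⟨n - 1, by omega⟩
  obtain ⟨S, ⟨X⟩, he⟩ := PSLeps.exists_dat F m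
  have he' : epsG (ProjectiveSpecialLinearGroup (Fin (m + 1)) F) = _ := he
  rw [he']
  rw [hF] at X
  generalize maxIrrDeg (PSLeps.PS (m + 1) F) = b at X
  have hb : 0 < b := lt_of_lt_of_le (by positivity) X.hQ
  have key : b ^ 2 < S := by
    rcases (by omega : m = 1 ∨ m = 2 ∨ m = 3 ∨ 4 ≤ m) with h | h | h | h
    · subst h
      exact PSLeps.rank_one (by omega) X
    · subst h
      rcases (by omega : q = 3 ∨ q = 4 ∨ 5 ≤ q) with h | h | h
      · subst h; exact PSLeps.case33 X
      · subst h; exact PSLeps.case34 X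
      · exact PSLeps.general (m := 1) hq X (by omega)
    · subst h
      rcases (by omega : q = 3 ∨ 4 ≤ q) with h | h
      · subst h; exact PSLeps.case43 X
      · exact PSLeps.general (m := 2) hq X (by omega)
    · obtain ⟨k, rfl⟩ : ∃ k, m = k + 1 := ⟨m - 1, by omega⟩
      exact PSLeps.general hq X (by omega)
  rw [one_lt_div (by positivity)]
  exact_mod_cast key
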